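/- arXiv:0904.2068 — 7 statements merged into one kernel-verified Lean document; each statement's English description precedes it below -/
import Mathlib

section
/- Let I ⊆ ℝ be an open interval and let c : I → ℂ^n be a real-analytic curve with c(t) ∈ σ(ℂ^m) for all t ∈ I. Then every continuous lift c̄ : I → ℂ^m of c (σ ∘ c̄ = c) is locally absolutely continuous, i.e., absolutely continuous on every compact subinterval of I. -/
open MeasureTheory Set Filter
open scoped Topology Polynomial

/-- An integral element of a reduced algebra over a field of characteristic zero is a simple root
of its minimal polynomial. -/
theorem exists_aeval_eq_zero_and_aeval_derivative_isUnit {K A : Type*} [Field K] [CharZero K]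
    [CommRing A] [IsReduced A] [Algebra K A] {u : A} (hu : IsIntegral K u) :
    ∃ Q B : K[X], Polynomial.aeval u Q = 0 ∧
      Polynomial.aeval u B * Polynomial.aeval u (Polynomial.derivative Q) = 1 := by
  have hne := minpoly.ne_zero hu
  have hsq : Squarefree (minpoly K u) :=
    (isRadical_iff_squarefree_of_ne_zero hne).1 (minpoly.isRadical K u)
  obtain ⟨a, b, hab⟩ := PerfectField.separable_iff_squarefree.2 hsq
  refine ⟨minpoly K u, b, minpoly.aeval K u, ?_⟩
  have h := congrArg (Polynomial.aeval u) hab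
  simpa using h

theorem IsField.exists_aeval_eq_zero_and_aeval_derivative_isUnit {K A : Type*} [CommRing K]
    (hK : IsField K) [CharZero K] [CommRing A] [IsReduced A] [Algebra K A] {u : A}
    (hu : IsIntegral K u) :
    ∃ Q B : K[X], Polynomial.aeval u Q = 0 ∧
      Polynomial.aeval u B * Polynomial.aeval u (Polynomial.derivative Q) = 1 := by
  let := hK.toField
  exact _root_.exists_aeval_eq_zero_and_aeval_derivative_isUnit hu

instance Filter.Germ.instIsReduced {α R : Type*} [CommRing R] [IsReduced R] {l : Filter α} :
    IsReduced (Germ l R) := by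
  constructor
  rintro x ⟨n, hn⟩
  induction x using Germ.inductionOn with
  | h f =>
    rw [← Germ.coe_pow, ← Germ.coe_zero, Germ.coe_eq] at hn
    rw [← Germ.coe_zero, Germ.coe_eq]
    filter_upwards [hn] with t ht
    exact eq_zero_of_pow_eq_zero ht

/-- The germs along `l` of complex functions that are meromorphic at `t₀`. -/
def meromorphicGerms (t₀ : ℝ) (l : Filter ℝ) : Subring (Germ l ℂ) where
  carrier := {g | ∃ f : ℝ → ℂ, MeromorphicAt f t₀ ∧ (f : Germ l ℂ) = g}
  mul_mem' := by
    rintro _ _ ⟨f, hf, rfl⟩ ⟨g, hg, rfl⟩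
    exact ⟨f * g, hf.mul hg, rfl⟩
  one_mem' := ⟨1, MeromorphicAt.const 1 t₀, rfl⟩
  add_mem' := by
    rintro _ _ ⟨f, hf, rfl⟩ ⟨g, hg, rfl⟩
    exact ⟨f + g, hf.add hg, rfl⟩
  zero_mem' := ⟨0, MeromorphicAt.const 0 t₀, rfl⟩
  neg_mem' := by
    rintro _ ⟨f, hf, rfl⟩
    exact ⟨-f, hf.neg, rfl⟩

theorem mem_meromorphicGerms {t₀ : ℝ} {l : Filter ℝ} {f : ℝ → ℂ} (hf : MeromorphicAt f t₀) :
    (f : Germ l ℂ) ∈ meromorphicGerms t₀ l := ⟨f, hf, rfl⟩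

theorem isIntegral_coe_of_meromorphicAt {t₀ : ℝ} {l : Filter ℝ} {f : ℝ → ℂ}
    (hf : MeromorphicAt f t₀) : IsIntegral (meromorphicGerms t₀ l) (f : Germ l ℂ) :=
  isIntegral_algebraMap (R := meromorphicGerms t₀ l) (x := ⟨f, mem_meromorphicGerms hf⟩)

theorem isField_meromorphicGerms {t₀ : ℝ} {l : Filter ℝ} [l.NeBot] (hl : l ≤ 𝓝[≠] t₀) :
    IsField (meromorphicGerms t₀ l) where
  exists_pair_ne := ⟨0, 1, zero_ne_one⟩
  mul_comm := mul_comm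
  mul_inv_cancel := by
    rintro ⟨_, f, hf, rfl⟩ hne
    refine ⟨⟨_, mem_meromorphicGerms hf.inv⟩, ?_⟩
    rcases hf.eventually_eq_zero_or_eventually_ne_zero with h | h
    · exact (hne (Subtype.ext (Germ.coe_eq.2 (hl h)))).elim
    · refine Subtype.ext (Germ.coe_eq.2 ?_)
      filter_upwards [hl h] with t ht
      exact mul_inv_cancel₀ ht

instance {t₀ : ℝ} {l : Filter ℝ} [l.NeBot] : CharZero (meromorphicGerms t₀ l) :=
  ⟨fun m n h ↦ by
    have h' : ((m : ℂ) : Germ l ℂ) = ((n : ℂ) : Germ l ℂ) := congrArg Subtype.val h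
    exact Nat.cast_injective (Germ.const_inj.1 h')⟩

/-- The image of a coordinate function is integral over every subring that contains the images of
the invariant polynomials. -/
theorem isIntegral_map_X {m : ℕ} {G A : Type*} [Group G] [Fintype G] [CommRing A]
    (ρ : G →* ((Fin m → ℂ) ≃ₗ[ℂ] (Fin m → ℂ))) (K : Subring A)
    (φ : MvPolynomial (Fin m) ℂ →+* A)
    (hφ : ∀ f : MvPolynomial (Fin m) ℂ,
      (∀ g x, MvPolynomial.eval (ρ g x) f = MvPolynomial.eval x f) → φ f ∈ K) (i : Fin m) :
    IsIntegral K (φ (MvPolynomial.X i)) := by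
  classical
  let L : G → MvPolynomial (Fin m) ℂ := fun g ↦
    ∑ j, MvPolynomial.C (ρ g (Pi.single j 1) i) * MvPolynomial.X j
  have hL (g : G) (x : Fin m → ℂ) : MvPolynomial.eval x (L g) = ρ g x i := by
    have h := LinearMap.pi_apply_eq_sum_univ (ρ g).toLinearMap x
    have hs (j : Fin m) : (fun k ↦ if j = k then 1 else 0) = (Pi.single j 1 : Fin m → ℂ) := by
      ext k
      simp [Pi.single_apply, eq_comm]
    simp only [LinearEquiv.coe_coe, hs] at h
    rw [h]
    simp [L, mul_comm]
  let P : (MvPolynomial (Fin m) ℂ)[X] := ∏ g, (Polynomial.X - Polynomial.C (L g))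
  have hmap (x : Fin m → ℂ) : P.map (MvPolynomial.eval x) =
      ∏ g, (Polynomial.X - Polynomial.C (ρ g x i)) := by
    simp [P, Polynomial.map_prod, hL]
  have hPinv (h : G) (x : Fin m → ℂ) :
      P.map (MvPolynomial.eval (ρ h x)) = P.map (MvPolynomial.eval x) := by
    rw [hmap, hmap]
    exact Fintype.prod_equiv (Equiv.mulRight h) _ _ fun g ↦ by simp
  have hcoeff (k : ℕ) : φ (P.coeff k) ∈ K := hφ _ fun g x ↦ by
    rw [← Polynomial.coeff_map, hPinv, Polynomial.coeff_map]
  have hsub : ((P.map φ).coeffs : Set A) ⊆ K := by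
    intro a ha
    obtain ⟨k, -, rfl⟩ := Polynomial.mem_coeffs_iff.1 ha
    rw [Polynomial.coeff_map]
    exact hcoeff k
  have hX : L 1 = MvPolynomial.X i := MvPolynomial.funext fun x ↦ by simp [hL]
  have hP0 : P.eval (MvPolynomial.X i) = 0 := by
    rw [Polynomial.eval_prod]
    exact Finset.prod_eq_zero (Finset.mem_univ 1) (by simp [hX])
  refine ⟨(P.map φ).toSubring K hsub, (Polynomial.monic_toSubring _ _ _).2 ?_, ?_⟩
  · exact (Polynomial.monic_prod_of_monic _ _ fun g _ ↦ Polynomial.monic_X_sub_C _).map φ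
  · have : ((P.map φ).toSubring K hsub).map (algebraMap K A) = P.map φ :=
      Polynomial.map_toSubring _ _ _
    rw [← Polynomial.eval_map, this, Polynomial.eval_map, Polynomial.eval₂_hom, hP0, map_zero]

/-- A continuous root of a polynomial with differentiable coefficients is differentiable wherever
it is a simple root. -/
theorem hasDerivAt_of_simple_root {N : ℕ} {a : ℕ → ℝ → ℂ} {a' : ℕ → ℂ} {u : ℝ → ℂ} {s : ℝ}
    (ha : ∀ j ∈ Finset.range N, HasDerivAt (a j) (a' j) s) (hu : ContinuousAt u s)
    (hroot : ∀ᶠ t in 𝓝 s, ∑ j ∈ Finset.range N, a j t * u t ^ j = 0)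
    (hD : ∑ j ∈ Finset.range N, a j s * (j * u s ^ (j - 1)) ≠ 0) :
    HasDerivAt u (-(∑ j ∈ Finset.range N, a' j * u s ^ j) /
      ∑ j ∈ Finset.range N, a j s * (j * u s ^ (j - 1))) s := by
  let F : ℝ → ℂ := fun t ↦ ∑ j ∈ Finset.range N, a j t * u s ^ j
  let H : ℝ → ℂ := fun t ↦
    ∑ j ∈ Finset.range N, a j t * ∑ i ∈ Finset.range j, u t ^ i * u s ^ (j - 1 - i)
  have hF : HasDerivAt F (∑ j ∈ Finset.range N, a' j * u s ^ j) s :=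
    HasDerivAt.fun_sum fun j hj ↦ (ha j hj).mul_const _
  have hHs : H s = ∑ j ∈ Finset.range N, a j s * (j * u s ^ (j - 1)) :=
    Finset.sum_congr rfl fun j _ ↦ by rw [geom_sum₂_self]
  have hH : ContinuousAt H s := by
    refine tendsto_finsetSum _ fun j hj ↦ (ha j hj).continuousAt.mul ?_
    exact tendsto_finsetSum _ fun i _ ↦ (hu.pow i).mul continuousAt_const
  have hFs : F s = 0 := hroot.self_of_nhds
  have hfac : ∀ᶠ t in 𝓝 s, H t * (u t - u s) = -F t := by
    filter_upwards [hroot] with t ht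
    have : H t * (u t - u s) = ∑ j ∈ Finset.range N, a j t * u t ^ j - F t := by
      simp only [H, F, Finset.sum_mul, ← Finset.sum_sub_distrib]
      refine Finset.sum_congr rfl fun j _ ↦ ?_
      rw [mul_assoc, geom_sum₂_mul, mul_sub]
    rw [this, ht, zero_sub]
  rw [hasDerivAt_iff_tendsto_slope] at hF ⊢
  rw [← hHs] at hD ⊢
  refine (hF.neg.div (hH.tendsto.mono_left nhdsWithin_le_nhds) hD).congr' ?_
  filter_upwards [nhdsWithin_le_nhds hfac, nhdsWithin_le_nhds (hH.eventually_ne hD)] with t ht hne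
  rw [Pi.div_apply, div_eq_iff hne, slope_def_module, slope_def_module, hFs, sub_zero, smul_mul_assoc,
    mul_comm (u t - u s), ht, smul_neg]

theorem eventually_eventually_nhds_of_Ioo {l : Filter ℝ}
    (hb : ∀ s ∈ l, ∃ a b, Ioo a b ∈ l ∧ Ioo a b ⊆ s) {p : ℝ → Prop} (hp : ∀ᶠ t in l, p t) :
    ∀ᶠ t in l, ∀ᶠ s in 𝓝 t, p s := by
  obtain ⟨a, b, hab, hsub⟩ := hb _ hp
  filter_upwards [hab] with t ht
  filter_upwards [Ioo_mem_nhds ht.1 ht.2] with s hs using hsub hs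

section

variable {t₀ : ℝ} {l : Filter ℝ}

theorem exists_meromorphicAt_coe_eq (k : meromorphicGerms t₀ l) :
    ∃ f : ℝ → ℂ, MeromorphicAt f t₀ ∧ (f : Germ l ℂ) = k := k.2

theorem exists_eventually_continuousAt_coe_eq_aeval (hl : l ≤ 𝓝[≠] t₀) {w : ℝ → ℂ}
    (hw : ∀ᶠ t in l, ContinuousAt w t) (Q : (meromorphicGerms t₀ l)[X]) :
    ∃ h : ℝ → ℂ, (∀ᶠ t in l, ContinuousAt h t) ∧
      (h : Germ l ℂ) = Polynomial.aeval (w : Germ l ℂ) Q := by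
  induction Q using Polynomial.induction_on' with
  | add p q hp hq =>
    obtain ⟨f, hf, hfe⟩ := hp
    obtain ⟨g, hg, hge⟩ := hq
    refine ⟨f + g, ?_, by rw [Germ.coe_add, hfe, hge, map_add]⟩
    filter_upwards [hf, hg] with t h1 h2 using h1.add h2
  | monomial n k =>
    obtain ⟨f, hf, hfe⟩ := exists_meromorphicAt_coe_eq k
    refine ⟨f * w ^ n, ?_, ?_⟩
    · filter_upwards [hl hf.eventually_analyticAt, hw] with t h1 h2
      exact h1.continuousAt.mul (h2.pow n)
    · rw [Polynomial.aeval_monomial, Germ.coe_mul, hfe, Germ.coe_pow]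
      rfl

/-- A continuous function that is integral over the meromorphic germs either vanishes identically
or has no zeros, along the filter `l`. -/
theorem eventually_eq_zero_or_eventually_ne_zero_of_isIntegral [l.NeBot] (hl : l ≤ 𝓝[≠] t₀)
    (hb : ∀ s ∈ l, ∃ a b, Ioo a b ∈ l ∧ Ioo a b ⊆ s) {w : ℝ → ℂ}
    (hw : ∀ᶠ t in l, ContinuousAt w t)
    (hint : IsIntegral (meromorphicGerms t₀ l) (w : Germ l ℂ)) :
    (∀ᶠ t in l, w t = 0) ∨ ∀ᶠ t in l, w t ≠ 0 := by
  have : Nontrivial (meromorphicGerms t₀ l) := (isField_meromorphicGerms hl).nontrivial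
  obtain ⟨N, hN, hN0⟩ := hint
  obtain ⟨N₁, hN₁, hdvd⟩ :=
    Polynomial.exists_eq_pow_rootMultiplicity_mul_and_not_dvd N hN.ne_zero 0
  set k := Polynomial.rootMultiplicity 0 N
  rw [Polynomial.C_0, sub_zero] at hN₁ hdvd
  rw [Polynomial.X_dvd_iff] at hdvd
  obtain ⟨h, hh, hhe⟩ := exists_eventually_continuousAt_coe_eq_aeval hl hw N₁
  obtain ⟨h₂, -, hhe₂⟩ := exists_eventually_continuousAt_coe_eq_aeval hl hw N₁.divX
  obtain ⟨a, ha, hae⟩ := exists_meromorphicAt_coe_eq (N₁.coeff 0)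
  have ha0 : ∀ᶠ t in l, a t ≠ 0 := by
    rcases ha.eventually_eq_zero_or_eventually_ne_zero with h0 | h0
    · refine (hdvd (Subtype.ext ?_)).elim
      rw [← hae]
      exact Germ.coe_eq.2 (hl h0)
    · exact hl h0
  have hprod : ∀ᶠ t in l, w t ^ k * h t = 0 := by
    have : ((w ^ k * h : ℝ → ℂ) : Germ l ℂ) = ((0 : ℝ → ℂ) : Germ l ℂ) := by
      rw [Germ.coe_mul, hhe, Germ.coe_pow, Germ.coe_zero, ← hN0, ← Polynomial.aeval_def, hN₁,
        map_mul, map_pow, Polynomial.aeval_X]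
    exact Germ.coe_eq.1 this
  have hsplit : ∀ᶠ t in l, h t = h₂ t * w t + a t := by
    have : (h : Germ l ℂ) = ((h₂ * w + a : ℝ → ℂ) : Germ l ℂ) := by
      rw [Germ.coe_add, Germ.coe_mul, hhe, hhe₂, hae]
      conv_lhs => rw [← Polynomial.divX_mul_X_add N₁]
      simp only [map_add, map_mul, Polynomial.aeval_X, Polynomial.aeval_C]
      rfl
    exact Germ.coe_eq.1 this
  obtain ⟨x, y, hxy, hsub⟩ := hb _ (hw.and (hh.and (ha0.and (hprod.and hsplit))))
  have hwc : ContinuousOn w (Ioo x y) := fun t ht ↦ (hsub ht).1.continuousWithinAt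
  have hhc : ContinuousOn h (Ioo x y) := fun t ht ↦ (hsub ht).2.1.continuousWithinAt
  have hcover (t : ℝ) (ht : t ∈ Ioo x y) : w t ≠ 0 ∨ h t ≠ 0 := by
    obtain ⟨-, -, h1, -, h2⟩ := hsub ht
    by_contra! hcon
    rw [hcon.1, hcon.2, mul_zero, zero_add] at h2
    exact h1 h2.symm
  by_cases h1 : ∃ t ∈ Ioo x y, w t ≠ 0
  · by_cases h2 : ∃ t ∈ Ioo x y, h t ≠ 0
    · obtain ⟨t, ht, hwt⟩ := h1
      obtain ⟨s, hs, hhs⟩ := h2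
      obtain ⟨r, hr, hr1, hr2⟩ := isPreconnected_Ioo
        (Ioo x y ∩ w ⁻¹' {0}ᶜ) (Ioo x y ∩ h ⁻¹' {0}ᶜ)
        (hwc.isOpen_inter_preimage isOpen_Ioo isOpen_compl_singleton)
        (hhc.isOpen_inter_preimage isOpen_Ioo isOpen_compl_singleton)
        (fun t ht ↦ (hcover t ht).imp (fun h ↦ ⟨ht, h⟩) fun h ↦ ⟨ht, h⟩)
        ⟨t, ht, ht, hwt⟩ ⟨s, hs, hs, hhs⟩
      exact (mul_ne_zero (pow_ne_zero k hr1.2) hr2.2 (hsub hr).2.2.2.1).elim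
    · push Not at h2
      refine Or.inr ?_
      filter_upwards [hxy] with t ht
      exact (hcover t ht).resolve_right (not_not.2 (h2 t ht))
  · push Not at h1
    exact Or.inl (mem_of_superset hxy h1)

/-- A continuous function that is integral over the meromorphic germs is differentiable along `l`,
with derivative again continuous and integral. -/
theorem exists_hasDerivAt_of_isIntegral [l.NeBot] (hl : l ≤ 𝓝[≠] t₀)
    (hb : ∀ s ∈ l, ∃ a b, Ioo a b ∈ l ∧ Ioo a b ⊆ s) {u : ℝ → ℂ}
    (hu : ∀ᶠ t in l, ContinuousAt u t)
    (hint : IsIntegral (meromorphicGerms t₀ l) (u : Germ l ℂ)) :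
    ∃ w : ℝ → ℂ, IsIntegral (meromorphicGerms t₀ l) (w : Germ l ℂ) ∧
      ∀ᶠ t in l, ContinuousAt w t ∧ HasDerivAt u (w t) t := by
  obtain ⟨Q, B, hQ, hB⟩ :=
    (isField_meromorphicGerms hl).exists_aeval_eq_zero_and_aeval_derivative_isUnit hint
  choose a ha hae using fun j ↦ exists_meromorphicAt_coe_eq (Q.coeff j)
  set N := Q.natDegree + 1
  let D : ℝ → ℂ := ∑ j ∈ Finset.range N, a j * ((j : ℝ → ℂ) * u ^ (j - 1))
  let E : ℝ → ℂ := ∑ j ∈ Finset.range N, deriv (a j) * u ^ j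
  have hcoe_sum (f : ℕ → ℝ → ℂ) : ((∑ j ∈ Finset.range N, f j : ℝ → ℂ) : Germ l ℂ) =
      ∑ j ∈ Finset.range N, (f j : Germ l ℂ) := map_sum (Germ.coeRingHom l) _ _
  have hD : (D : Germ l ℂ) = Polynomial.aeval (u : Germ l ℂ) (Polynomial.derivative Q) := by
    conv_rhs => rw [Q.as_sum_range_C_mul_X_pow]
    simp only [D, hcoe_sum, map_sum, Germ.coe_mul, Germ.coe_pow, hae, ← Germ.natCast_def,
      Polynomial.derivative_C_mul_X_pow, map_mul, map_pow, Polynomial.aeval_C, Polynomial.aeval_X,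
      map_natCast, mul_assoc]
    rfl
  have hE : IsIntegral (meromorphicGerms t₀ l) (E : Germ l ℂ) := by
    rw [hcoe_sum]
    refine IsIntegral.sum _ fun j _ ↦ ?_
    rw [Germ.coe_mul, Germ.coe_pow]
    exact (isIntegral_coe_of_meromorphicAt (ha j).deriv).mul (hint.pow j)
  obtain ⟨b, -, hbe⟩ := exists_eventually_continuousAt_coe_eq_aeval hl hu B
  have hBint : IsIntegral (meromorphicGerms t₀ l) (b : Germ l ℂ) := by
    rw [hbe, Polynomial.aeval_eq_sum_range]
    exact IsIntegral.sum _ fun j _ ↦ (hint.pow j).smul _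
  have hbD : ∀ᶠ t in l, b t * D t = 1 := by
    have : ((b * D : ℝ → ℂ) : Germ l ℂ) = ((1 : ℝ → ℂ) : Germ l ℂ) := by
      rw [Germ.coe_mul, hD, hbe, hB, Germ.coe_one]
    exact Germ.coe_eq.1 this
  have hroot : ∀ᶠ t in l, ∑ j ∈ Finset.range N, a j t * u t ^ j = 0 := by
    have : ((∑ j ∈ Finset.range N, a j * u ^ j : ℝ → ℂ) : Germ l ℂ) =
        ((0 : ℝ → ℂ) : Germ l ℂ) := by
      rw [hcoe_sum, Germ.coe_zero, ← hQ, Polynomial.aeval_eq_sum_range]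
      refine Finset.sum_congr rfl fun j _ ↦ ?_
      rw [Germ.coe_mul, Germ.coe_pow, hae]
      rfl
    filter_upwards [Germ.coe_eq.1 this] with t ht
    simpa using ht
  have han : ∀ᶠ t in l, ∀ j ∈ Finset.range N, AnalyticAt ℝ (a j) t :=
    (Finset.eventually_all _).2 fun j _ ↦ hl (ha j).eventually_analyticAt
  refine ⟨-E / D, ?_, ?_⟩
  · have : ((-E / D : ℝ → ℂ) : Germ l ℂ) = -E * b := by
      rw [← Germ.coe_neg, ← Germ.coe_mul]
      refine Germ.coe_eq.2 ?_
      filter_upwards [hbD] with t ht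
      have hne : D t ≠ 0 := right_ne_zero_of_mul_eq_one ht
      rw [Pi.div_apply, Pi.mul_apply, div_eq_iff hne, mul_assoc, ht, mul_one]
    rw [this]
    exact hE.neg.mul hBint
  · filter_upwards [hu, han, hbD, eventually_eventually_nhds_of_Ioo hb hroot] with t h1 h2 h3 h4
    have hne : D t ≠ 0 := right_ne_zero_of_mul_eq_one h3
    have hDt : D = fun t ↦ ∑ j ∈ Finset.range N, a j t * (j * u t ^ (j - 1)) := by
      ext; simp [D]
    have hEt : E = fun t ↦ ∑ j ∈ Finset.range N, deriv (a j) t * u t ^ j := by ext; simp [E]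
    refine ⟨ContinuousAt.div (ContinuousAt.neg ?_) ?_ hne, ?_⟩
    · rw [hEt]
      exact tendsto_finsetSum _ fun j hj ↦ (h2 j hj).deriv.continuousAt.mul (h1.pow j)
    · rw [hDt]
      exact tendsto_finsetSum _ fun j hj ↦
        (h2 j hj).continuousAt.mul (continuousAt_const.mul (h1.pow _))
    · rw [Pi.div_apply, Pi.neg_apply, hEt, hDt]
      rw [hDt] at hne
      exact hasDerivAt_of_simple_root (fun j hj ↦ (h2 j hj).differentiableAt.hasDerivAt) h1 h4 hne

end

/-- A real function that is continuous and integral over the meromorphic germs is differentiable,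
with a derivative of constant sign, along `l`. -/
theorem exists_Ioo_deriv_sign_of_isIntegral {t₀ : ℝ} {l : Filter ℝ} [l.NeBot] (hl : l ≤ 𝓝[≠] t₀)
    (hb : ∀ s ∈ l, ∃ a b, Ioo a b ∈ l ∧ Ioo a b ⊆ s) {u : ℝ → ℝ}
    (hu : ∀ᶠ t in l, ContinuousAt u t)
    (hint : IsIntegral (meromorphicGerms t₀ l) ((fun t ↦ (u t : ℂ) : ℝ → ℂ) : Germ l ℂ)) :
    ∃ a b, Ioo a b ∈ l ∧ (∀ t ∈ Ioo a b, HasDerivAt u (deriv u t) t) ∧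
      ((∀ t ∈ Ioo a b, 0 ≤ deriv u t) ∨ ∀ t ∈ Ioo a b, 0 ≤ -deriv u t) := by
  have huc : ∀ᶠ t in l, ContinuousAt (fun t ↦ (u t : ℂ)) t := by
    filter_upwards [hu] with t ht using Complex.continuous_ofReal.continuousAt.comp ht
  obtain ⟨w, hw, hwd⟩ := exists_hasDerivAt_of_isIntegral hl hb huc hint
  have hdich := eventually_eq_zero_or_eventually_ne_zero_of_isIntegral hl hb
    (hwd.mono fun t ht ↦ ht.1) hw
  have hreal : ∀ᶠ t in l, HasDerivAt u (deriv u t) t ∧ w t = deriv u t := by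
    filter_upwards [hwd] with t ht
    have h1 : HasDerivAt u (w t).re t := Complex.reCLM.hasFDerivAt.comp_hasDerivAt t ht.2
    rw [h1.deriv]
    exact ⟨h1, ht.2.unique h1.ofReal_comp⟩
  rcases hdich with h | h
  · obtain ⟨a, b, hab, hsub⟩ := hb _ (hreal.and h)
    refine ⟨a, b, hab, fun t ht ↦ (hsub ht).1.1, Or.inl fun t ht ↦ ?_⟩
    obtain ⟨⟨-, h1⟩, h2⟩ := hsub ht
    rw [h2] at h1
    exact (Complex.ofReal_eq_zero.1 h1.symm).ge
  · obtain ⟨a, b, hab, hsub⟩ := hb _ (hreal.and h)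
    refine ⟨a, b, hab, fun t ht ↦ (hsub ht).1.1, ?_⟩
    have hne : ∀ t ∈ Ioo a b, deriv u t ≠ 0 := by
      intro t ht h0
      obtain ⟨⟨-, h1⟩, h2⟩ := hsub ht
      rw [h0, Complex.ofReal_zero] at h1
      exact h2 h1
    rcases hasDerivWithinAt_forall_lt_or_forall_gt_of_forall_ne (convex_Ioo a b)
      (fun t ht ↦ (hsub ht).1.1.hasDerivWithinAt) hne with h | h
    · exact Or.inr fun t ht ↦ neg_nonneg.2 (h t ht).le
    · exact Or.inl fun t ht ↦ (h t ht).le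

theorem integrableOn_deriv_of_constant_sign {u : ℝ → ℝ} {a b : ℝ} (hu : ContinuousOn u (Icc a b))
    (hd : ∀ t ∈ Ioo a b, HasDerivAt u (deriv u t) t)
    (hs : (∀ t ∈ Ioo a b, 0 ≤ deriv u t) ∨ ∀ t ∈ Ioo a b, 0 ≤ -deriv u t) :
    IntegrableOn (deriv u) (Ioo a b) := by
  rcases hs with hs | hs
  · exact (intervalIntegral.integrableOn_deriv_of_nonneg hu hd hs).mono_set Ioo_subset_Ioc_self
  · have h := intervalIntegral.integrableOn_deriv_of_nonneg hu.neg (fun t ht ↦ (hd t ht).neg) hs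
    simpa using (h.mono_set Ioo_subset_Ioc_self).neg

theorem exists_Ioo_mem_nhdsGT_subset {t₀ : ℝ} {s : Set ℝ} (hs : s ∈ 𝓝[>] t₀) :
    ∃ a b, Ioo a b ∈ 𝓝[>] t₀ ∧ Ioo a b ⊆ s := by
  obtain ⟨b, hb, hsub⟩ := mem_nhdsGT_iff_exists_Ioo_subset.1 hs
  exact ⟨t₀, b, Ioo_mem_nhdsGT hb, hsub⟩

theorem exists_Ioo_mem_nhdsLT_subset {t₀ : ℝ} {s : Set ℝ} (hs : s ∈ 𝓝[<] t₀) :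
    ∃ a b, Ioo a b ∈ 𝓝[<] t₀ ∧ Ioo a b ⊆ s := by
  obtain ⟨a, ha, hsub⟩ := mem_nhdsLT_iff_exists_Ioo_subset.1 hs
  exact ⟨a, t₀, Ioo_mem_nhdsLT ha, hsub⟩

section

variable {I : Set ℝ} {u : ℝ → ℝ}

theorem exists_mem_nhds_integrableOn_deriv (hI : IsOpen I) (hu : ContinuousOn u I) {t₀ : ℝ}
    (ht₀ : t₀ ∈ I) (hint : ∀ l : Filter ℝ, l ≤ 𝓝[≠] t₀ →
      IsIntegral (meromorphicGerms t₀ l) ((fun t ↦ (u t : ℂ) : ℝ → ℂ) : Germ l ℂ)) :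
    ∃ V ∈ 𝓝 t₀, IntegrableOn (deriv u) V ∧ ∀ t ∈ V, t ≠ t₀ → HasDerivAt u (deriv u t) t := by
  have hIn : I ∈ 𝓝 t₀ := hI.mem_nhds ht₀
  have hcont : ∀ᶠ t in 𝓝 t₀, ContinuousAt u t := by
    filter_upwards [hIn] with t ht using hu.continuousAt (hI.mem_nhds ht)
  have hgt : 𝓝[>] t₀ ≤ 𝓝[≠] t₀ := nhdsGT_le_nhdsNE t₀
  have hlt : 𝓝[<] t₀ ≤ 𝓝[≠] t₀ := nhdsLT_le_nhdsNE t₀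
  obtain ⟨c, hc, hcd, hci⟩ : ∃ c, t₀ < c ∧ (∀ t ∈ Ioo t₀ c, HasDerivAt u (deriv u t) t) ∧
      IntegrableOn (deriv u) (Ioo t₀ c) := by
    obtain ⟨a, b, hab, hd, hs⟩ := exists_Ioo_deriv_sign_of_isIntegral hgt
      (fun s ↦ exists_Ioo_mem_nhdsGT_subset) (nhdsWithin_le_nhds hcont) (hint _ hgt)
    obtain ⟨c, hc, hsub⟩ := mem_nhdsGT_iff_exists_Ioc_subset.1
      (inter_mem hab (nhdsWithin_le_nhds hIn))
    have hsub' : Ioo t₀ c ⊆ Ioo a b := fun t ht ↦ (hsub (Ioo_subset_Ioc_self ht)).1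
    refine ⟨c, hc, fun t ht ↦ hd t (hsub' ht), integrableOn_deriv_of_constant_sign
      (hu.mono fun t ht ↦ ?_) (fun t ht ↦ hd t (hsub' ht))
      (hs.imp (fun h t ht ↦ h t (hsub' ht)) fun h t ht ↦ h t (hsub' ht))⟩
    rcases ht.1.eq_or_lt with rfl | h
    · exact ht₀
    · exact (hsub ⟨h, ht.2⟩).2
  obtain ⟨d, hdl, hdd, hdi⟩ : ∃ d, d < t₀ ∧ (∀ t ∈ Ioo d t₀, HasDerivAt u (deriv u t) t) ∧
      IntegrableOn (deriv u) (Ioo d t₀) := by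
    obtain ⟨a, b, hab, hd, hs⟩ := exists_Ioo_deriv_sign_of_isIntegral hlt
      (fun s ↦ exists_Ioo_mem_nhdsLT_subset) (nhdsWithin_le_nhds hcont) (hint _ hlt)
    obtain ⟨c, hc, hsub⟩ := mem_nhdsLT_iff_exists_Ico_subset.1
      (inter_mem hab (nhdsWithin_le_nhds hIn))
    have hsub' : Ioo c t₀ ⊆ Ioo a b := fun t ht ↦ (hsub (Ioo_subset_Ico_self ht)).1
    refine ⟨c, hc, fun t ht ↦ hd t (hsub' ht), integrableOn_deriv_of_constant_sign
      (hu.mono fun t ht ↦ ?_) (fun t ht ↦ hd t (hsub' ht))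
      (hs.imp (fun h t ht ↦ h t (hsub' ht)) fun h t ht ↦ h t (hsub' ht))⟩
    rcases ht.2.eq_or_lt with rfl | h
    · exact ht₀
    · exact (hsub ⟨ht.1, h⟩).2
  refine ⟨Ioo d c, Ioo_mem_nhds hdl hc, ?_, fun t ht hne ↦ ?_⟩
  · have h0 : IntegrableOn (deriv u) {t₀} := by simp
    refine ((hdi.union h0).union hci).mono_set fun t ht ↦ ?_
    rcases lt_trichotomy t t₀ with h | h | h
    · exact Or.inl (Or.inl ⟨ht.1, h⟩)
    · exact Or.inl (Or.inr h)
    · exact Or.inr ⟨h, ht.2⟩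
  · rcases hne.lt_or_gt with h | h
    · exact hdd t ⟨ht.1, h⟩
    · exact hcd t ⟨h, ht.2⟩

/-- A continuous real function on an open set, everywhere locally integral over the meromorphic
germs, is the integral of its derivative on compact intervals. -/
theorem integrableOn_deriv_and_eq_add_integral (hI : IsOpen I) (hu : ContinuousOn u I)
    (hint : ∀ t₀ ∈ I, ∀ l : Filter ℝ, l ≤ 𝓝[≠] t₀ →
      IsIntegral (meromorphicGerms t₀ l) ((fun t ↦ (u t : ℂ) : ℝ → ℂ) : Germ l ℂ))
    {a b : ℝ} (hab : Icc a b ⊆ I) :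
    IntegrableOn (deriv u) (Icc a b) ∧
      ∀ t ∈ Icc a b, u t = u a + ∫ s in a..t, deriv u s := by
  have key : IntegrableOn (deriv u) (Icc a b) ∧
      ∃ S : Set ℝ, S.Countable ∧ ∀ t ∈ Icc a b, t ∉ S → HasDerivAt u (deriv u t) t := by
    refine isCompact_Icc.induction_on (p := fun s ↦ IntegrableOn (deriv u) s ∧
      ∃ S : Set ℝ, S.Countable ∧ ∀ t ∈ s, t ∉ S → HasDerivAt u (deriv u t) t) ?_ ?_ ?_ ?_
    · exact ⟨integrableOn_empty, ∅, countable_empty, by simp⟩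
    · rintro s t hst ⟨h1, S, hS, h2⟩
      exact ⟨h1.mono_set hst, S, hS, fun x hx ↦ h2 x (hst hx)⟩
    · rintro s t ⟨h1, S, hS, h2⟩ ⟨h3, T, hT, h4⟩
      refine ⟨h1.union h3, S ∪ T, hS.union hT, fun x hx hxn ↦ ?_⟩
      rw [mem_union, not_or] at hxn
      exact hx.elim (fun h ↦ h2 x h hxn.1) fun h ↦ h4 x h hxn.2
    · intro t₀ ht₀
      obtain ⟨V, hV, h1, h2⟩ :=
        exists_mem_nhds_integrableOn_deriv hI hu (hab ht₀) (hint t₀ (hab ht₀))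
      exact ⟨V, nhdsWithin_le_nhds hV, h1, {t₀}, countable_singleton _, h2⟩
  obtain ⟨hi, S, hS, hd⟩ := key
  refine ⟨hi, fun t ht ↦ ?_⟩
  have hsub : Icc a t ⊆ Icc a b := Icc_subset_Icc_right ht.2
  rw [integral_eq_of_hasDerivAt_off_countable_of_le u (deriv u) ht.1 hS
    (hu.mono (hsub.trans hab)) (fun x hx ↦ hd x (hsub (Ioo_subset_Icc_self hx.1)) hx.2)
    ((intervalIntegrable_iff_integrableOn_Icc_of_le ht.1).2 (hi.mono_set hsub))]
  ring

end



/-- Every continuous lift of a real-analytic curve in `σ(ℂ^m)` (finite group) is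
absolutely continuous on every compact subinterval. -/
theorem stmt6
    {m n : ℕ} {G : Type} [Group G] [Fintype G]
    (ρ : G →* ((Fin m → ℂ) ≃ₗ[ℂ] (Fin m → ℂ)))
    (σ : Fin n → MvPolynomial (Fin m) ℂ) (deg : Fin n → ℕ)
    (hdeg : ∀ k, 1 ≤ deg k)
    (hhom : ∀ k, (σ k).IsHomogeneous (deg k))
    (hinv : ∀ k g x, MvPolynomial.eval (ρ g x) (σ k) = MvPolynomial.eval x (σ k))
    (hgen : ∀ f : MvPolynomial (Fin m) ℂ,
      (∀ g x, MvPolynomial.eval (ρ g x) f = MvPolynomial.eval x f) →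
      ∃ p : MvPolynomial (Fin n) ℂ, MvPolynomial.aeval σ p = f)
    (σm : (Fin m → ℂ) → (Fin n → ℂ))
    (hσm : ∀ x k, σm x k = MvPolynomial.eval x (σ k))
    (I : Set ℝ) (hIo : IsOpen I) (hIc : I.OrdConnected)
    (c : ℝ → Fin n → ℂ) (hc : AnalyticOnNhd ℝ c I)
    (hcσ : ∀ t ∈ I, ∃ x : Fin m → ℂ, σm x = c t)
    (cb : ℝ → Fin m → ℂ) (hcb : ContinuousOn cb I)
    (hcblift : ∀ t ∈ I, σm (cb t) = c t) :
      ∀ a b : ℝ, a ≤ b → Set.Icc a b ⊆ I →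
        ∃ g : ℝ → Fin m → ℂ, IntegrableOn g (Set.Icc a b) ∧
          ∀ t ∈ Set.Icc a b, cb t = cb a + ∫ s in a..t, g s := by
  have hzint (τ : ℂ →+* ℂ) (hτ : Continuous τ) (hτr : ∀ x : ℝ, τ x = x) (t₀ : ℝ) (ht₀ : t₀ ∈ I)
      (l : Filter ℝ) (hl : l ≤ 𝓝[≠] t₀) (i : Fin m) :
      IsIntegral (meromorphicGerms t₀ l) ((fun t ↦ τ (cb t i) : ℝ → ℂ) : Germ l ℂ) := by
    let φ : MvPolynomial (Fin m) ℂ →+* Germ l ℂ := (Germ.coeRingHom l).comp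
      (RingHom.pi fun t ↦ τ.comp (MvPolynomial.eval (cb t)))
    have hφX : φ (MvPolynomial.X i) = ((fun t ↦ τ (cb t i) : ℝ → ℂ) : Germ l ℂ) := by
      change ((fun t ↦ τ (MvPolynomial.eval (cb t) (MvPolynomial.X i)) : ℝ → ℂ) : Germ l ℂ) = _
      simp
    rw [← hφX]
    refine isIntegral_map_X ρ _ φ (fun f hf ↦ ?_) i
    obtain ⟨p, rfl⟩ := hgen f hf
    let τL : ℂ →L[ℝ] ℂ :=
      { toFun := τ
        map_add' := map_add τ
        map_smul' := fun r x ↦ by simp [hτr]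
        cont := hτ }
    have han : AnalyticAt ℝ (fun t ↦ τ (MvPolynomial.aeval (c t) p)) t₀ :=
      (τL.analyticAt _).comp (AnalyticAt.aeval_mvPolynomial
        (fun k ↦ ((ContinuousLinearMap.proj (R := ℝ) (φ := fun _ : Fin n ↦ ℂ) k).analyticAt _).comp
          (hc t₀ ht₀)) p)
    have hφp : φ (MvPolynomial.aeval σ p) =
        ((fun t ↦ τ (MvPolynomial.aeval (c t) p) : ℝ → ℂ) : Germ l ℂ) := by
      refine Germ.coe_eq.2 ?_
      filter_upwards [hl (nhdsWithin_le_nhds (hIo.mem_nhds ht₀))] with t ht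
      have hct : c t = fun k ↦ MvPolynomial.eval (cb t) (σ k) := by
        rw [← hcblift t ht]
        exact funext fun k ↦ hσm _ k
      change τ (MvPolynomial.eval (cb t) (MvPolynomial.aeval σ p)) = _
      rw [hct, MvPolynomial.aeval_def, MvPolynomial.aeval_def, MvPolynomial.eval₂_comp_left]
      congr 2
      ext <;> simp
    rw [hφp]
    exact mem_meromorphicGerms han.meromorphicAt
  have hconst (t₀ : ℝ) (l : Filter ℝ) (x : ℂ) :
      IsIntegral (meromorphicGerms t₀ l) ((fun _ ↦ x : ℝ → ℂ) : Germ l ℂ) :=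
    isIntegral_coe_of_meromorphicAt (MeromorphicAt.const x t₀)
  have hz (t₀ : ℝ) (ht₀ : t₀ ∈ I) (l : Filter ℝ) (hl : l ≤ 𝓝[≠] t₀) (i : Fin m) :
      IsIntegral (meromorphicGerms t₀ l) ((fun t ↦ cb t i : ℝ → ℂ) : Germ l ℂ) :=
    hzint (RingHom.id ℂ) continuous_id (fun _ ↦ rfl) t₀ ht₀ l hl i
  have hzbar (t₀ : ℝ) (ht₀ : t₀ ∈ I) (l : Filter ℝ) (hl : l ≤ 𝓝[≠] t₀) (i : Fin m) :
      IsIntegral (meromorphicGerms t₀ l)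
        ((fun t ↦ starRingEnd ℂ (cb t i) : ℝ → ℂ) : Germ l ℂ) :=
    hzint (starRingEnd ℂ) Complex.continuous_conj Complex.conj_ofReal t₀ ht₀ l hl i
  intro a b hab hsub
  have hcbi (i : Fin m) : ContinuousOn (fun t ↦ cb t i) I :=
    (continuous_apply i).comp_continuousOn hcb
  have hre (i : Fin m) := integrableOn_deriv_and_eq_add_integral (u := fun t ↦ (cb t i).re) hIo
    (Complex.continuous_re.comp_continuousOn (hcbi i)) (fun t₀ ht₀ l hl ↦ by
      have h := ((hz t₀ ht₀ l hl i).add (hzbar t₀ ht₀ l hl i)).mul (hconst t₀ l (1 / 2))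
      rw [← Germ.coe_add, ← Germ.coe_mul] at h
      have e : (fun t ↦ ((cb t i).re : ℂ)) =
          ((fun t ↦ cb t i) + fun t ↦ starRingEnd ℂ (cb t i)) * fun _ ↦ (1 / 2) := by
        ext t
        rw [Pi.mul_apply, Pi.add_apply, Complex.re_eq_add_conj]
        ring
      rw [e]
      exact h) hsub
  have him (i : Fin m) := integrableOn_deriv_and_eq_add_integral (u := fun t ↦ (cb t i).im) hIo
    (Complex.continuous_im.comp_continuousOn (hcbi i)) (fun t₀ ht₀ l hl ↦ by
      have h := ((hz t₀ ht₀ l hl i).sub (hzbar t₀ ht₀ l hl i)).mul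
        (hconst t₀ l (1 / (2 * Complex.I)))
      rw [← Germ.coe_sub, ← Germ.coe_mul] at h
      have e : (fun t ↦ ((cb t i).im : ℂ)) =
          ((fun t ↦ cb t i) - fun t ↦ starRingEnd ℂ (cb t i)) * fun _ ↦ (1 / (2 * Complex.I)) := by
        ext t
        rw [Pi.mul_apply, Pi.sub_apply, Complex.im_eq_sub_conj]
        ring
      rw [e]
      exact h) hsub
  let g : ℝ → Fin m → ℂ := fun t i ↦
    ((deriv (fun t ↦ (cb t i).re) t : ℝ) : ℂ) + ((deriv (fun t ↦ (cb t i).im) t : ℝ) : ℂ) * Complex.I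
  have hg : IntegrableOn g (Icc a b) :=
    Integrable.of_eval fun i ↦ (hre i).1.ofReal.add ((him i).1.ofReal.mul_const _)
  refine ⟨g, hg, fun t ht ↦ ?_⟩
  have hle : Icc a t ⊆ Icc a b := Icc_subset_Icc_right ht.2
  have hint {E : Type} [NormedAddCommGroup E] {f : ℝ → E}
      (hf : Integrable f (volume.restrict (Icc a b))) :
      IntervalIntegrable f volume a t :=
    (intervalIntegrable_iff_integrableOn_Icc_of_le ht.1).2 (IntegrableOn.mono_set hf hle)
  ext i
  have hproj : (∫ s in a..t, g s) i = ∫ s in a..t, g s i :=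
    ((ContinuousLinearMap.proj (R := ℝ) (φ := fun _ : Fin m ↦ ℂ) i).intervalIntegral_comp_comm
      (hint hg)).symm
  rw [Pi.add_apply, hproj]
  simp only [g]
  rw [intervalIntegral.integral_add (hint (hre i).1.ofReal)
    (hint ((him i).1.ofReal.mul_const _)), intervalIntegral.integral_mul_const,
    intervalIntegral.integral_ofReal, intervalIntegral.integral_ofReal]
  have h1 := (hre i).2 t ht
  have h2 := (him i).2 t ht
  rw [← sub_eq_iff_eq_add'] at h1 h2
  rw [← h1, ← h2]
  refine Complex.ext ?_ ?_ <;> simp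
end

section
/- Let I ⊆ ℝ be an open interval, t₀ ∈ I, and let c : I → ℂ^n be a real-analytic curve with c(t) ∈ σ(ℂ^m) for all t. Let J ⊆ I be an open subinterval containing t₀ and let c̄₁, c̄₂ : J → ℂ^m be C^∞ lifts of c (σ ∘ c̄ᵢ = c on J). Then there exist g ∈ G and δ > 0 such that c̄₁(t) = ρ(g)·c̄₂(t) for all t ∈ J with |t − t₀| < δ. (This is the paper's uniqueness lemma for smooth lifts in the case of a finite group, where a smooth curve in G is locally constant; real-analytic curves are automatically normally nonflat.) -/
open MeasureTheory Set Filter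

/-- If a function agrees to order `N` with an analytic function, then it is either negligible
against `(t - t₀) ^ N` or nonvanishing on a punctured neighbourhood of `t₀`. -/
theorem isLittleO_pow_or_eventually_ne_zero {f T : ℝ → ℂ} {t₀ : ℝ} {N : ℕ}
    (hT : AnalyticAt ℝ T t₀)
    (hf : (fun t => f t - T t) =o[nhds t₀] fun t => (t - t₀) ^ N) :
    (f =o[nhdsWithin t₀ {t₀}ᶜ] fun t => (t - t₀) ^ N) ∨
      ∀ᶠ t in nhdsWithin t₀ {t₀}ᶜ, f t ≠ 0 := by
  have hf' := hf.mono (nhdsWithin_le_nhds (s := {t₀}ᶜ))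
  by_cases h0 : ∀ᶠ t in nhds t₀, T t = 0
  · left
    refine hf'.congr' ?_ EventuallyEq.rfl
    filter_upwards [nhdsWithin_le_nhds h0] with t ht
    simp [ht]
  obtain ⟨n, u, hu, hu0, hTu⟩ := hT.exists_eventuallyEq_pow_smul_nonzero_iff.2 h0
  have hu' : Tendsto u (nhdsWithin t₀ {t₀}ᶜ) (nhds (u t₀)) :=
    hu.continuousAt.tendsto.mono_left nhdsWithin_le_nhds
  rcases lt_or_ge N n with hn | hn
  · left
    have hTo : T =o[nhdsWithin t₀ {t₀}ᶜ] fun t => (t - t₀) ^ N := by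
      have h1 : (fun t : ℝ => (t - t₀) ^ n) =o[nhdsWithin t₀ {t₀}ᶜ] fun t => (t - t₀) ^ N :=
        Asymptotics.isLittleO_norm_norm.1 <| by
          simpa using (Asymptotics.isLittleO_pow_sub_pow_sub t₀ hn).mono nhdsWithin_le_nhds
      have h2 := h1.smul_isBigO (hu'.isBigO_one ℝ)
      refine h2.congr' ?_ ?_
      · filter_upwards [nhdsWithin_le_nhds hTu] with t ht using ht.symm
      · exact Eventually.of_forall fun t => by simp
    simpa using hf'.add hTo
  · right
    have hpow : (fun t : ℝ => (t - t₀) ^ N) =O[nhdsWithin t₀ {t₀}ᶜ] fun t => (t - t₀) ^ n := by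
      have hc : ContinuousAt (fun t : ℝ => (t - t₀) ^ (N - n)) t₀ := by fun_prop
      have h := ((hc.tendsto.mono_left nhdsWithin_le_nhds).isBigO_one ℝ).mul
        (Asymptotics.isBigO_refl (fun t : ℝ => (t - t₀) ^ n) (nhdsWithin t₀ {t₀}ᶜ))
      simpa [← pow_add, Nat.sub_add_cancel hn] using h
    have h1 := (hf'.trans_isBigO hpow).def (c := ‖u t₀‖ / 2) (by positivity)
    have h2 : ∀ᶠ t in nhdsWithin t₀ {t₀}ᶜ, ‖u t₀‖ / 2 < ‖u t‖ :=
      hu'.norm.eventually_const_lt (by have := norm_pos_iff.2 hu0; linarith)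
    filter_upwards [h1, h2, nhdsWithin_le_nhds hTu, self_mem_nhdsWithin] with t h1 h2 h3 h4 h5
    have hp : 0 < ‖(t - t₀) ^ n‖ := norm_pos_iff.2 (pow_ne_zero _ (sub_ne_zero.2 h4))
    rw [h5, h3, zero_sub, norm_neg, norm_smul, mul_comm] at h1
    exact absurd (le_of_mul_le_mul_right h1 hp) (not_le.2 h2)

/-- A smooth root of a nonzero polynomial with analytic coefficients either vanishes identically
near a point, or does not vanish on a punctured neighbourhood of it. -/
theorem eventually_eq_zero_or_eventually_ne_zero {f : ℝ → ℂ} {t₀ : ℝ} {J : Set ℝ}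
    (hJo : IsOpen J) (hJ : Convex ℝ J) (ht₀ : t₀ ∈ J) (hf : ContDiffOn ℝ (⊤ : ℕ∞) f J)
    (d : ℕ) (a : ℕ → ℝ → ℂ) (ha : ∀ j, AnalyticAt ℝ (a j) t₀)
    (had : ¬ ∀ᶠ t in nhds t₀, a d t = 0)
    (hroot : ∀ t ∈ J, ∑ j ∈ Finset.range (d + 1), a j t * f t ^ j = 0) :
    (∀ᶠ t in nhdsWithin t₀ {t₀}ᶜ, f t = 0) ∨ ∀ᶠ t in nhdsWithin t₀ {t₀}ᶜ, f t ≠ 0 := by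
  classical
  have hex : ∃ j, ¬ ∀ᶠ t in nhds t₀, a j t = 0 := ⟨d, had⟩
  set k := Nat.find hex
  have hk0 : ¬ ∀ᶠ t in nhds t₀, a k t = 0 := Nat.find_spec hex
  have hkd : k ≤ d := Nat.find_min' hex had
  have hlt : ∀ᶠ t in nhds t₀, ∀ j ∈ Finset.range k, a j t = 0 := by
    rw [Filter.eventually_all_finset]
    intro j hj
    exact not_not.1 (Nat.find_min hex (Finset.mem_range.1 hj))
  have hfc : ContinuousAt f t₀ := hf.continuousOn.continuousAt (hJo.mem_nhds ht₀)
  set B : ℝ → ℂ := fun t => ∑ j ∈ Finset.range (d - k), a (k + (j + 1)) t * f t ^ j with hB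
  have hBc : ContinuousAt B t₀ :=
    tendsto_finsetSum _ fun j _ => (ha _).continuousAt.mul (hfc.pow j)
  have hfac : ∀ᶠ t in nhds t₀, f t ^ k * (a k t + f t * B t) = 0 := by
    filter_upwards [hlt, hJo.mem_nhds ht₀] with t h1 h2
    rw [← hroot t h2, show d + 1 = k + ((d - k) + 1) by omega, Finset.sum_range_add,
      Finset.sum_eq_zero fun j hj => by rw [h1 j hj, zero_mul], zero_add,
      Finset.sum_range_succ', hB, mul_add, Finset.mul_sum, Finset.mul_sum, add_comm]
    congr 1
    · refine Finset.sum_congr rfl fun j _ => ?_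
      ring
    · simp [mul_comm]
  obtain ⟨N, u, hu, hu0, hau⟩ := (ha k).exists_eventuallyEq_pow_smul_nonzero_iff.2 hk0
  have hu' : Tendsto u (nhdsWithin t₀ {t₀}ᶜ) (nhds (u t₀)) :=
    hu.continuousAt.tendsto.mono_left nhdsWithin_le_nhds
  have hTan : AnalyticAt ℝ (taylorWithinEval f N J t₀) t₀ := by
    have : taylorWithinEval f N J t₀ = fun t => ∑ j ∈ Finset.range (N + 1),
        (((j.factorial : ℝ)⁻¹ * (t - t₀) ^ j) • iteratedDerivWithin j f J t₀) := by
      ext t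
      exact taylor_within_apply f N J t₀ t
    rw [this]
    fun_prop
  have htay := taylor_isLittleO (n := N) hJ ht₀ (hf.of_le (by exact_mod_cast le_top))
  rw [hJo.nhdsWithin_eq ht₀] at htay
  rcases isLittleO_pow_or_eventually_ne_zero hTan htay with h | h
  · left
    have hBO : B =O[nhdsWithin t₀ {t₀}ᶜ] fun _ => (1 : ℝ) :=
      (hBc.tendsto.mono_left nhdsWithin_le_nhds).isBigO_one ℝ
    have h1 := (h.mul_isBigO hBO).def (c := ‖u t₀‖ / 2) (by positivity)
    have h2 : ∀ᶠ t in nhdsWithin t₀ {t₀}ᶜ, ‖u t₀‖ / 2 < ‖u t‖ :=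
      hu'.norm.eventually_const_lt (by have := norm_pos_iff.2 hu0; linarith)
    filter_upwards [h1, h2, nhdsWithin_le_nhds hau, nhdsWithin_le_nhds hfac,
      self_mem_nhdsWithin] with t h1 h2 h3 h4 h5
    by_contra h6
    have h7 := (mul_eq_zero.1 h4).resolve_left (pow_ne_zero _ h6)
    have hp : 0 < ‖(t - t₀) ^ N‖ := norm_pos_iff.2 (pow_ne_zero _ (sub_ne_zero.2 h5))
    rw [eq_neg_of_add_eq_zero_right h7, h3, norm_neg, norm_smul, mul_comm, mul_one] at h1
    exact absurd (le_of_mul_le_mul_right h1 hp) (not_le.2 h2)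
  · exact Or.inr h

section FiniteGroup

open MvPolynomial

variable {m : ℕ} {G : Type*} [Group G] (ρ : G →* ((Fin m → ℂ) ≃ₗ[ℂ] (Fin m → ℂ)))

/-- The `i`-th coordinate of `x ↦ ρ g x` as a polynomial. -/
noncomputable def coordPoly (g : G) (i : Fin m) : MvPolynomial (Fin m) ℂ :=
  ∑ j, C (ρ g (Pi.single j 1) i) * X j

theorem eval_coordPoly (g : G) (i : Fin m) (x : Fin m → ℂ) :
    eval x (coordPoly ρ g i) = ρ g x i := by
  conv_rhs => rw [← Finset.univ_sum_single x, map_sum, Finset.sum_apply]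
  simp only [coordPoly, map_sum, map_mul, eval_C, eval_X]
  refine Finset.sum_congr rfl fun j _ => ?_
  have : (Pi.single j (x j) : Fin m → ℂ) = x j • Pi.single j 1 := by
    rw [← Pi.single_smul, smul_eq_mul, mul_one]
  rw [this, map_smul, Pi.smul_apply, smul_eq_mul, mul_comm]

/-- A point outside a finite set is separated from it by a polynomial. -/
theorem exists_eval_eq_one_forall_eval_eq_zero (x : Fin m → ℂ) (s : Finset (Fin m → ℂ))
    (hx : x ∉ s) : ∃ p : MvPolynomial (Fin m) ℂ, eval x p = 1 ∧ ∀ y ∈ s, eval y p = 0 := by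
  have h : ∀ y : s, ∃ i, x i ≠ y.1 i := fun y =>
    Function.ne_iff.1 fun h => hx (h ▸ y.2)
  choose i hi using h
  refine ⟨∏ y : s, C (x (i y) - y.1 (i y))⁻¹ * (X (i y) - C (y.1 (i y))), ?_, fun y hy => ?_⟩
  · rw [map_prod]
    refine Finset.prod_eq_one fun y _ => ?_
    simp [sub_ne_zero.2 (hi y)]
  · rw [map_prod]
    exact Finset.prod_eq_zero (Finset.mem_univ ⟨y, hy⟩) (by simp)

/-- Disjoint finite sets are separated by a polynomial. -/
theorem exists_eval_eq_zero_and_eval_eq_one (s t : Finset (Fin m → ℂ)) (h : Disjoint s t) :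
    ∃ p : MvPolynomial (Fin m) ℂ, (∀ x ∈ s, eval x p = 0) ∧ ∀ y ∈ t, eval y p = 1 := by
  choose p hp1 hp0 using fun x : s =>
    exists_eval_eq_one_forall_eval_eq_zero x.1 t (Finset.disjoint_left.1 h x.2)
  refine ⟨∏ x : s, (1 - p x), fun x hx => ?_, fun y hy => ?_⟩
  · rw [map_prod]
    exact Finset.prod_eq_zero (Finset.mem_univ ⟨x, hx⟩)
      (by rw [map_sub, hp1 ⟨x, hx⟩, map_one, sub_self])
  · rw [map_prod]
    exact Finset.prod_eq_one fun x _ => by simp [hp0 x y hy]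

variable [Fintype G]

/-- Invariant polynomials of a finite group separate orbits. -/
theorem exists_eq_of_forall_invariant_eval_eq (x y : Fin m → ℂ)
    (h : ∀ f : MvPolynomial (Fin m) ℂ, (∀ g z, eval (ρ g z) f = eval z f) →
      eval x f = eval y f) : ∃ g, y = ρ g x := by
  classical
  by_contra! hne
  have hdisj : Disjoint (Finset.univ.image fun g => ρ g x)
      (Finset.univ.image fun g => ρ g y) := by
    rw [Finset.disjoint_left]
    intro z hz hz'
    obtain ⟨a, -, rfl⟩ := Finset.mem_image.1 hz
    obtain ⟨b, -, hb⟩ := Finset.mem_image.1 hz'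
    refine hne (b⁻¹ * a) ?_
    rw [map_mul, LinearEquiv.mul_apply, ← hb, ← LinearEquiv.mul_apply, ← map_mul]
    simp
  obtain ⟨q, hq0, hq1⟩ := exists_eval_eq_zero_and_eval_eq_one _ _ hdisj
  have hev : ∀ z, eval z (∏ g, bind₁ (coordPoly ρ g) q) = ∏ g, eval (ρ g z) q := fun z => by
    rw [map_prod]
    refine Finset.prod_congr rfl fun g _ => ?_
    rw [← aeval_eq_eval, aeval_bind₁]
    simp only [aeval_eq_eval, eval_coordPoly]
  have := h (∏ g, bind₁ (coordPoly ρ g) q) fun g z => by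
    rw [hev, hev]
    refine Fintype.prod_equiv (Equiv.mulRight g) _ _ fun a => ?_
    simp [map_mul, LinearEquiv.mul_apply]
  rw [hev, hev, Finset.prod_eq_zero (Finset.mem_univ 1)
      (hq0 _ (Finset.mem_image_of_mem _ (Finset.mem_univ _))),
    Finset.prod_eq_one fun g _ => hq1 _ (Finset.mem_image_of_mem _ (Finset.mem_univ _))] at this
  exact zero_ne_one this

/-- The monic polynomial whose roots are the differences of `i`-th coordinates of pairs of points
in a generic orbit. -/
noncomputable def diffPoly (i : Fin m) : Polynomial (MvPolynomial (Fin m) ℂ) :=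
  ∏ p : G × G, (Polynomial.X - Polynomial.C (coordPoly ρ p.1 i - coordPoly ρ p.2 i))

theorem diffPoly_monic (i : Fin m) : (diffPoly ρ i).Monic :=
  Polynomial.monic_prod_of_monic _ _ fun _ _ => Polynomial.monic_X_sub_C _

theorem map_eval_diffPoly (i : Fin m) (x : Fin m → ℂ) :
    (diffPoly ρ i).map (eval x) =
      ∏ p : G × G, (Polynomial.X - Polynomial.C (ρ p.1 x i - ρ p.2 x i)) := by
  simp [diffPoly, Polynomial.map_prod, eval_coordPoly]

theorem eval_coeff_diffPoly_invariant (i : Fin m) (k : ℕ) (g : G) (x : Fin m → ℂ) :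
    eval (ρ g x) ((diffPoly ρ i).coeff k) = eval x ((diffPoly ρ i).coeff k) := by
  rw [← Polynomial.coeff_map, ← Polynomial.coeff_map, map_eval_diffPoly, map_eval_diffPoly]
  congr 1
  refine Fintype.prod_equiv ((Equiv.mulRight g).prodCongr (Equiv.mulRight g)) _ _ fun a => ?_
  simp [map_mul, LinearEquiv.mul_apply]

theorem sum_coeff_diffPoly_eq_zero (i : Fin m) (x : Fin m → ℂ) (a b : G) :
    ∑ j ∈ Finset.range ((diffPoly ρ i).natDegree + 1),
      eval x ((diffPoly ρ i).coeff j) * (ρ a x i - ρ b x i) ^ j = 0 := by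
  rw [← Polynomial.eval₂_eq_sum_range, ← Polynomial.eval_map, map_eval_diffPoly,
    Polynomial.eval_prod]
  exact Finset.prod_eq_zero (Finset.mem_univ (a, b)) (by simp)

end FiniteGroup

/-- Uniqueness of smooth lifts (finite group): two `C^∞` lifts of a real-analytic
curve in `σ(ℂ^m)` differ near `t₀` by a fixed group element. -/
theorem stmt7
    {m n : ℕ} {G : Type} [Group G] [Fintype G]
    (ρ : G →* ((Fin m → ℂ) ≃ₗ[ℂ] (Fin m → ℂ)))
    (σ : Fin n → MvPolynomial (Fin m) ℂ) (deg : Fin n → ℕ)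
    (hdeg : ∀ k, 1 ≤ deg k)
    (hhom : ∀ k, (σ k).IsHomogeneous (deg k))
    (hinv : ∀ k g x, MvPolynomial.eval (ρ g x) (σ k) = MvPolynomial.eval x (σ k))
    (hgen : ∀ f : MvPolynomial (Fin m) ℂ,
      (∀ g x, MvPolynomial.eval (ρ g x) f = MvPolynomial.eval x f) →
      ∃ p : MvPolynomial (Fin n) ℂ, MvPolynomial.aeval σ p = f)
    (σm : (Fin m → ℂ) → (Fin n → ℂ))
    (hσm : ∀ x k, σm x k = MvPolynomial.eval x (σ k))
    (I : Set ℝ) (hIo : IsOpen I) (hIc : I.OrdConnected)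
    (t₀ : ℝ) (ht₀ : t₀ ∈ I)
    (c : ℝ → Fin n → ℂ) (hc : AnalyticOnNhd ℝ c I)
    (hcσ : ∀ t ∈ I, ∃ x : Fin m → ℂ, σm x = c t)
    (J : Set ℝ) (hJo : IsOpen J) (hJc : J.OrdConnected) (hJI : J ⊆ I) (ht₀J : t₀ ∈ J)
    (c1 c2 : ℝ → Fin m → ℂ)
    (hc1 : ContDiffOn ℝ (⊤:ℕ∞) c1 J) (hc2 : ContDiffOn ℝ (⊤:ℕ∞) c2 J)
    (hl1 : ∀ t ∈ J, σm (c1 t) = c t) (hl2 : ∀ t ∈ J, σm (c2 t) = c t) :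
    ∃ (g : G) (δ : ℝ), 0 < δ ∧ ∀ t ∈ J, |t - t₀| < δ → c1 t = ρ g (c2 t) := by
    classical
  have horb : ∀ t ∈ J, ∃ g, c2 t = ρ g (c1 t) := fun t ht => by
    refine exists_eq_of_forall_invariant_eval_eq ρ _ _ fun f hf => ?_
    obtain ⟨p, rfl⟩ := hgen f hf
    have h : ∀ x, MvPolynomial.eval x (MvPolynomial.aeval σ p) =
        MvPolynomial.eval (σm x) p := fun x => by
      rw [← MvPolynomial.bind₁, ← MvPolynomial.aeval_eq_eval, MvPolynomial.aeval_bind₁]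
      simp only [MvPolynomial.aeval_eq_eval, ← hσm]
    rw [h, h, hl1 t ht, hl2 t ht]
  have heval : ∀ f : MvPolynomial (Fin m) ℂ,
      (∀ g x, MvPolynomial.eval (ρ g x) f = MvPolynomial.eval x f) →
      ∃ p : MvPolynomial (Fin n) ℂ, ∀ x, MvPolynomial.eval x f = MvPolynomial.eval (σm x) p := by
    intro f hf
    obtain ⟨p, rfl⟩ := hgen f hf
    refine ⟨p, fun x => ?_⟩
    rw [← MvPolynomial.bind₁, ← MvPolynomial.aeval_eq_eval, MvPolynomial.aeval_bind₁]
    simp only [MvPolynomial.aeval_eq_eval, ← hσm]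
  have horb : ∀ t ∈ J, ∃ g, c2 t = ρ g (c1 t) := fun t ht => by
    refine exists_eq_of_forall_invariant_eval_eq ρ _ _ fun f hf => ?_
    obtain ⟨p, hp⟩ := heval f hf
    rw [hp, hp, hl1 t ht, hl2 t ht]
  have hsmooth : ∀ g i, ContDiffOn ℝ (⊤ : ℕ∞) (fun t => c1 t i - ρ g (c2 t) i) J := fun g i => by
    have hL : ContDiff ℝ (⊤ : ℕ∞) fun x => ρ g x :=
      (((ρ g : (Fin m → ℂ) →ₗ[ℂ] (Fin m → ℂ)).toContinuousLinearMap).restrictScalars ℝ).contDiff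
    exact (contDiffOn_pi.1 hc1 i).sub (contDiffOn_pi.1 (hL.comp_contDiffOn hc2) i)
  have hdich : ∀ g i, (∀ᶠ t in nhdsWithin t₀ {t₀}ᶜ, c1 t i - ρ g (c2 t) i = 0) ∨
      ∀ᶠ t in nhdsWithin t₀ {t₀}ᶜ, c1 t i - ρ g (c2 t) i ≠ 0 := fun g i => by
    choose p hp using fun j => heval _ (eval_coeff_diffPoly_invariant ρ i j)
    have hcoeff : ∀ t ∈ J, ∀ j, MvPolynomial.eval (c t) (p j) =
        MvPolynomial.eval (c1 t) ((diffPoly ρ i).coeff j) := fun t ht j => by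
      rw [hp, hl1 t ht]
    refine eventually_eq_zero_or_eventually_ne_zero hJo hJc.convex ht₀J (hsmooth g i)
      (diffPoly ρ i).natDegree (fun j t => MvPolynomial.eval (c t) (p j)) (fun j => ?_) ?_ ?_
    · exact AnalyticAt.aeval_mvPolynomial (fun k => analyticAt_pi_iff.1 (hc t₀ ht₀) k) (p j)
    · intro h
      have h0 := h.self_of_nhds
      rw [hcoeff t₀ ht₀J, Polynomial.coeff_natDegree, diffPoly_monic, map_one] at h0
      exact one_ne_zero h0
    · intro t ht
      obtain ⟨b, hb⟩ := horb t ht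
      have h := sum_coeff_diffPoly_eq_zero ρ i (c1 t) 1 (g * b)
      simp only [hcoeff t ht, hb]
      simpa [map_mul, LinearEquiv.mul_apply] using h
  have hg : ∃ g, ∀ i, ∀ᶠ t in nhdsWithin t₀ {t₀}ᶜ, c1 t i - ρ g (c2 t) i = 0 := by
    by_contra! hne
    choose i hi using hne
    have hall : ∀ᶠ t in nhdsWithin t₀ {t₀}ᶜ, ∀ g, c1 t (i g) - ρ g (c2 t) (i g) ≠ 0 :=
      eventually_all.2 fun g =>
        (hdich g (i g)).resolve_left fun h => hi g (h.mono fun _ => not_not.2)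
    obtain ⟨t, ht, htJ⟩ := (hall.and (nhdsWithin_le_nhds (hJo.mem_nhds ht₀J))).exists
    obtain ⟨b, hb⟩ := horb t htJ
    refine ht b⁻¹ ?_
    rw [hb, ← LinearEquiv.mul_apply, ← map_mul]
    simp
  obtain ⟨g, hg⟩ := hg
  have hev : ∀ᶠ t in nhds t₀, c1 t = ρ g (c2 t) := by
    have hfull : ∀ i, ∀ᶠ t in nhds t₀, c1 t i - ρ g (c2 t) i = 0 := fun i =>
      (((hsmooth g i).continuousOn.continuousAt
        (hJo.mem_nhds ht₀J)).eventuallyEq_nhds_iff_eventuallyEq_nhdsNE continuousAt_const).1 (hg i)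
    filter_upwards [eventually_all.2 hfull] with t ht
    exact funext fun i => sub_eq_zero.1 (ht i)
  obtain ⟨δ, hδ, h⟩ := Metric.eventually_nhds_iff.1 hev
  exact ⟨g, δ, hδ, fun t _ ht => h (by rwa [Real.dist_eq])⟩
end

section
/- Assume in addition that the only vector fixed by all ρ(g), g ∈ G, is 0 (i.e., V^G = {0}). Let d = max(d₁,…,d_n), let I ⊆ ℝ be an open interval containing 0, and let c = (c₁,…,c_n) : I → ℂ^n be a curve of class C^d with c(t) ∈ σ(ℂ^m) for all t. Then the following are equivalent: (1) for each 1 ≤ k ≤ n the coordinate c_k has multiplicity ≥ d_k at 0, i.e., c_k(t) = t^{d_k} φ_k(t) near 0 with φ_k continuous; (2) for every nonconstant homogeneous G-invariant polynomial f ∈ ℂ[x₁,…,x_m] of degree e, and every polynomial p ∈ ℂ[y₁,…,y_n] with f = p(σ₁,…,σ_n), the function t ↦ p(c(t)) has multiplicity ≥ e at 0, i.e., p(c(t)) = t^e ψ(t) near 0 with ψ continuous. -/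
open MeasureTheory Set Filter

/-- Evaluating a weighted homogeneous polynomial on a weighted dilation of a point. -/
theorem MvPolynomial.IsWeightedHomogeneous.eval_pow_mul {ι R : Type*} [Fintype ι]
    [CommSemiring R] {w : ι → ℕ} {e : ℕ} {p : MvPolynomial ι R}
    (hp : p.IsWeightedHomogeneous w e) (t : R) (y : ι → R) :
    MvPolynomial.eval (fun i => t ^ w i * y i) p = t ^ e * MvPolynomial.eval y p := by
  rw [MvPolynomial.eval_eq', MvPolynomial.eval_eq', Finset.mul_sum]
  refine Finset.sum_congr rfl fun d hd => ?_
  have hw : Finsupp.weight w d = e := hp (MvPolynomial.mem_support_iff.mp hd)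
  have ht : ∏ i, (t ^ w i) ^ d i = t ^ e := by
    rw [← hw, Finsupp.weight_apply, Finsupp.sum_fintype _ _ (by simp), ← Finset.prod_pow_eq_pow_sum]
    exact Finset.prod_congr rfl fun i _ => by rw [← pow_mul, smul_eq_mul, mul_comm]
  simp only [mul_pow, Finset.prod_mul_distrib, ht]
  ring

/-- Substituting homogeneous polynomials of degrees `w` turns weighted homogeneous components
into homogeneous components. -/
theorem MvPolynomial.homogeneousComponent_aeval {ι τ R : Type*} [Fintype ι] [CommSemiring R]
    {w : ι → ℕ} {g : ι → MvPolynomial τ R} (hg : ∀ i, (g i).IsHomogeneous (w i)) (e : ℕ)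
    (p : MvPolynomial ι R) :
    MvPolynomial.homogeneousComponent e (MvPolynomial.aeval g p) =
      MvPolynomial.aeval g (MvPolynomial.weightedHomogeneousComponent w e p) := by
  induction p using MvPolynomial.induction_on' with
  | monomial d a =>
    have hmon : (MvPolynomial.aeval g (MvPolynomial.monomial d a)).IsHomogeneous
        (Finsupp.weight w d) := by
      rw [MvPolynomial.aeval_monomial, Finsupp.prod_fintype _ _ (by simp), Finsupp.weight_apply,
        Finsupp.sum_fintype _ _ (by simp), ← zero_add (∑ i, d i • w i)]
      refine (MvPolynomial.isHomogeneous_C τ a).mul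
        (MvPolynomial.IsHomogeneous.prod _ _ _ fun i _ => ?_)
      rw [smul_eq_mul, mul_comm]
      exact (hg i).pow _
    rw [MvPolynomial.homogeneousComponent_of_mem hmon,
      MvPolynomial.weightedHomogeneousComponent_of_mem
        (MvPolynomial.isWeightedHomogeneous_monomial w d a rfl)]
    split_ifs <;> simp
  | add p q hp hq => simp only [map_add, hp, hq]

/-- Multiplicity lemma: for `V^G = {0}` and a `C^d` curve `c` in `σ(ℂ^m)`
(`d = max dₖ`), the coordinates satisfy `m(cₖ) ≥ dₖ` at `0` iff
`m(f ∘ c) ≥ deg f` for all nonconstant homogeneous invariant `f`. -/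
theorem stmt8
    {m n : ℕ} {G : Type} [Group G] [Fintype G]
    (ρ : G →* ((Fin m → ℂ) ≃ₗ[ℂ] (Fin m → ℂ)))
    (σ : Fin n → MvPolynomial (Fin m) ℂ) (deg : Fin n → ℕ)
    (hdeg : ∀ k, 1 ≤ deg k)
    (hhom : ∀ k, (σ k).IsHomogeneous (deg k))
    (hinv : ∀ k g x, MvPolynomial.eval (ρ g x) (σ k) = MvPolynomial.eval x (σ k))
    (hgen : ∀ f : MvPolynomial (Fin m) ℂ,
      (∀ g x, MvPolynomial.eval (ρ g x) f = MvPolynomial.eval x f) →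
      ∃ p : MvPolynomial (Fin n) ℂ, MvPolynomial.aeval σ p = f)
    (σm : (Fin m → ℂ) → (Fin n → ℂ))
    (hσm : ∀ x k, σm x k = MvPolynomial.eval x (σ k))
    (hVG : ∀ x : Fin m → ℂ, (∀ g : G, ρ g x = x) → x = 0)
    (I : Set ℝ) (hIo : IsOpen I) (hIc : I.OrdConnected) (h0 : (0:ℝ) ∈ I)
    (c : ℝ → Fin n → ℂ) (hc : ContDiffOn ℝ (Finset.univ.sup deg : ℕ) c I)
    (hcσ : ∀ t ∈ I, ∃ x : Fin m → ℂ, σm x = c t) :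
    ((∀ k : Fin n, ∃ (ε : ℝ) (φ : ℝ → ℂ), 0 < ε ∧ Set.Ioo (-ε) ε ⊆ I ∧
        ContinuousOn φ (Set.Ioo (-ε) ε) ∧
        ∀ t ∈ Set.Ioo (-ε) ε, c t k = (t:ℂ) ^ (deg k) * φ t)
      ↔
      (∀ e : ℕ, 1 ≤ e → ∀ f : MvPolynomial (Fin m) ℂ, f.IsHomogeneous e →
        (∀ g x, MvPolynomial.eval (ρ g x) f = MvPolynomial.eval x f) →
        ∀ p : MvPolynomial (Fin n) ℂ, MvPolynomial.aeval σ p = f →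
        ∃ (ε : ℝ) (ψ : ℝ → ℂ), 0 < ε ∧ Set.Ioo (-ε) ε ⊆ I ∧
          ContinuousOn ψ (Set.Ioo (-ε) ε) ∧
          ∀ t ∈ Set.Ioo (-ε) ε, MvPolynomial.eval (c t) p = (t:ℂ) ^ e * ψ t)) := by
  constructor
  · intro h e _ f hf _ p hp
    choose ε φ hε hεI hφ hcφ using h
    obtain ⟨δ, hδ, hδI⟩ := Metric.isOpen_iff.mp hIo 0 h0
    have hsmall : ∀ᶠ η in nhdsWithin (0 : ℝ) (Set.Ioi 0), 0 < η ∧ η < δ ∧ ∀ k, η < ε k :=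
      (eventually_mem_nhdsWithin).and <| (eventually_nhdsWithin_of_eventually_nhds
        (eventually_lt_nhds hδ)).and <| eventually_all.mpr fun k =>
          eventually_nhdsWithin_of_eventually_nhds (eventually_lt_nhds (hε k))
    obtain ⟨η, hη, hηδ, hηε⟩ := hsmall.exists
    have hsub : ∀ k, Set.Ioo (-η) η ⊆ Set.Ioo (-ε k) (ε k) := fun k =>
      Set.Ioo_subset_Ioo (neg_le_neg (hηε k).le) (hηε k).le
    have hηI : Set.Ioo (-η) η ⊆ I := fun t ht => hδI <| by
      rw [Metric.mem_ball, dist_zero_right, Real.norm_eq_abs]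
      exact (abs_lt.mpr ht).trans hηδ
    set q := MvPolynomial.weightedHomogeneousComponent deg e p
    have hq : MvPolynomial.aeval σ q = f := by
      rw [← MvPolynomial.homogeneousComponent_aeval hhom, hp,
        MvPolynomial.homogeneousComponent_eq_self hf]
    have heval : ∀ x (r : MvPolynomial (Fin n) ℂ),
        MvPolynomial.eval (σm x) r = MvPolynomial.eval x (MvPolynomial.aeval σ r) := by
      intro x r
      rw [funext (hσm x)]
      simp only [← MvPolynomial.coe_aeval_eq_eval, RingHom.coe_coe,
        MvPolynomial.comp_aeval_apply]
    refine ⟨η, fun t => MvPolynomial.eval (fun k => φ k t) q, hη, hηI, ?_, fun t ht => ?_⟩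
    · exact (MvPolynomial.continuous_eval q).comp_continuousOn
        (continuousOn_pi.mpr fun k => (hφ k).mono (hsub k))
    · obtain ⟨x, hx⟩ := hcσ t (hηI ht)
      rw [← hx, heval, hp, ← hq, ← heval, hx,
        funext fun k => hcφ k t (hsub k ht)]
      exact (MvPolynomial.weightedHomogeneousComponent_isWeightedHomogeneous e p).eval_pow_mul _ _
  · intro h k
    simpa using h (deg k) (hdeg k) (σ k) (hhom k) (fun g x => hinv k g x) (MvPolynomial.X k)
      (MvPolynomial.aeval_X σ k)
end

section
/- Let I ⊆ ℝ be an open interval containing 0 and let c = (c₁,…,c_n) : I → ℂ^n be a continuous curve with c(t) ∈ σ(ℂ^m) for all t and c(0) = 0. Then the following are equivalent: (1) there exists a continuous lift c̄ of c (σ ∘ c̄ = c) defined near 0 with c̄(0) = 0 which is differentiable at 0; (2) for each 1 ≤ k ≤ n there is a continuous function γ_k near 0 with c_k(t) = t^{d_k} γ_k(t). (This is the instance at the point v = 0 of the paper's characterization of curves admitting lifts differentiable at a point.) -/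
open MeasureTheory Set Filter

open Topology

section PathLifting

variable {G X : Type*} [Group G] [MulAction G X] [TopologicalSpace X]

/-- `f` can be moved within its `H`-orbits to a map which is continuous on `S`. -/
def LiftsOn (H : Subgroup G) (f : ℝ → X) (S : Set ℝ) : Prop :=
  ∃ h : ℝ → G, (∀ t, h t ∈ H) ∧ ContinuousOn (fun t => h t • f t) S

/-- Continuity at `t` of the map to the orbit space `X / H` induced by `f`. -/
def OrbitContinuousAt (H : Subgroup G) (f : ℝ → X) (t : ℝ) : Prop :=
  ∀ U ∈ 𝓝 (f t), ∀ᶠ s in 𝓝 t, ∃ h ∈ H, h • f s ∈ U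

lemma LiftsOn.mono {H : Subgroup G} {f : ℝ → X} {S T : Set ℝ} (hS : LiftsOn H f S)
    (hTS : T ⊆ S) : LiftsOn H f T := by
  obtain ⟨h, hH, hc⟩ := hS
  exact ⟨h, hH, hc.mono hTS⟩

lemma LiftsOn.normalize [ContinuousConstSMul G X] {H : Subgroup G} {f : ℝ → X} {S : Set ℝ}
    (hS : LiftsOn H f S) (p : ℝ) :
    ∃ h : ℝ → G, (∀ t, h t ∈ H) ∧ h p = 1 ∧ ContinuousOn (fun t => h t • f t) S := by
  obtain ⟨h, hH, hc⟩ := hS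
  refine ⟨fun t => (h p)⁻¹ * h t, fun t => H.mul_mem (H.inv_mem (hH p)) (hH t), by simp, ?_⟩
  simp only [mul_smul]
  exact hc.const_smul _

lemma ContinuousOn.of_inter_Iic_Ici {F : ℝ → X} {S : Set ℝ} (p : ℝ)
    (h₁ : ContinuousOn F (S ∩ Iic p)) (h₂ : ContinuousOn F (S ∩ Ici p)) : ContinuousOn F S := by
  intro x hx
  have hS : S = (S ∩ Iic p) ∪ (S ∩ Ici p) := by
    rw [← inter_union_distrib_left, Iic_union_Ici, inter_univ]
  rw [hS]
  refine ContinuousWithinAt.union ?_ ?_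
  · by_cases hxp : x ≤ p
    · exact h₁ x ⟨hx, hxp⟩
    · exact continuousWithinAt_of_notMem_closure fun h =>
        hxp (closure_minimal inter_subset_right isClosed_Iic h)
  · by_cases hxp : p ≤ x
    · exact h₂ x ⟨hx, hxp⟩
    · exact continuousWithinAt_of_notMem_closure fun h =>
        hxp (closure_minimal inter_subset_right isClosed_Ici h)

lemma exists_continuousOn_of_monotone_seq [ContinuousConstSMul G X] {H : Subgroup G} {f : ℝ → X}
    {u : ℕ → ℝ} (hu : Monotone u) (hl : ∀ n, LiftsOn H f (Icc (u n) (u (n + 1)))) :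
    ∃ h : ℝ → G, (∀ t, h t ∈ H) ∧ h (u 0) = 1 ∧
      ∀ n, ContinuousOn (fun t => h t • f t) (Icc (u 0) (u n)) := by
  classical
  choose k hkH hk1 hkc using fun n => (hl n).normalize (u n)
  let F : ℕ → ℝ → G := fun n => Nat.rec (fun _ => 1)
    (fun n g s => if s ≤ u n then g s else g (u n) * k n s) n
  have F0 : F 0 = fun _ => 1 := rfl
  have Fs : ∀ n, F (n + 1) = fun s => if s ≤ u n then F n s else F n (u n) * k n s :=
    fun n => rfl
  have FH : ∀ n s, F n s ∈ H := by
    intro n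
    induction n with
    | zero => intro s; exact H.one_mem
    | succ n ih =>
      intro s
      rw [Fs]
      dsimp only
      split_ifs
      · exact ih s
      · exact H.mul_mem (ih _) (hkH n s)
  have Fc : ∀ n, ContinuousOn (fun t => F n t • f t) (Icc (u 0) (u n)) := by
    intro n
    induction n with
    | zero => rw [Icc_self]; exact continuousOn_singleton _ _
    | succ n ih =>
      refine ContinuousOn.of_inter_Iic_Ici (u n) ?_ ?_
      · refine (ih.mono fun s hs => ⟨hs.1.1, hs.2⟩).congr fun s hs => ?_
        have : s ≤ u n := hs.2
        simp [Fs, this]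
      · refine (((hkc n).const_smul (F n (u n))).mono fun s hs => ⟨hs.2, hs.1.2⟩).congr
          fun s hs => ?_
        have hs2 : u n ≤ s := hs.2
        rcases hs2.eq_or_lt with rfl | hlt
        · simp [Fs, hk1]
        · simp [Fs, hlt.not_ge, mul_smul]
  have Fagree : ∀ n m, n ≤ m → ∀ s ≤ u n, F m s = F n s := by
    intro n m hnm
    induction m, hnm using Nat.le_induction with
    | base => intro s _; rfl
    | succ m hm ih =>
      intro s hs
      rw [← ih s hs, Fs]
      simp [hs.trans (hu hm)]
  refine ⟨fun s => if hs : ∃ n, s ≤ u n then F (Nat.find hs) s else 1, fun t => ?_, ?_, fun n => ?_⟩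
  · dsimp only
    split_ifs
    · exact FH _ _
    · exact H.one_mem
  · have h0 : ∃ n, u 0 ≤ u n := ⟨0, le_rfl⟩
    have h1 := Fagree 0 (Nat.find h0) (Nat.zero_le _) (u 0) le_rfl
    simp only [h0, dif_pos, h1, F0]
  · refine (Fc n).congr fun s hs => ?_
    have h0 : ∃ n, s ≤ u n := ⟨n, hs.2⟩
    have h1 := Fagree (Nat.find h0) n (Nat.find_min' h0 hs.2) s (Nat.find_spec h0)
    simp only [h0, dif_pos, h1]

lemma LiftsOn.Icc_of_local [ContinuousConstSMul G X] {H : Subgroup G} {f : ℝ → X} {a b : ℝ}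
    (hl : ∀ t ∈ Icc a b, ∃ V ∈ 𝓝 t, LiftsOn H f V) : LiftsOn H f (Icc a b) := by
  rcases le_or_gt a b with hab | hab
  · choose! V hV hVl using hl
    obtain ⟨t, ht0, htm, ⟨N, hN⟩, hsub⟩ := exists_monotone_Icc_subset_open_cover_Icc hab
      (c := fun i : Icc a b => Subtype.val ⁻¹' interior (V i))
      (fun i => isOpen_interior.preimage continuous_subtype_val)
      (fun x _ => mem_iUnion.2 ⟨x, mem_interior_iff_mem_nhds.2 (hV x x.2)⟩)
    obtain ⟨h, hH, -, hc⟩ := exists_continuousOn_of_monotone_seq (H := H) (f := f)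
      (u := fun n => (t n : ℝ)) (fun i j hij => htm hij) fun n => by
        obtain ⟨i, hi⟩ := hsub n
        refine (hVl i i.2).mono fun x hx => interior_subset ?_
        exact @hi ⟨x, (t n).2.1.trans hx.1, hx.2.trans (t (n + 1)).2.2⟩ hx
    refine ⟨h, hH, ?_⟩
    have := hc N
    rwa [ht0, hN N le_rfl] at this
  · exact ⟨fun _ => 1, fun _ => H.one_mem, by simp [Icc_eq_empty hab.not_ge]⟩

lemma exists_continuousOn_inter_Ici [ContinuousConstSMul G X] {H : Subgroup G} {f : ℝ → X}
    {C : Set ℝ} (hCo : IsOpen C) (hCc : C.OrdConnected) {p : ℝ} (hp : p ∈ C)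
    (hl : ∀ t ∈ C, ∃ V ∈ 𝓝 t, LiftsOn H f V) :
    ∃ h : ℝ → G, (∀ t, h t ∈ H) ∧ h p = 1 ∧ ContinuousOn (fun t => h t • f t) (C ∩ Ici p) := by
  have hD : (C ∩ Ici p).OrdConnected := hCc.inter ordConnected_Ici
  have hne : Nonempty ↥(C ∩ Ici p) := ⟨⟨p, hp, self_mem_Ici⟩⟩
  obtain ⟨v, hvm, hvt⟩ := exists_seq_monotone_tendsto_atTop_atTop ↥(C ∩ Ici p)
  let u : ℕ → ℝ := fun n => Nat.casesOn n p fun n => v n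
  have hum : Monotone u := monotone_nat_of_le_succ fun n => by
    cases n with
    | zero => exact (v 0).2.2
    | succ n => exact hvm n.le_succ
  have huC : ∀ n, u n ∈ C := fun n => by
    cases n with
    | zero => exact hp
    | succ n => exact (v n).2.1
  obtain ⟨h, hH, h1, hc⟩ := exists_continuousOn_of_monotone_seq (H := H) (f := f) hum fun n =>
    LiftsOn.Icc_of_local fun t ht => hl t (hCc.out (huC n) (huC (n + 1)) ht)
  refine ⟨h, hH, h1, fun x hx => ?_⟩
  obtain ⟨y, hyC, hxy⟩ : ∃ y ∈ C, x < y := by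
    have := (mem_nhdsWithin_of_mem_nhds (hCo.mem_nhds hx.1) : C ∈ 𝓝[>] x)
    obtain ⟨y, hy1, hy2⟩ := Filter.nonempty_of_mem (inter_mem this self_mem_nhdsWithin)
    exact ⟨y, hy1, hy2⟩
  obtain ⟨n, hn⟩ := (hvt.eventually_ge_atTop ⟨y, hyC, hx.2.trans hxy.le⟩).exists
  have hlt : x < u (n + 1) := hxy.trans_le hn
  refine (hc (n + 1) x ⟨hx.2, hlt.le⟩).mono_of_mem_nhdsWithin ?_
  filter_upwards [self_mem_nhdsWithin, mem_nhdsWithin_of_mem_nhds (Iic_mem_nhds hlt)] with z hz hz'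
  exact ⟨hz.2, hz'⟩

lemma LiftsOn.of_local [ContinuousConstSMul G X] {H : Subgroup G} {f : ℝ → X}
    {C : Set ℝ} (hCo : IsOpen C) (hCc : C.OrdConnected)
    (hl : ∀ t ∈ C, ∃ V ∈ 𝓝 t, LiftsOn H f V) : LiftsOn H f C := by
  classical
  rcases C.eq_empty_or_nonempty with rfl | ⟨p, hp⟩
  · exact ⟨fun _ => 1, fun _ => H.one_mem, continuousOn_empty _⟩
  obtain ⟨h, hH, h1, hc⟩ := exists_continuousOn_inter_Ici hCo hCc hp hl
  obtain ⟨k, kH, k1, kc⟩ := exists_continuousOn_inter_Ici (H := H) (f := fun t => f (-t))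
    (C := -C) (p := -p) hCo.neg ⟨fun x hx y hy z hz => by
      have := hCc.out (x := -y) (y := -x) hy hx
      exact this ⟨neg_le_neg hz.2, neg_le_neg hz.1⟩⟩ (by simpa using hp) fun t ht => by
        obtain ⟨V, hV, g, gH, gc⟩ := hl (-t) ht
        exact ⟨Neg.neg ⁻¹' V, continuous_neg.continuousAt hV, fun t => g (-t), fun t => gH _,
          gc.comp continuous_neg.continuousOn fun x hx => hx⟩
  have kc' : ContinuousOn (fun t => k (-t) • f t) (C ∩ Iic p) := by
    have := kc.comp (s := C ∩ Iic p) (f := Neg.neg) continuous_neg.continuousOn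
      fun x hx => ⟨by simpa using hx.1, by simpa using hx.2⟩
    simpa [Function.comp_def] using this
  refine ⟨fun t => if t ≤ p then k (-t) else h t, fun t => ?_, ?_⟩
  · dsimp only
    split_ifs
    · exact kH _
    · exact hH _
  · refine ContinuousOn.of_inter_Iic_Ici p (kc'.congr fun t ht => ?_) (hc.congr fun t ht => ?_)
    · have : t ≤ p := ht.2
      simp [this]
    · have : p ≤ t := ht.2
      rcases this.eq_or_lt with rfl | hlt
      · simp [k1, h1]
      · simp [hlt.not_ge]

lemma LiftsOn.of_local_of_isOpen [ContinuousConstSMul G X] {H : Subgroup G} {f : ℝ → X}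
    {O : Set ℝ} (hO : IsOpen O) (hl : ∀ t ∈ O, ∃ V ∈ 𝓝 t, LiftsOn H f V) : LiftsOn H f O := by
  classical
  have key : ∀ x, LiftsOn H f (connectedComponentIn O x) := fun x =>
    LiftsOn.of_local hO.connectedComponentIn isPreconnected_connectedComponentIn.ordConnected
      fun t ht => hl t (connectedComponentIn_subset _ _ ht)
  have key' : ∀ C : Set ℝ, ∃ h : ℝ → G, (∀ t, h t ∈ H) ∧
      ((∃ x, C = connectedComponentIn O x) → ContinuousOn (fun t => h t • f t) C) := by
    intro C
    by_cases hC : ∃ x, C = connectedComponentIn O x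
    · obtain ⟨x, rfl⟩ := hC
      obtain ⟨h, hH, hc⟩ := key x
      exact ⟨h, hH, fun _ => hc⟩
    · exact ⟨fun _ => 1, fun _ => H.one_mem, fun h => absurd h hC⟩
  choose h hH hc using key'
  refine ⟨fun t => h (connectedComponentIn O t) t, fun t => hH _ t, fun t ht => ?_⟩
  have hmem : connectedComponentIn O t ∈ 𝓝 t :=
    hO.connectedComponentIn.mem_nhds (mem_connectedComponentIn ht)
  refine ContinuousAt.continuousWithinAt ?_
  refine ((hc _ ⟨t, rfl⟩).continuousAt hmem).congr ?_
  filter_upwards [hmem] with s hs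
  rw [connectedComponentIn_eq hs]

lemma exists_nhds_smul_disjoint [Finite G] [ContinuousConstSMul G X] [T2Space X] (x : X) :
    ∃ U ∈ 𝓝 x, ∀ g : G, ∀ y ∈ U, g • y ∈ U → g • x = x := by
  have : ∀ g : G, ∃ U ∈ 𝓝 x, ∀ y ∈ U, g • y ∈ U → g • x = x := by
    intro g
    by_cases hg : g • x = x
    · exact ⟨univ, univ_mem, fun _ _ _ => hg⟩
    · obtain ⟨A, B, hA, hB, hxA, hxB, hAB⟩ := t2_separation hg
      exact ⟨B ∩ (g • ·) ⁻¹' A, inter_mem (hB.mem_nhds hxB)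
        ((continuous_const_smul g).continuousAt (hA.mem_nhds hxA)),
        fun y hy hgy => (disjoint_left.1 hAB hy.2 hgy.1).elim⟩
  choose U hU hUg using this
  exact ⟨⋂ g, U g, iInter_mem.2 hU, fun g y hy hgy =>
    hUg g y (mem_iInter.1 hy g) (mem_iInter.1 hgy g)⟩

/-- Path lifting for actions of finite groups: a path in the orbit space lifts. -/
theorem LiftsOn.of_orbitContinuousAt [Finite G] [ContinuousConstSMul G X] [T2Space X]
    (H : Subgroup G) (f : ℝ → X) {J : Set ℝ} (hJ : IsOpen J)
    (hf : ∀ t ∈ J, OrbitContinuousAt H f t) : LiftsOn H f J := by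
  induction H using WellFoundedLT.induction generalizing f J with
  | ind H ih =>
  let N : Set X := {x | ∃ h ∈ H, h • x ≠ x}
  have hN : IsOpen N := by
    have : N = ⋃ h ∈ H, {x | h • x ≠ x} := by ext; simp [N]
    rw [this]
    exact isOpen_biUnion fun h _ => isOpen_ne_fun (continuous_const_smul h) continuous_id
  have hNinv : ∀ h ∈ H, ∀ x, h • x ∈ N → x ∈ N := by
    rintro h hh x ⟨g, hg, hgx⟩
    by_contra hx
    have hx' : ∀ k ∈ H, k • x = x := by simpa [N] using hx
    exact hgx (by rw [hx' h hh, hx' g hg])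
  let O : Set ℝ := {t ∈ J | f t ∈ N}
  have hO : IsOpen O := by
    rw [isOpen_iff_mem_nhds]
    rintro t ⟨htJ, htN⟩
    filter_upwards [hJ.mem_nhds htJ, hf t htJ N (hN.mem_nhds htN)] with s hs hs'
    obtain ⟨h, hh, hs'⟩ := hs'
    exact ⟨hs, hNinv h hh _ hs'⟩
  have hOl : LiftsOn H f O := by
    refine LiftsOn.of_local_of_isOpen hO ?_
    rintro t ⟨htJ, htN⟩
    obtain ⟨U, hU, hUg⟩ := exists_nhds_smul_disjoint (G := G) (f t)
    let K : Subgroup G := H ⊓ MulAction.stabilizer G (f t)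
    have hKH : K < H := by
      refine lt_of_le_of_ne inf_le_left fun hK => ?_
      obtain ⟨h, hh, hne⟩ := htN
      exact hne ((hK ▸ hh : h ∈ K).2)
    have hev : ∀ᶠ s in 𝓝 t, s ∈ J ∧ ∃ h ∈ H, h • f s ∈ interior U :=
      (hJ.eventually_mem htJ).and
        (hf t htJ _ (isOpen_interior.mem_nhds (mem_interior_iff_mem_nhds.2 hU)))
    obtain ⟨J', hJ'sub, hJ'o, htJ'⟩ := eventually_nhds_iff.1 hev
    have hex : ∀ s, ∃ h ∈ H, s ∈ J' → h • f s ∈ interior U := fun s => by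
      by_cases hs : s ∈ J'
      · obtain ⟨-, h, hh, hU⟩ := hJ'sub s hs
        exact ⟨h, hh, fun _ => hU⟩
      · exact ⟨1, H.one_mem, fun h => absurd h hs⟩
    choose h₁ h₁H h₁U using hex
    obtain ⟨k, kK, kc⟩ := ih K hKH (fun s => h₁ s • f s) hJ'o fun s hs W hW => by
      have hmem : (fun x => h₁ s • x) ⁻¹' (W ∩ interior U) ∈ 𝓝 (f s) :=
        (continuous_const_smul (h₁ s)).continuousAt
          (inter_mem hW (isOpen_interior.mem_nhds (h₁U s hs)))
      filter_upwards [hf s (hJ'sub s hs).1 _ hmem, hJ'o.mem_nhds hs] with r hr hrJ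
      obtain ⟨h, hh, hrW, hrU⟩ := hr
      have heq : (h₁ s * h * (h₁ r)⁻¹) • h₁ r • f r = h₁ s • h • f r := by
        simp [mul_smul]
      refine ⟨h₁ s * h * (h₁ r)⁻¹, ⟨H.mul_mem (H.mul_mem (h₁H s) hh) (H.inv_mem (h₁H r)), ?_⟩, ?_⟩
      · refine hUg _ (h₁ r • f r) (interior_subset (h₁U r hrJ)) ?_
        rw [heq]
        exact interior_subset hrU
      · rw [heq]
        exact hrW
    refine ⟨J', hJ'o.mem_nhds htJ', fun s => k s * h₁ s,
      fun s => H.mul_mem (kK s).1 (h₁H s), ?_⟩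
    simpa only [mul_smul] using kc
  obtain ⟨h, hH, hc⟩ := hOl
  refine ⟨h, hH, fun t ht => ContinuousAt.continuousWithinAt ?_⟩
  by_cases htN : f t ∈ N
  · exact hc.continuousAt (hO.mem_nhds ⟨ht, htN⟩)
  · have hfix : ∀ k ∈ H, k • f t = f t := by simpa [N] using htN
    intro U hU
    dsimp only at hU
    rw [hfix _ (hH t)] at hU
    have hV : (⋂ k : H, (fun x => (k : G) • x) ⁻¹' U) ∈ 𝓝 (f t) := iInter_mem.2 fun k =>
      (continuous_const_smul (k : G)).continuousAt (by rwa [hfix _ k.2])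
    rw [mem_map]
    filter_upwards [hf t ht _ hV] with s hs
    obtain ⟨k, hk, hks⟩ := hs
    have := mem_iInter.1 hks ⟨h s * k⁻¹, H.mul_mem (hH s) (H.inv_mem hk)⟩
    simpa [mul_smul] using this

end PathLifting

section Invariants

variable {m n : ℕ}

lemma MvPolynomial.IsHomogeneous.eval_smul_eq {ι R : Type*} [CommSemiring R]
    {p : MvPolynomial ι R} {d : ℕ} (hp : p.IsHomogeneous d) (a : R) (x : ι → R) :
    MvPolynomial.eval (a • x) p = a ^ d * MvPolynomial.eval x p := by
  rw [MvPolynomial.eval_eq, MvPolynomial.eval_eq, Finset.mul_sum]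
  refine Finset.sum_congr rfl fun s hs => ?_
  have hd : ∑ i ∈ s.support, s i = d := by
    have := hp (MvPolynomial.mem_support_iff.1 hs)
    simpa [Finsupp.weight_apply, Finsupp.sum] using this
  simp only [Pi.smul_apply, smul_eq_mul, mul_pow, Finset.prod_mul_distrib,
    Finset.prod_pow_eq_pow_sum, hd]
  ring

/-- Generating invariants of a finite group separate orbits. -/
lemma exists_smul_eq_of_eval_eq {G : Type*} [Group G] [Fintype G]
    (ρ : G →* ((Fin m → ℂ) ≃ₗ[ℂ] (Fin m → ℂ))) {σ : Fin n → MvPolynomial (Fin m) ℂ}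
    (hgen : ∀ f : MvPolynomial (Fin m) ℂ,
      (∀ g x, MvPolynomial.eval (ρ g x) f = MvPolynomial.eval x f) →
      ∃ p : MvPolynomial (Fin n) ℂ, MvPolynomial.aeval σ p = f)
    {x y : Fin m → ℂ} (hxy : ∀ k, MvPolynomial.eval x (σ k) = MvPolynomial.eval y (σ k)) :
    ∃ g, ρ g x = y := by
  by_contra! hne
  obtain ⟨l, hl⟩ := Module.exists_dual_forall_apply_ne_zero (K := ℂ) (fun g => ρ g x - y)
    fun g => sub_ne_zero.2 (hne g)
  let F : MvPolynomial (Fin m) ℂ := ∏ g : G,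
    (∑ i, MvPolynomial.C (l (ρ g (Pi.single i 1))) * MvPolynomial.X i - MvPolynomial.C (l y))
  have hF : ∀ z, MvPolynomial.eval z F = ∏ g : G, l (ρ g z - y) := fun z => by
    simp only [F, map_prod, map_sub, map_sum, map_mul, MvPolynomial.eval_C, MvPolynomial.eval_X]
    refine Finset.prod_congr rfl fun g _ => ?_
    congr 1
    conv_rhs => rw [pi_eq_sum_univ' z]
    simp only [map_sum, map_smul, smul_eq_mul]
    exact Finset.sum_congr rfl fun i _ => mul_comm _ _
  obtain ⟨p, hp⟩ := hgen F fun g z => by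
    rw [hF, hF]
    exact Fintype.prod_equiv (Equiv.mulRight g) _ _ fun k => by simp
  have heval : ∀ z, MvPolynomial.eval z F =
      MvPolynomial.eval (fun k => MvPolynomial.eval z (σ k)) p := fun z => by
    rw [← hp]
    change MvPolynomial.eval z (MvPolynomial.bind₁ σ p) = _
    rw [← MvPolynomial.coe_aeval_eq_eval, RingHom.coe_coe, MvPolynomial.aeval_bind₁]
    rfl
  have hFxy : MvPolynomial.eval x F = MvPolynomial.eval y F := by
    rw [heval, heval, funext hxy]
  have hy : ∏ g, l (ρ g y - y) = 0 :=
    Finset.prod_eq_zero (i := (1 : G)) (Finset.mem_univ _) (by simp)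
  rw [hF, hF, hy] at hFxy
  exact Finset.prod_ne_zero_iff.2 (fun g _ => hl g) hFxy

/-- Homogeneous polynomials of positive degree vanishing simultaneously only at the origin
form a proper map. -/
lemma exists_norm_le_of_norm_eval_le {σ : Fin n → MvPolynomial (Fin m) ℂ} {deg : Fin n → ℕ}
    (hdeg : ∀ k, 1 ≤ deg k) (hhom : ∀ k, (σ k).IsHomogeneous (deg k))
    (hzero : ∀ x, (∀ k, MvPolynomial.eval x (σ k) = 0) → x = 0) (M : ℝ) :
    ∃ R, ∀ x, (∀ k, ‖MvPolynomial.eval x (σ k)‖ ≤ M) → ‖x‖ ≤ R := by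
  have hcont : Continuous fun x : Fin m → ℂ => ‖fun k => MvPolynomial.eval x (σ k)‖ :=
    (continuous_pi fun k => MvPolynomial.continuous_eval (σ k)).norm
  have hpos : ∃ δ > 0, ∀ y ∈ Metric.sphere (0 : Fin m → ℂ) 1,
      δ ≤ ‖fun k => MvPolynomial.eval y (σ k)‖ := by
    rcases (Metric.sphere (0 : Fin m → ℂ) 1).eq_empty_or_nonempty with he | hne
    · exact ⟨1, one_pos, by simp [he]⟩
    obtain ⟨y₀, hy₀, hmin⟩ := (isCompact_sphere (0 : Fin m → ℂ) 1).exists_isMinOn hne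
      hcont.continuousOn
    refine ⟨_, norm_pos_iff.2 fun h => ?_, fun y hy => hmin hy⟩
    have := hzero y₀ fun k => congrFun h k
    simp [this] at hy₀
  obtain ⟨δ, hδ, hδy⟩ := hpos
  refine ⟨max 1 (M / δ), fun x hx => ?_⟩
  by_cases hx1 : ‖x‖ ≤ 1
  · exact hx1.trans (le_max_left _ _)
  have hx1 : 1 < ‖x‖ := not_le.1 hx1
  have hx0 : 0 < ‖x‖ := one_pos.trans hx1
  refine le_max_of_le_right ((le_div_iff₀ hδ).2 ?_)
  set y : Fin m → ℂ := ((‖x‖⁻¹ : ℝ) : ℂ) • x with hy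
  have hyn : y ∈ Metric.sphere (0 : Fin m → ℂ) 1 := by
    simp [hy, norm_smul, hx0.ne']
  have hδM : δ ≤ M / ‖x‖ := by
    have hM : 0 ≤ M := by
      by_contra! hM
      have h0 : (fun k => MvPolynomial.eval y (σ k)) = 0 :=
        funext fun k => absurd (hx k) (not_le.2 (hM.trans_le (norm_nonneg _)))
      have := hδy y hyn
      rw [h0, norm_zero] at this
      exact this.not_gt hδ
    refine (hδy y hyn).trans ((pi_norm_le_iff_of_nonneg (by positivity)).2 fun k => ?_)
    rw [hy, (hhom k).eval_smul_eq, norm_mul, norm_pow, Complex.norm_real, norm_inv, norm_norm,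
      div_eq_inv_mul]
    refine mul_le_mul ?_ (hx k) (norm_nonneg _) (by positivity)
    exact pow_le_of_le_one (by positivity) (inv_le_one_of_one_le₀ hx1.le)
      (Nat.one_le_iff_ne_zero.1 (hdeg k))
  rw [le_div_iff₀ hx0] at hδM
  linarith

/-- Continuous maps into the image of a proper orbit map lift through it. -/
lemma exists_continuousOn_lift {G X Y : Type*} [Group G] [Finite G] [MulAction G X]
    [MetricSpace X] [ProperSpace X] [ContinuousConstSMul G X] [MetricSpace Y] (x₀ : X)
    {π : X → Y} (hπ : Continuous π) (hinv : ∀ (g : G) x, π (g • x) = π x)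
    (hsep : ∀ x y, π x = π y → ∃ g : G, g • x = y)
    (hprop : ∀ y : Y, ∀ r : ℝ, ∃ R, ∀ x, dist (π x) y ≤ r → dist x x₀ ≤ R)
    {J : Set ℝ} (hJ : IsOpen J) {γ : ℝ → Y} (hγ : ContinuousOn γ J)
    (hγr : ∀ t ∈ J, γ t ∈ range π) :
    ∃ b : ℝ → X, ContinuousOn b J ∧ ∀ t ∈ J, π (b t) = γ t := by
  have : Nonempty X := ⟨x₀⟩
  choose! f hf using hγr
  have hO : ∀ t ∈ J, OrbitContinuousAt (⊤ : Subgroup G) f t := by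
    intro t ht U hU
    obtain ⟨R, hR⟩ := hprop (γ t) 1
    let W : Set X := ⋃ g : G, (fun x => g • x) ⁻¹' interior U
    have hW : IsOpen W :=
      isOpen_iUnion fun g => isOpen_interior.preimage (continuous_const_smul g)
    have hK : IsCompact (π '' (Metric.closedBall x₀ R \ W)) :=
      ((isCompact_closedBall x₀ R).diff hW).image hπ
    have hmem : γ t ∈ (π '' (Metric.closedBall x₀ R \ W))ᶜ := by
      rintro ⟨x, ⟨-, hx⟩, hxt⟩
      obtain ⟨g, hg⟩ := hsep x (f t) (hxt.trans (hf t ht).symm)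
      refine hx (mem_iUnion.2 ⟨g, ?_⟩)
      rw [mem_preimage, hg]
      exact mem_interior_iff_mem_nhds.2 hU
    have hγt := hγ.continuousAt (hJ.mem_nhds ht)
    filter_upwards [hJ.mem_nhds ht, hγt (hK.isClosed.isOpen_compl.mem_nhds hmem),
      hγt (Metric.closedBall_mem_nhds _ one_pos)] with s hs hs1 hs2
    have hsW : f s ∈ W := by
      by_contra hsW
      exact hs1 ⟨f s, ⟨hR _ (by rw [hf s hs]; exact hs2), hsW⟩, hf s hs⟩
    obtain ⟨g, hg⟩ := mem_iUnion.1 hsW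
    exact ⟨g, Subgroup.mem_top g, interior_subset hg⟩
  obtain ⟨h, -, hc⟩ := LiftsOn.of_orbitContinuousAt (⊤ : Subgroup G) f hJ hO
  exact ⟨_, hc, fun t ht => by rw [hinv, hf t ht]⟩

/-- The range of a proper map is closed. -/
lemma mem_range_of_tendsto {ι X Y : Type*} [MetricSpace X] [ProperSpace X] [MetricSpace Y]
    (x₀ : X) {π : X → Y} (hπ : Continuous π)
    (hprop : ∀ y : Y, ∀ r : ℝ, ∃ R, ∀ x, dist (π x) y ≤ r → dist x x₀ ≤ R)
    {l : Filter ι} [l.NeBot] {γ : ι → Y} {y : Y} (hγ : Tendsto γ l (𝓝 y))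
    (hγr : ∀ᶠ t in l, γ t ∈ range π) : y ∈ range π := by
  obtain ⟨R, hR⟩ := hprop y 1
  have hK : IsClosed (π '' Metric.closedBall x₀ R) :=
    ((isCompact_closedBall x₀ R).image hπ).isClosed
  refine image_subset_range _ _ (hK.mem_of_tendsto hγ ?_)
  filter_upwards [hγr, hγ (Metric.closedBall_mem_nhds _ one_pos)]
  rintro t ⟨x, hx⟩ ht
  exact ⟨x, hR x (by rw [hx]; exact ht), hx⟩

end Invariants

/-- Characterization of curves admitting a lift differentiable at `0` through `v = 0`:
a lift differentiable at `0` with `c̄(0) = 0` exists iff `cₖ(t) = t^{dₖ} γₖ(t)` near `0`. -/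
theorem stmt9
    {m n : ℕ} {G : Type} [Group G] [Fintype G]
    (ρ : G →* ((Fin m → ℂ) ≃ₗ[ℂ] (Fin m → ℂ)))
    (σ : Fin n → MvPolynomial (Fin m) ℂ) (deg : Fin n → ℕ)
    (hdeg : ∀ k, 1 ≤ deg k)
    (hhom : ∀ k, (σ k).IsHomogeneous (deg k))
    (hinv : ∀ k g x, MvPolynomial.eval (ρ g x) (σ k) = MvPolynomial.eval x (σ k))
    (hgen : ∀ f : MvPolynomial (Fin m) ℂ,
      (∀ g x, MvPolynomial.eval (ρ g x) f = MvPolynomial.eval x f) →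
      ∃ p : MvPolynomial (Fin n) ℂ, MvPolynomial.aeval σ p = f)
    (σm : (Fin m → ℂ) → (Fin n → ℂ))
    (hσm : ∀ x k, σm x k = MvPolynomial.eval x (σ k))
    (I : Set ℝ) (hIo : IsOpen I) (hIc : I.OrdConnected) (h0 : (0:ℝ) ∈ I)
    (c : ℝ → Fin n → ℂ) (hc : ContinuousOn c I)
    (hcσ : ∀ t ∈ I, ∃ x : Fin m → ℂ, σm x = c t) (hc0 : c 0 = 0) :
    ((∃ (ε : ℝ) (cb : ℝ → Fin m → ℂ), 0 < ε ∧ Set.Ioo (-ε) ε ⊆ I ∧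
        ContinuousOn cb (Set.Ioo (-ε) ε) ∧ (∀ t ∈ Set.Ioo (-ε) ε, σm (cb t) = c t) ∧
        cb 0 = 0 ∧ DifferentiableAt ℝ cb 0)
      ↔
      (∀ k : Fin n, ∃ (ε : ℝ) (γ : ℝ → ℂ), 0 < ε ∧ Set.Ioo (-ε) ε ⊆ I ∧
        ContinuousOn γ (Set.Ioo (-ε) ε) ∧
        ∀ t ∈ Set.Ioo (-ε) ε, c t k = (t:ℂ) ^ (deg k) * γ t)) := by
  classical
  have hpow : ∀ (t : ℝ) (x : Fin m → ℂ) k,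
      MvPolynomial.eval (t • x) (σ k) = (t : ℂ) ^ deg k * MvPolynomial.eval x (σ k) :=
    fun t x k => (hhom k).eval_smul_eq (t : ℂ) x
  have hσ0 : ∀ k, MvPolynomial.eval 0 (σ k) = 0 := fun k => by
    simpa [Nat.one_le_iff_ne_zero.1 (hdeg k)] using hpow 0 0 k
  have hσc : Continuous σm := by
    rw [funext fun x => funext (hσm x)]
    exact continuous_pi fun k => MvPolynomial.continuous_eval (σ k)
  constructor
  · rintro ⟨ε, cb, hε, hεI, hcb, hlift, hcb0, hd⟩ k
    have hnhds : Ioo (-ε) ε ∈ 𝓝 (0 : ℝ) := Ioo_mem_nhds (neg_neg_of_pos hε) hε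
    refine ⟨ε, fun t => MvPolynomial.eval (dslope cb 0 t) (σ k), hε, hεI,
      (MvPolynomial.continuous_eval (σ k)).comp_continuousOn
        ((continuousOn_dslope hnhds).2 ⟨hcb, hd⟩), fun t ht => ?_⟩
    have ht' : t • dslope cb 0 t = cb t := by
      simpa [hcb0] using sub_smul_dslope cb 0 t
    rw [← hpow, ht', ← hlift t ht, hσm]
  · intro h
    choose e γ he heI hγ hcγ using h
    obtain ⟨ε₀, hε₀, hε₀I⟩ := Metric.isOpen_iff.1 hIo 0 h0
    have hball : ∀ r : ℝ, Metric.ball (0 : ℝ) r = Ioo (-r) r := fun r => by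
      rw [Real.ball_eq_Ioo, zero_sub, zero_add]
    obtain ⟨ε, hε, hεε₀, hεe⟩ : ∃ ε > 0, ε ≤ ε₀ ∧ ∀ k, ε ≤ e k := by
      have hle : ∀ r : ℝ, 0 < r → ∀ᶠ ε in 𝓝[>] (0 : ℝ), ε ≤ r := fun r hr =>
        mem_nhdsWithin_of_mem_nhds (Iic_mem_nhds hr)
      have : ∀ᶠ ε in 𝓝[>] (0 : ℝ), 0 < ε ∧ ε ≤ ε₀ ∧ ∀ k, ε ≤ e k :=
        eventually_mem_nhdsWithin.and ((hle ε₀ hε₀).and (eventually_all.2 fun k => hle _ (he k)))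
      exact this.exists
    have hsub : ∀ k, Ioo (-ε) ε ⊆ Ioo (-e k) (e k) := fun k =>
      Ioo_subset_Ioo (neg_le_neg (hεe k)) (hεe k)
    have hεI : Ioo (-ε) ε ⊆ I := by
      rw [← hball]
      exact (Metric.ball_subset_ball hεε₀).trans hε₀I
    have hnhds : Ioo (-ε) ε ∈ 𝓝 (0 : ℝ) := Ioo_mem_nhds (neg_neg_of_pos hε) hε
    let Γ : ℝ → Fin n → ℂ := fun t k => γ k t
    have hΓ : ContinuousOn Γ (Ioo (-ε) ε) :=
      continuousOn_pi.2 fun k => (hγ k).mono (hsub k)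
    have hsep : ∀ x y, σm x = σm y → ∃ g, ρ g x = y := fun x y hxy =>
      exists_smul_eq_of_eval_eq ρ hgen fun k => by rw [← hσm, ← hσm, hxy]
    have hzero : ∀ x, (∀ k, MvPolynomial.eval x (σ k) = 0) → x = 0 := fun x hx => by
      obtain ⟨g, hg⟩ := hsep x 0 (funext fun k => by rw [hσm, hσm, hx, hσ0])
      simpa using hg
    have hprop : ∀ (y : Fin n → ℂ) (r : ℝ), ∃ R, ∀ x, dist (σm x) y ≤ r → dist x 0 ≤ R := by
      intro y r
      obtain ⟨R, hR⟩ := exists_norm_le_of_norm_eval_le hdeg hhom hzero (r + ‖y‖)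
      refine ⟨R, fun x hx => ?_⟩
      rw [dist_zero_right]
      refine hR x fun k => ?_
      rw [← hσm]
      have h1 := norm_le_pi_norm (σm x) k
      have h2 := norm_le_norm_add_norm_sub' (σm x) y
      rw [dist_eq_norm] at hx
      linarith
    have hΓne : ∀ t ∈ Ioo (-ε) ε, t ≠ 0 → Γ t ∈ range σm := by
      intro t ht ht0
      obtain ⟨x, hx⟩ := hcσ t (hεI ht)
      refine ⟨t⁻¹ • x, funext fun k => ?_⟩
      have ht0' : (t : ℂ) ≠ 0 := Complex.ofReal_ne_zero.2 ht0
      rw [hσm, hpow, ← hσm, hx, hcγ k t (hsub k ht), ← mul_assoc, ← mul_pow,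
        Complex.ofReal_inv, inv_mul_cancel₀ ht0', one_pow, one_mul]
    have hΓr : ∀ t ∈ Ioo (-ε) ε, Γ t ∈ range σm := by
      intro t ht
      by_cases ht0 : t = 0
      · subst ht0
        refine mem_range_of_tendsto (l := 𝓝[≠] (0 : ℝ)) 0 hσc hprop
          ((hΓ.continuousAt hnhds).tendsto.mono_left nhdsWithin_le_nhds) ?_
        filter_upwards [self_mem_nhdsWithin, mem_nhdsWithin_of_mem_nhds hnhds] with s hs hs'
        exact hΓne s hs' hs
      · exact hΓne t ht ht0
    let _ : MulAction G (Fin m → ℂ) := MulAction.compHom _ ρ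
    have hsmul : ∀ (g : G) (x : Fin m → ℂ), g • x = ρ g x := fun _ _ => rfl
    have : ContinuousConstSMul G (Fin m → ℂ) :=
      ⟨fun g => (ρ g).toLinearMap.continuous_of_finiteDimensional⟩
    obtain ⟨b, hb, hbΓ⟩ := exists_continuousOn_lift (G := G) 0 hσc
      (fun g x => funext fun k => by rw [hsmul, hσm, hσm, hinv]) hsep hprop isOpen_Ioo hΓ hΓr
    refine ⟨ε, fun t => t • b t, hε, hεI, continuousOn_id.smul hb, fun t ht => ?_, by simp, ?_⟩
    · ext k
      rw [hσm, hpow, ← hσm, hbΓ t ht, hcγ k t (hsub k ht)]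
    · refine HasDerivAt.differentiableAt (f' := b 0) (hasDerivAt_iff_tendsto_slope_zero.2 ?_)
      refine ((hb.continuousAt hnhds).tendsto.mono_left nhdsWithin_le_nhds).congr' ?_
      filter_upwards [self_mem_nhdsWithin] with t ht
      have ht0 : t ≠ 0 := ht
      simp [smul_smul, ht0]
end

section
/- Let I ⊆ ℝ be an open interval and let c : I → ℂ^n be a real-analytic curve with c(t) ∈ σ(ℂ^m) for all t ∈ I. If c̄ : I → ℂ^m is a C^∞ curve with σ ∘ c̄ = c, then c̄ is real-analytic on I. (This is the paper's theorem that smooth lifts of quasianalytic C^M curves are C^M, in the case M = (1)_{k∈ℕ}, i.e., C^M = C^ω.) -/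
open MeasureTheory Set Filter

open Asymptotics Topology Polynomial

/-- Functions `ℝ → ℂ` which are real-analytic at `t₀`, as a subring of all functions. -/
def analyticSubring (t₀ : ℝ) : Subring (ℝ → ℂ) where
  carrier := {f | AnalyticAt ℝ f t₀}
  mul_mem' ha hb := ha.mul hb
  one_mem' := analyticAt_const
  add_mem' ha hb := ha.add hb
  zero_mem' := analyticAt_const
  neg_mem' ha := ha.neg

/-- Evaluation at `t`, as a ring homomorphism. -/
def evalAt (t₀ t : ℝ) : analyticSubring t₀ →+* ℂ :=
  (Pi.evalRingHom (fun _ : ℝ => ℂ) t).comp (analyticSubring t₀).subtype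

@[simp]
lemma evalAt_apply {t₀ : ℝ} (t : ℝ) (a : analyticSubring t₀) : evalAt t₀ t a = a.1 t := rfl

lemma analyticAt_eval₂ {t₀ : ℝ} (p : (analyticSubring t₀)[X]) (z₀ : ℂ) :
    AnalyticAt ℝ (fun x : ℝ × ℂ => p.eval₂ (evalAt t₀ x.1) x.2) (t₀, z₀) := by
  induction p using Polynomial.induction_on' with
  | add p q hp hq => simpa only [eval₂_add] using hp.fun_add hq
  | monomial n a =>
    simp only [eval₂_monomial, evalAt_apply]
    have h1 : AnalyticAt ℝ (fun x : ℝ × ℂ => a.1 x.1) (t₀, z₀) :=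
      AnalyticAt.fun_comp (f := Prod.fst) a.2 analyticAt_fst
    exact h1.mul (analyticAt_snd.pow n)

lemma continuousAt_eval₂ {t₀ : ℝ} (p : (analyticSubring t₀)[X]) {u : ℝ → ℂ}
    (hu : ContinuousAt u t₀) : ContinuousAt (fun t => p.eval₂ (evalAt t₀ t) (u t)) t₀ :=
  ContinuousAt.comp' (f := fun t => (t, u t)) (analyticAt_eval₂ p (u t₀)).continuousAt
    (continuousAt_id.prodMk hu)

/-- Second order expansion along `T + s z`. -/
lemma exists_eval₂_add_mul {t₀ : ℝ} (p : (analyticSubring t₀)[X]) (T s : analyticSubring t₀) :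
    ∃ R : (analyticSubring t₀)[X], ∀ t z,
      p.eval₂ (evalAt t₀ t) (T.1 t + s.1 t * z) =
        p.eval₂ (evalAt t₀ t) (T.1 t) +
          p.derivative.eval₂ (evalAt t₀ t) (T.1 t) * (s.1 t * z) +
          R.eval₂ (evalAt t₀ t) z * (s.1 t * z) ^ 2 := by
  obtain ⟨R, hR⟩ := (p.map C).binomExpansion (C T) (C s * X)
  refine ⟨R, fun t z => ?_⟩
  have h := congrArg (fun q => q.eval₂ (evalAt t₀ t) z) hR
  have key : ∀ q y : (analyticSubring t₀)[X],
      ((q.map C).eval y).eval₂ (evalAt t₀ t) z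
        = q.eval₂ (evalAt t₀ t) (y.eval₂ (evalAt t₀ t) z) := by
    intro q y
    induction q using Polynomial.induction_on' with
    | add a b ha hb => simp [ha, hb]
    | monomial n a => simp [eval₂_mul, eval₂_pow]
  simp only [derivative_map, eval₂_add, eval₂_mul, eval₂_pow, key, eval₂_C, eval₂_X,
    evalAt_apply] at h
  exact h

/-- Second order expansion around `T`. -/
lemma exists_eval₂_eq {t₀ : ℝ} (p : (analyticSubring t₀)[X]) (T : analyticSubring t₀) :
    ∃ R : (analyticSubring t₀)[X], ∀ t z,
      p.eval₂ (evalAt t₀ t) z =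
        p.eval₂ (evalAt t₀ t) (T.1 t) +
          (z - T.1 t) * (p.derivative.eval₂ (evalAt t₀ t) (T.1 t) +
          R.eval₂ (evalAt t₀ t) (z - T.1 t) * (z - T.1 t)) := by
  obtain ⟨R, hR⟩ := exists_eval₂_add_mul p T 1
  refine ⟨R, fun t z => ?_⟩
  have := hR t (z - T.1 t)
  simp only [Subring.coe_one, Pi.one_apply, one_mul, add_sub_cancel] at this
  rw [this]; ring

lemma isBigO_eval₂_sub {t₀ : ℝ} (p : (analyticSubring t₀)[X]) {T u : ℝ → ℂ}
    (hT : AnalyticAt ℝ T t₀) (hu : ContinuousAt u t₀) :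
    (fun t => p.eval₂ (evalAt t₀ t) (u t) - p.eval₂ (evalAt t₀ t) (T t))
      =O[𝓝 t₀] fun t => u t - T t := by
  obtain ⟨R, hR⟩ := exists_eval₂_eq p ⟨T, hT⟩
  have hw : ContinuousAt (fun t => u t - T t) t₀ := hu.sub hT.continuousAt
  have hb := Tendsto.isBigO_one ℂ ((continuousAt_eval₂ p.derivative hT.continuousAt).fun_add
    ((continuousAt_eval₂ R hw).fun_mul hw))
  have := (isBigO_refl (fun t => u t - T t) (𝓝 t₀)).mul hb
  simp only [mul_one] at this
  refine this.congr_left fun t => ?_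
  rw [hR t (u t)]; ring

/-- `f` vanishes to infinite order at `t₀`. -/
def FlatAt (f : ℝ → ℂ) (t₀ : ℝ) : Prop := ∀ n : ℕ, f =o[𝓝 t₀] fun t => (t - t₀) ^ n

lemma isBigO_sub_pow {t₀ : ℝ} {m n : ℕ} (h : m ≤ n) :
    (fun t : ℝ => (t - t₀) ^ n) =O[𝓝 t₀] fun t => (t - t₀) ^ m := by
  have h1 : (fun t : ℝ => (t - t₀) ^ (n - m)) =O[𝓝 t₀] fun _ => (1 : ℝ) :=
    Tendsto.isBigO_one ℝ
      (show ContinuousAt (fun t : ℝ => (t - t₀) ^ (n - m)) t₀ by fun_prop)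
  simpa [← pow_add, Nat.add_sub_cancel' h] using (isBigO_refl (fun t => (t - t₀) ^ m) _).mul h1

lemma isLittleO_sub_pow {t₀ : ℝ} {m n : ℕ} (h : m < n) :
    (fun t : ℝ => (t - t₀) ^ n) =o[𝓝 t₀] fun t => (t - t₀) ^ m := by
  have h1 : (fun t : ℝ => (t - t₀) ^ (n - m)) =o[𝓝 t₀] fun _ => (1 : ℝ) := by
    rw [isLittleO_one_iff]
    have : ContinuousAt (fun t : ℝ => (t - t₀) ^ (n - m)) t₀ := by fun_prop
    simpa [ContinuousAt, Nat.sub_ne_zero_of_lt h] using this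
  simpa [← pow_add, Nat.add_sub_cancel' h.le] using
    (isBigO_refl (fun t => (t - t₀) ^ m) _).mul_isLittleO h1


lemma not_isLittleO_sub_pow_self (t₀ : ℝ) (n : ℕ) :
    ¬ (fun t : ℝ => (t - t₀) ^ n) =o[𝓝 t₀] fun t => (t - t₀) ^ n := by
  refine isLittleO_irrefl' (Frequently.filter_mono (f := 𝓝[≠] t₀) ?_ nhdsWithin_le_nhds)
  refine Eventually.frequently (eventually_nhdsWithin_of_forall fun t ht => ?_)
  simpa using fun h => absurd (sub_eq_zero.1 h) ht

/-- A function of exact order `k` at `t₀` dominates `(t - t₀) ^ k`. -/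
lemma isBigO_pow_of_eventually_eq {t₀ : ℝ} {f g : ℝ → ℂ} {k : ℕ} (hg : ContinuousAt g t₀)
    (hg0 : g t₀ ≠ 0) (h : ∀ᶠ t in 𝓝 t₀, f t = (t - t₀) ^ k • g t) :
    (fun t : ℝ => (t - t₀) ^ k) =O[𝓝 t₀] f := by
  have h1 : (fun t => f t * (g t)⁻¹) =O[𝓝 t₀] f := by
    simpa using (isBigO_refl f (𝓝 t₀)).mul (Tendsto.isBigO_one ℂ (hg.inv₀ hg0))
  refine (IsBigO.of_bound 1 ?_).trans h1
  filter_upwards [h, hg.eventually_ne hg0] with t ht hgt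
  rw [ht, smul_mul_assoc, mul_inv_cancel₀ hgt]
  simp [-Complex.ofReal_sub]

lemma exists_order_of_not_eventually_eq_zero {t₀ : ℝ} {f : ℝ → ℂ} (hf : AnalyticAt ℝ f t₀)
    (h : ¬ ∀ᶠ t in 𝓝 t₀, f t = 0) : ∃ (k : ℕ) (g : ℝ → ℂ), AnalyticAt ℝ g t₀ ∧ g t₀ ≠ 0 ∧
      ∀ᶠ t in 𝓝 t₀, f t = (t - t₀) ^ k • g t := by
  rw [← analyticOrderAt_eq_top] at h
  obtain ⟨k, hk⟩ := ENat.ne_top_iff_exists.1 h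
  exact ⟨k, hf.analyticOrderAt_eq_natCast.1 hk.symm⟩

lemma isLittleO_smul_of_eventually_eq {t₀ : ℝ} {f g : ℝ → ℂ} {k n : ℕ} (hg : ContinuousAt g t₀)
    (hn : n < k) (h : ∀ᶠ t in 𝓝 t₀, f t = (t - t₀) ^ k • g t) :
    f =o[𝓝 t₀] fun t : ℝ => (t - t₀) ^ n := by
  have h1 : (fun t => (t - t₀) ^ k • g t) =O[𝓝 t₀] fun t => (t - t₀) ^ k • (1 : ℝ) :=
    (isBigO_refl _ _).smul (Tendsto.isBigO_one ℝ hg)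
  simp only [smul_eq_mul, mul_one] at h1
  exact (h1.trans_isLittleO (isLittleO_sub_pow hn)).congr' (h.mono fun _ h => h.symm) .rfl

lemma exists_order_of_not_isLittleO {t₀ : ℝ} {f : ℝ → ℂ} (hf : AnalyticAt ℝ f t₀) {n : ℕ}
    (h : ¬ f =o[𝓝 t₀] fun t : ℝ => (t - t₀) ^ n) :
    ∃ k ≤ n, ∃ g : ℝ → ℂ, AnalyticAt ℝ g t₀ ∧ g t₀ ≠ 0 ∧
      ∀ᶠ t in 𝓝 t₀, f t = (t - t₀) ^ k • g t := by
  obtain ⟨k, g, hg, hg0, hk⟩ := exists_order_of_not_eventually_eq_zero hf fun h0 =>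
    h ((isLittleO_zero _ _).congr' (h0.mono fun _ h => h.symm) .rfl)
  refine ⟨k, ?_, g, hg, hg0, hk⟩
  by_contra! hn
  exact h (isLittleO_smul_of_eventually_eq hg.continuousAt hn hk)

lemma exists_eq_pow_smul_of_isLittleO {t₀ : ℝ} {f : ℝ → ℂ} (hf : AnalyticAt ℝ f t₀) {n m : ℕ}
    (hm : m ≤ n + 1) (h : f =o[𝓝 t₀] fun t : ℝ => (t - t₀) ^ n) :
    ∃ g : ℝ → ℂ, AnalyticAt ℝ g t₀ ∧ ∀ᶠ t in 𝓝 t₀, f t = (t - t₀) ^ m • g t := by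
  rw [← natCast_le_analyticOrderAt hf]
  by_contra! hlt
  obtain ⟨k, hk⟩ := ENat.ne_top_iff_exists.1 hlt.ne_top
  obtain ⟨g, hg, hg0, hfg⟩ := hf.analyticOrderAt_eq_natCast.1 hk.symm
  rw [← hk, Nat.cast_lt] at hlt
  have h1 := (isBigO_pow_of_eventually_eq hg.continuousAt hg0 hfg).trans_isLittleO h
  exact not_isLittleO_sub_pow_self t₀ k (h1.trans_isBigO (isBigO_sub_pow (by omega)))

lemma FlatAt.eventually_eq_zero {t₀ : ℝ} {f : ℝ → ℂ} (hfl : FlatAt f t₀)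
    (hf : AnalyticAt ℝ f t₀) : ∀ᶠ t in 𝓝 t₀, f t = 0 := by
  by_contra h
  obtain ⟨k, g, hg, hg0, hk⟩ := exists_order_of_not_eventually_eq_zero hf h
  exact not_isLittleO_sub_pow_self t₀ k
    ((isBigO_pow_of_eventually_eq hg.continuousAt hg0 hk).trans_isLittleO (hfl k))

/-- Implicit function theorem for the equation
`(t - t₀) a(t) + b(t) y + (t - t₀) y² S(t, y) = 0` with `b(t₀) ≠ 0`. -/
lemma exists_analyticAt_solution {t₀ : ℝ} {a b : ℝ → ℂ} {S : ℝ × ℂ → ℂ}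
    (ha : AnalyticAt ℝ a t₀) (hb : AnalyticAt ℝ b t₀) (hb0 : b t₀ ≠ 0)
    (hS : AnalyticAt ℝ S (t₀, 0)) :
    ∃ y : ℝ → ℂ, AnalyticAt ℝ y t₀ ∧ ∀ᶠ t in 𝓝 t₀,
      ((t - t₀ : ℝ) : ℂ) * a t + b t * y t + ((t - t₀ : ℝ) : ℂ) * y t ^ 2 * S (t, y t) = 0 := by
  let F : ℝ × ℂ → ℂ := fun x =>
    ((x.1 - t₀ : ℝ) : ℂ) * a x.1 + b x.1 * x.2 + ((x.1 - t₀ : ℝ) : ℂ) * x.2 ^ 2 * S x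
  have hs : AnalyticAt ℝ (fun x : ℝ × ℂ => ((x.1 - t₀ : ℝ) : ℂ)) (t₀, 0) :=
    AnalyticAt.fun_comp (g := Complex.ofRealCLM) (Complex.ofRealCLM.analyticAt _)
      (analyticAt_fst.sub analyticAt_const)
  have ha' : AnalyticAt ℝ (fun x : ℝ × ℂ => a x.1) (t₀, 0) :=
    AnalyticAt.fun_comp (f := Prod.fst) ha analyticAt_fst
  have hb' : AnalyticAt ℝ (fun x : ℝ × ℂ => b x.1) (t₀, 0) :=
    AnalyticAt.fun_comp (f := Prod.fst) hb analyticAt_fst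
  have hF : AnalyticAt ℝ F (t₀, 0) :=
    ((hs.mul ha').add (hb'.mul analyticAt_snd)).add ((hs.mul (analyticAt_snd.pow 2)).mul hS)
  have hFc : ContDiffAt ℝ (⊤ : WithTop ℕ∞) F (t₀, 0) := hF.contDiffAt
  have hd : fderiv ℝ F (t₀, 0) ∘L .inr ℝ ℝ ℂ =
      (ContinuousLinearEquiv.smulLeft (R₁ := ℝ) (Units.mk0 (b t₀) hb0) : ℂ ≃L[ℝ] ℂ) := by
    have h1 : HasFDerivAt (fun z : ℂ => F (t₀, z)) (fderiv ℝ F (t₀, 0) ∘L .inr ℝ ℝ ℂ) 0 :=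
      hF.differentiableAt.hasFDerivAt.comp (0 : ℂ) (hasFDerivAt_prodMk_right t₀ (0 : ℂ))
    have h2 : HasFDerivAt (fun z : ℂ => F (t₀, z)) ((b t₀) • ContinuousLinearMap.id ℝ ℂ) 0 := by
      have : (fun z : ℂ => F (t₀, z)) = fun z => b t₀ * z := by
        funext z; simp [F]
      rw [this]
      exact (hasFDerivAt_id (𝕜 := ℝ) (0 : ℂ)).const_mul (b t₀)
    rw [h1.unique h2]
    ext
    simp
  have hi : (fderiv ℝ F (t₀, 0) ∘L .inr ℝ ℝ ℂ).IsInvertible := by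
    rw [hd]; exact ContinuousLinearMap.isInvertible_equiv
  refine ⟨hFc.implicitFunction (by simp) hi,
    (hFc.contDiffAt_implicitFunction (by simp) hi).analyticAt, ?_⟩
  filter_upwards [hFc.eventually_apply_implicitFunction (by simp) hi] with t ht
  have h0 : F (t₀, 0) = 0 := by simp [F]
  rw [h0] at ht
  exact ht

/-- Cancellation of a power of `t - t₀` in an estimate. -/
lemma isLittleO_of_mul_pow {t₀ : ℝ} {w : ℝ → ℂ} {n k : ℕ} (hw : w t₀ = 0)
    (h : (fun t => w t * (((t - t₀) ^ k : ℝ) : ℂ)) =o[𝓝 t₀] fun t : ℝ => (t - t₀) ^ (n + k)) :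
    w =o[𝓝 t₀] fun t : ℝ => (t - t₀) ^ n := by
  rw [isLittleO_iff] at h ⊢
  intro c hc
  filter_upwards [h hc] with t ht
  rcases eq_or_ne t t₀ with rfl | hne
  · rw [hw, norm_zero]; positivity
  · have hpos : 0 < ‖(t - t₀) ^ k‖ := norm_pos_iff.2 (pow_ne_zero _ (sub_ne_zero.2 hne))
    rw [norm_mul, Complex.norm_real, pow_add, norm_mul, ← mul_assoc] at ht
    exact le_of_mul_le_mul_right ht hpos

/-- Newton step: if `p(u)` is flat and `p'(u)` is not, then `u` is analytic up to a flat error. -/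
lemma exists_analyticAt_flatAt_sub_of_derivative {t₀ : ℝ} {u : ℝ → ℂ} (huc : ContinuousAt u t₀)
    (hu : ∀ n : ℕ, ∃ T : ℝ → ℂ, AnalyticAt ℝ T t₀ ∧
      (fun t => u t - T t) =o[𝓝 t₀] fun t : ℝ => (t - t₀) ^ n)
    (p : (analyticSubring t₀)[X]) (hp : FlatAt (fun t => p.eval₂ (evalAt t₀ t) (u t)) t₀)
    (hp' : ¬ FlatAt (fun t => p.derivative.eval₂ (evalAt t₀ t) (u t)) t₀) :
    ∃ v : ℝ → ℂ, AnalyticAt ℝ v t₀ ∧ FlatAt (fun t => u t - v t) t₀ := by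
  have hev : ∀ (q : (analyticSubring t₀)[X]) {T : ℝ → ℂ}, AnalyticAt ℝ T t₀ →
      AnalyticAt ℝ (fun t => q.eval₂ (evalAt t₀ t) (T t)) t₀ := fun q T hT =>
    AnalyticAt.fun_comp (f := fun t => (t, T t)) (analyticAt_eval₂ q (T t₀))
      (analyticAt_id.prod hT)
  unfold FlatAt at hp'
  push Not at hp'
  obtain ⟨M, hM⟩ := hp'
  obtain ⟨T, hT, huT⟩ := hu (2 * M + 2)
  have hM' : ¬ (fun t => p.derivative.eval₂ (evalAt t₀ t) (T t)) =o[𝓝 t₀]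
      fun t : ℝ => (t - t₀) ^ M := by
    intro h
    refine hM (((((isBigO_eval₂_sub p.derivative hT huc).trans_isLittleO huT).trans_isBigO
      (isBigO_sub_pow (by omega))).add h).congr_left fun t => ?_)
    ring
  obtain ⟨k, hkM, b, hb, hb0, hpb⟩ := exists_order_of_not_isLittleO (hev _ hT) hM'
  have hpT : (fun t => p.eval₂ (evalAt t₀ t) (T t)) =o[𝓝 t₀]
      fun t : ℝ => (t - t₀) ^ (2 * M + 2) := by
    refine ((hp _).sub ((isBigO_eval₂_sub p hT huc).trans_isLittleO huT)).congr_left fun t => ?_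
    ring
  obtain ⟨a, ha, hpa⟩ := exists_eq_pow_smul_of_isLittleO (m := 2 * k + 2) (hev p hT)
    (by omega) hpT
  let s : ℝ → ℂ := fun t => (((t - t₀) ^ (k + 1) : ℝ) : ℂ)
  have hs : AnalyticAt ℝ s t₀ :=
    AnalyticAt.fun_comp (g := Complex.ofRealCLM) (Complex.ofRealCLM.analyticAt _)
      ((analyticAt_id.sub analyticAt_const).pow (k + 1))
  obtain ⟨R, hR⟩ := exists_eval₂_add_mul p ⟨T, hT⟩ ⟨s, hs⟩
  obtain ⟨y, hy, hyF⟩ := exists_analyticAt_solution ha hb hb0 (analyticAt_eval₂ R 0)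
  let v : ℝ → ℂ := fun t => T t + s t * y t
  have hv : AnalyticAt ℝ v t₀ := hT.add (hs.mul hy)
  have hpv : ∀ᶠ t in 𝓝 t₀, p.eval₂ (evalAt t₀ t) (v t) = 0 := by
    filter_upwards [hpa, hpb, hyF] with t h1 h2 h3
    have h4 := hR t (y t)
    simp only [h1, h2, Complex.real_smul] at h4
    rw [h4]
    simp only [s]
    push_cast at h3 ⊢
    linear_combination ((t : ℂ) - t₀) ^ (2 * k + 1) * h3
  refine ⟨v, hv, fun n => ?_⟩
  have hvT : (fun t => v t - T t) =O[𝓝 t₀] fun t : ℝ => (t - t₀) ^ (k + 1) := by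
    have h1 : s =O[𝓝 t₀] fun t : ℝ => (t - t₀) ^ (k + 1) :=
      Complex.isBigO_ofReal_left.2 (isBigO_refl _ _)
    simpa [v] using h1.mul (Tendsto.isBigO_one ℝ hy.continuousAt)
  have hw : (fun t => u t - v t) =O[𝓝 t₀] fun t : ℝ => (t - t₀) ^ (k + 1) := by
    refine ((huT.isBigO.trans (isBigO_sub_pow (by omega))).sub hvT).congr_left fun t => ?_
    ring
  have hwc : ContinuousAt (fun t => u t - v t) t₀ := huc.sub hv.continuousAt
  have hw0 : u t₀ - v t₀ = 0 := by
    have := hw.eq_zero_imp.self_of_nhds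
    exact this (by simp)
  obtain ⟨Q, hQ⟩ := exists_eval₂_eq p ⟨v, hv⟩
  let h : ℝ → ℂ := fun t => p.derivative.eval₂ (evalAt t₀ t) (v t) +
    Q.eval₂ (evalAt t₀ t) (u t - v t) * (u t - v t)
  have hh : (fun t : ℝ => (t - t₀) ^ k) =O[𝓝 t₀] h := by
    have h1 := isBigO_pow_of_eventually_eq hb.continuousAt hb0 hpb
    have h2 : (fun t => h t - p.derivative.eval₂ (evalAt t₀ t) (T t)) =O[𝓝 t₀]
        fun t : ℝ => (t - t₀) ^ (k + 1) := by
      have h3 := (isBigO_eval₂_sub p.derivative hT hv.continuousAt).trans hvT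
      have h4 := (Tendsto.isBigO_one ℝ (continuousAt_eval₂ Q hwc)).mul hw
      simp only [one_mul] at h4
      refine (h3.add h4).congr_left fun t => ?_
      simp only [h]
      ring
    have h5 := ((h2.trans_isLittleO (isLittleO_sub_pow k.lt_succ_self)).trans_isBigO
      h1).right_isBigO_add
    simp only [sub_add_cancel] at h5
    exact h1.trans h5
  refine isLittleO_of_mul_pow hw0 (k := k) (IsBigO.trans_isLittleO ?_ (hp (n + k)))
  have h6 : (fun t => (((t - t₀) ^ k : ℝ) : ℂ)) =O[𝓝 t₀] h :=
    (Complex.isBigO_ofReal_left).2 hh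
  refine ((isBigO_refl (fun t => u t - v t) _).mul h6).congr' .rfl ?_
  filter_upwards [hpv] with t ht
  have := hQ t (u t)
  simp only [ht, zero_add] at this
  exact this.symm

/-- If `p(u)` is flat for a nonzero `p`, then `u` is analytic up to a flat error. -/
lemma exists_analyticAt_flatAt_sub {t₀ : ℝ} {u : ℝ → ℂ} (huc : ContinuousAt u t₀)
    (hu : ∀ n : ℕ, ∃ T : ℝ → ℂ, AnalyticAt ℝ T t₀ ∧
      (fun t => u t - T t) =o[𝓝 t₀] fun t : ℝ => (t - t₀) ^ n)
    (p : (analyticSubring t₀)[X]) (hp0 : ∃ i, ¬ ∀ᶠ t in 𝓝 t₀, (p.coeff i).1 t = 0)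
    (hp : FlatAt (fun t => p.eval₂ (evalAt t₀ t) (u t)) t₀) :
    ∃ v : ℝ → ℂ, AnalyticAt ℝ v t₀ ∧ FlatAt (fun t => u t - v t) t₀ := by
  induction hd : p.natDegree using Nat.strong_induction_on generalizing p with
  | _ d ih =>
  by_cases hp' : FlatAt (fun t => p.derivative.eval₂ (evalAt t₀ t) (u t)) t₀
  swap
  · exact exists_analyticAt_flatAt_sub_of_derivative huc hu p hp hp'
  by_cases h0 : ∃ i, ¬ ∀ᶠ t in 𝓝 t₀, (p.derivative.coeff i).1 t = 0
  · rcases Nat.eq_zero_or_pos p.natDegree with h | h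
    · rw [natDegree_eq_zero.1 h |>.choose_spec.symm] at h0
      simp at h0
    · exact ih _ (hd ▸ natDegree_derivative_lt h.ne') p.derivative h0 hp' rfl
  · push Not at h0
    have hs : ∀ i, ∀ᶠ t in 𝓝 t₀, (p.coeff (i + 1)).1 t = 0 := by
      intro i
      filter_upwards [h0 i] with t ht
      rw [coeff_derivative] at ht
      have h1 : ((i : ℂ) + 1) ≠ 0 := Nat.cast_add_one_ne_zero i
      have h2 : (p.coeff (i + 1)).1 t * ((i : ℂ) + 1) = 0 := by simpa using ht
      exact (mul_eq_zero.1 h2).resolve_right h1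
    have he : ∀ᶠ t in 𝓝 t₀, p.eval₂ (evalAt t₀ t) (u t) = (p.coeff 0).1 t := by
      have : ∀ᶠ t in 𝓝 t₀, ∀ i ∈ Finset.range p.natDegree, (p.coeff (i + 1)).1 t = 0 :=
        (Filter.eventually_all_finset _).2 fun i _ => hs i
      filter_upwards [this] with t ht
      rw [eval₂_eq_sum_range, Finset.sum_range_succ', Finset.sum_eq_zero]
      · simp
      · intro i hi
        simp [ht i hi]
    have hflat : FlatAt (p.coeff 0).1 t₀ := fun n => (hp n).congr' he .rfl
    have hz := hflat.eventually_eq_zero (p.coeff 0).2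
    obtain ⟨i, hi⟩ := hp0
    cases i with
    | zero => exact absurd hz hi
    | succ i => exact absurd (hs i) hi

/-- A flat root of a polynomial with nonzero analytic coefficients vanishes. -/
lemma FlatAt.eventually_eq_zero_of_root {t₀ : ℝ} {w : ℝ → ℂ} (hwc : ContinuousAt w t₀)
    (hw : FlatAt w t₀) (p : (analyticSubring t₀)[X])
    (hp0 : ∃ i, ¬ ∀ᶠ t in 𝓝 t₀, (p.coeff i).1 t = 0)
    (hp : ∀ᶠ t in 𝓝 t₀, w t = 0 ∨ p.eval₂ (evalAt t₀ t) (w t) = 0) :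
    ∀ᶠ t in 𝓝 t₀, w t = 0 := by
  have key : ∀ q : (analyticSubring t₀)[X], (¬ ∀ᶠ t in 𝓝 t₀, (q.coeff 0).1 t = 0) →
      (∀ᶠ t in 𝓝 t₀, w t = 0 ∨ q.eval₂ (evalAt t₀ t) (w t) = 0) → ∀ᶠ t in 𝓝 t₀, w t = 0 := by
    intro q hq0 hq
    obtain ⟨k, g, hg, hg0, hk⟩ := exists_order_of_not_eventually_eq_zero (q.coeff 0).2 hq0
    have h1 := isBigO_pow_of_eventually_eq hg.continuousAt hg0 hk
    have h2 : (fun t => q.divX.eval₂ (evalAt t₀ t) (w t) * w t) =o[𝓝 t₀] (q.coeff 0).1 := by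
      have := (Tendsto.isBigO_one ℝ (continuousAt_eval₂ q.divX hwc)).mul_isLittleO (hw k)
      simp only [one_mul] at this
      exact this.trans_isBigO h1
    filter_upwards [hq, h2.right_isBigO_add.eq_zero_imp, (hw k).isBigO.eq_zero_imp, h1.eq_zero_imp]
      with t h4 h5 h6 h7
    rcases h4 with h4 | h4
    · exact h4
    · refine h6 (h7 (h5 ?_))
      rw [← divX_mul_X_add q] at h4
      simpa using h4
  obtain ⟨i, hi⟩ := hp0
  induction i generalizing p with
  | zero => exact key p hi hp
  | succ i ih =>
    by_cases h0 : ∀ᶠ t in 𝓝 t₀, (p.coeff 0).1 t = 0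
    · refine ih p.divX ?_ (by simpa [coeff_divX] using hi)
      filter_upwards [hp, h0] with t h1 h2
      refine h1.elim Or.inl fun h1 => ?_
      rw [← divX_mul_X_add p] at h1
      simp only [eval₂_add, eval₂_mul, eval₂_X, eval₂_C, evalAt_apply, h2, add_zero] at h1
      exact (mul_eq_zero.1 h1).symm
    · exact key p h0 hp

lemma exists_analyticAt_isLittleO_sub {t₀ : ℝ} {I : Set ℝ} (hIo : IsOpen I)
    (hIc : I.OrdConnected) (ht₀ : t₀ ∈ I) {u : ℝ → ℂ} (hu : ContDiffOn ℝ (⊤ : ℕ∞) u I) (n : ℕ) :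
    ∃ T : ℝ → ℂ, AnalyticAt ℝ T t₀ ∧
      (fun t => u t - T t) =o[𝓝 t₀] fun t : ℝ => (t - t₀) ^ n := by
  refine ⟨taylorWithinEval u n I t₀, ?_, ?_⟩
  · rw [show taylorWithinEval u n I t₀ = _ from funext fun x => taylor_within_apply u n I t₀ x]
    fun_prop
  · have := taylor_isLittleO hIc.convex ht₀ (hu.of_le (mod_cast le_top) : ContDiffOn ℝ n u I)
    rwa [hIo.nhdsWithin_eq ht₀] at this

/-- A smooth root of a monic polynomial with real-analytic coefficients is real-analytic. -/
lemma analyticAt_of_monic_root {t₀ : ℝ} {I : Set ℝ} (hIo : IsOpen I)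
    (hIc : I.OrdConnected) (ht₀ : t₀ ∈ I) {u : ℝ → ℂ} (hu : ContDiffOn ℝ (⊤ : ℕ∞) u I)
    (p : (analyticSubring t₀)[X]) (hpm : p.Monic)
    (hp : ∀ᶠ t in 𝓝 t₀, p.eval₂ (evalAt t₀ t) (u t) = 0) : AnalyticAt ℝ u t₀ := by
  have huc : ContinuousAt u t₀ := hu.continuousOn.continuousAt (hIo.mem_nhds ht₀)
  have hmon : ∀ q : (analyticSubring t₀)[X], q.Monic →
      ∃ i, ¬ ∀ᶠ t in 𝓝 t₀, (q.coeff i).1 t = 0 := by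
    intro q hq
    refine ⟨q.natDegree, fun h => ?_⟩
    have := h.self_of_nhds
    rw [hq.coeff_natDegree] at this
    simp at this
  obtain ⟨v, hv, hfl⟩ := exists_analyticAt_flatAt_sub huc
    (exists_analyticAt_isLittleO_sub hIo hIc ht₀ hu) p (hmon p hpm)
    (fun n => (isLittleO_zero _ _).congr' (hp.mono fun _ h => h.symm) .rfl)
  have hz := hfl.eventually_eq_zero_of_root (huc.sub hv.continuousAt)
    (p.comp (X + C ⟨v, hv⟩)) (hmon _ (hpm.comp_X_add_C _)) (hp.mono fun t ht => Or.inr <| by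
      rw [eval₂_comp]; simpa using ht)
  exact hv.congr (hz.mono fun t ht => (sub_eq_zero.1 ht).symm)

/-- Each coordinate is, over the invariants, a root of a monic polynomial. -/
lemma exists_monic_root_of_invariants {m n : ℕ} {G : Type} [Group G] [Fintype G]
    (ρ : G →* ((Fin m → ℂ) ≃ₗ[ℂ] (Fin m → ℂ)))
    (σ : Fin n → MvPolynomial (Fin m) ℂ)
    (hgen : ∀ f : MvPolynomial (Fin m) ℂ,
      (∀ g x, MvPolynomial.eval (ρ g x) f = MvPolynomial.eval x f) →
      ∃ p : MvPolynomial (Fin n) ℂ, MvPolynomial.aeval σ p = f) (j : Fin m) :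
    ∃ (N : ℕ) (P : ℕ → MvPolynomial (Fin n) ℂ), ∀ x : Fin m → ℂ,
      ∑ i ∈ Finset.range N, MvPolynomial.eval (fun k => MvPolynomial.eval x (σ k)) (P i) * x j ^ i
        + x j ^ N = 0 := by
  let L : G → MvPolynomial (Fin m) ℂ := fun g =>
    ∑ i, MvPolynomial.C (ρ g (Pi.single i 1) j) * MvPolynomial.X i
  have hL : ∀ g x, MvPolynomial.eval x (L g) = ρ g x j := by
    intro g x
    have h := congrFun ((ρ g).toLinearMap.pi_apply_eq_sum_univ x) j
    simp only [LinearEquiv.coe_coe, Finset.sum_apply, Pi.smul_apply, smul_eq_mul] at h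
    rw [h]
    simp only [L, map_sum, map_mul, MvPolynomial.eval_C, MvPolynomial.eval_X]
    refine Finset.sum_congr rfl fun i _ => ?_
    rw [mul_comm]
    have hs : (fun l => if i = l then (1 : ℂ) else 0) = Pi.single i 1 := by
      funext l
      simp [Pi.single_apply, eq_comm]
    rw [hs]
  let Q : (MvPolynomial (Fin m) ℂ)[X] := ∏ g, (X - C (L g))
  have hQm : Q.Monic := monic_prod_of_monic _ _ fun g _ => monic_X_sub_C _
  have hQ : ∀ x, Q.map (MvPolynomial.eval x) = ∏ g, (X - C (ρ g x j)) := by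
    intro x
    simp [Q, Polynomial.map_prod, hL]
  have hinvQ : ∀ i h x, MvPolynomial.eval (ρ h x) (Q.coeff i) = MvPolynomial.eval x (Q.coeff i) := by
    intro i h x
    rw [← coeff_map, ← coeff_map, hQ, hQ]
    congr 1
    refine Fintype.prod_equiv (Equiv.mulRight h) _ _ fun g => ?_
    simp
  choose P hP using fun i => hgen (Q.coeff i) (hinvQ i)
  refine ⟨Q.natDegree, P, fun x => ?_⟩
  have h1 : ∀ i, MvPolynomial.eval (fun k => MvPolynomial.eval x (σ k)) (P i)
      = MvPolynomial.eval x (Q.coeff i) := by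
    intro i
    rw [← hP i]
    induction P i using MvPolynomial.induction_on with
    | C a => simp
    | add p q hp hq => simp [hp, hq]
    | mul_X p k hp => simp [hp]
  have h2 : Q.eval₂ (MvPolynomial.eval x) (x j) = 0 := by
    rw [← eval_map, hQ, eval_prod]
    exact Finset.prod_eq_zero (Finset.mem_univ 1) (by simp)
  rw [eval₂_eq_sum_range, Finset.sum_range_succ, hQm.coeff_natDegree, map_one, one_mul] at h2
  simpa only [h1] using h2

/-- Smooth lifts of real-analytic curves in `σ(ℂ^m)` (finite group) are real-analytic. -/
theorem stmt10
    {m n : ℕ} {G : Type} [Group G] [Fintype G]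
    (ρ : G →* ((Fin m → ℂ) ≃ₗ[ℂ] (Fin m → ℂ)))
    (σ : Fin n → MvPolynomial (Fin m) ℂ) (deg : Fin n → ℕ)
    (hdeg : ∀ k, 1 ≤ deg k)
    (hhom : ∀ k, (σ k).IsHomogeneous (deg k))
    (hinv : ∀ k g x, MvPolynomial.eval (ρ g x) (σ k) = MvPolynomial.eval x (σ k))
    (hgen : ∀ f : MvPolynomial (Fin m) ℂ,
      (∀ g x, MvPolynomial.eval (ρ g x) f = MvPolynomial.eval x f) →
      ∃ p : MvPolynomial (Fin n) ℂ, MvPolynomial.aeval σ p = f)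
    (σm : (Fin m → ℂ) → (Fin n → ℂ))
    (hσm : ∀ x k, σm x k = MvPolynomial.eval x (σ k))
    (I : Set ℝ) (hIo : IsOpen I) (hIc : I.OrdConnected)
    (c : ℝ → Fin n → ℂ) (hc : AnalyticOnNhd ℝ c I)
    (cb : ℝ → Fin m → ℂ) (hcb : ContDiffOn ℝ (⊤:ℕ∞) cb I)
    (hl : ∀ t ∈ I, σm (cb t) = c t) :
    AnalyticOnNhd ℝ cb I := by
  intro t₀ ht₀
  rw [analyticAt_pi_iff]
  intro j
  obtain ⟨N, P, hP⟩ := exists_monic_root_of_invariants ρ σ hgen j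
  have ha : ∀ i, AnalyticAt ℝ (fun t => MvPolynomial.eval (c t) (P i)) t₀ := fun i =>
    AnalyticAt.aeval_mvPolynomial (fun k => analyticAt_pi_iff.1 (hc t₀ ht₀) k) (P i)
  refine analyticAt_of_monic_root hIo hIc ht₀ (contDiffOn_pi.1 hcb j)
    (X ^ N + ∑ i ∈ Finset.range N, C ⟨_, ha i⟩ * X ^ i) (monic_X_pow_add ?_) ?_
  · rw [Finset.sum_range]
    exact degree_sum_fin_lt _
  · filter_upwards [hIo.mem_nhds ht₀] with t ht
    have h := hP (cb t)
    rw [show (fun k => MvPolynomial.eval (cb t) (σ k)) = c t from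
      (funext fun k => (hσm _ k).symm).trans (hl t ht)] at h
    rw [add_comm] at h
    simpa [eval₂_finsetSum] using h
end

section
/- Let U ⊆ ℝ^q be open and let f : U → ℂ^n be a real-analytic map with f(x) ∈ σ(ℂ^m) for all x ∈ U. If f̄ : U → ℂ^m is a C^∞ map with σ ∘ f̄ = f, then f̄ is real-analytic on U. -/
open MeasureTheory Set Filter

open Finset in
theorem sum_finset_sign_mul_prod {k : ℕ} (φ : Fin k → Option (Fin k)) :
    ∑ S : Finset (Fin k), (-1 : ℝ) ^ (#Sᶜ) * ∏ j, (φ j).elim 1 (fun i => if i ∈ S then 1 else 0) =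
      if (∀ i, ∃ j, φ j = some i) then 1 else 0 := by
  split_ifs with h
  · rw [Finset.sum_eq_single Finset.univ]
    · simp only [Finset.compl_univ, Finset.card_empty, pow_zero, one_mul]
      refine Finset.prod_eq_one fun j _ => ?_
      cases φ j <;> simp
    · intro S _ hS
      obtain ⟨i, hi⟩ : ∃ i, i ∉ S := by
        by_contra! hc
        exact hS (Finset.eq_univ_iff_forall.2 hc)
      obtain ⟨j, hj⟩ := h i
      rw [Finset.prod_eq_zero (Finset.mem_univ j), mul_zero]
      simp [hj, hi]
    · simp
  · push Not at h
    obtain ⟨i, hi⟩ := h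
    refine Finset.sum_involution (fun S _ => symmDiff S {i}) ?_ ?_ (by simp) (by simp)
    · intro S _
      have h1 : ∀ j, (φ j).elim (1 : ℝ) (fun l => if l ∈ symmDiff S {i} then 1 else 0) =
          (φ j).elim 1 (fun l => if l ∈ S then 1 else 0) := by
        intro j
        cases hφ : φ j with
        | none => rfl
        | some l =>
          have : l ≠ i := fun h => hi j (by rw [hφ, h])
          simp [Finset.mem_symmDiff, this]
      simp only [h1]
      rw [← add_mul]
      convert zero_mul _
      by_cases hS : i ∈ S
      · have : (symmDiff S {i})ᶜ = insert i Sᶜ := by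
          ext l; by_cases hl : l = i <;> simp [hl, hS]
        rw [this, Finset.card_insert_of_notMem (by simpa using hS), pow_succ]; ring
      · have : Sᶜ = insert i (symmDiff S {i})ᶜ := by
          ext l; by_cases hl : l = i <;> simp [hl, hS]
        rw [this, Finset.card_insert_of_notMem (by simp [hS]), pow_succ]; ring
    · intro S _ _ hS
      have := congrArg (i ∈ ·) hS
      by_cases hm : i ∈ S <;> simp [Finset.mem_symmDiff, hm] at this

open Finset in
/-- The polarization identity for symmetric multilinear maps. -/
theorem MultilinearMap.factorial_smul_eq_sum_of_symmetric {E F : Type*} [AddCommGroup E] [Module ℝ E]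
    [AddCommGroup F] [Module ℝ F] {k : ℕ} (A : MultilinearMap ℝ (fun _ : Fin k => E) F)
    (hA : ∀ (π : Equiv.Perm (Fin k)) v, A (fun i => v (π i)) = A v) (x : E) (h : Fin k → E) :
    (k.factorial : ℝ) • A h =
      ∑ S : Finset (Fin k), (-1 : ℝ) ^ (#Sᶜ) • A (fun _ => x + ∑ i ∈ S, h i) := by
  have key : ∀ S : Finset (Fin k), A (fun _ => x + ∑ i ∈ S, h i) =
      ∑ φ : Fin k → Option (Fin k),
        (∏ j, (φ j).elim (1 : ℝ) (fun i => if i ∈ S then 1 else 0)) •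
          A (fun j => (φ j).elim x h) := by
    intro S
    have : (fun _ : Fin k => x + ∑ i ∈ S, h i) = fun _ : Fin k => ∑ o : Option (Fin k),
        o.elim (1 : ℝ) (fun i => if i ∈ S then 1 else 0) • o.elim x h := by
      funext _
      simp [Fintype.sum_option, ite_smul, Finset.sum_ite_mem]
    rw [this, A.map_sum]
    refine Finset.sum_congr rfl fun φ _ => ?_
    rw [A.map_smul_univ]
  simp only [key, Finset.smul_sum, smul_smul]
  rw [Finset.sum_comm]
  simp only [← Finset.sum_smul, sum_finset_sign_mul_prod]
  have h2 : ∑ π : Equiv.Perm (Fin k), A h = (k.factorial : ℝ) • A h := by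
    simp [Fintype.card_perm, Nat.cast_smul_eq_nsmul]
  rw [← h2]
  refine Fintype.sum_of_injective (fun (π : Equiv.Perm (Fin k)) j => some (π j)) ?_ _ _ ?_ ?_
  · intro π π' hh
    ext j
    have := congrFun hh j
    simpa using congrArg Fin.val (Option.some.inj this)
  · intro φ hφ
    rw [if_neg, zero_smul]
    intro hs
    apply hφ
    choose g hg using hs
    have hgi : Function.Injective g := by
      intro a b hab
      have := hg a
      rw [hab, hg b] at this
      exact (Option.some.inj this).symm
    refine ⟨(Equiv.ofBijective g (Finite.injective_iff_bijective.1 hgi)).symm, ?_⟩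
    funext j
    obtain ⟨i, rfl⟩ := (Finite.injective_iff_bijective.1 hgi).2 j
    simp only [hg]
    congr 1
    rw [Equiv.symm_apply_eq]; rfl
  · intro π
    rw [if_pos fun i => ⟨π.symm i, by simp⟩, one_smul]
    exact (hA π h).symm

theorem ContinuousMultilinearMap.norm_le_of_symmetric_of_diagonal_le {E F : Type*}
    [NormedAddCommGroup E] [NormedSpace ℝ E] [NormedAddCommGroup F] [NormedSpace ℝ F] {k : ℕ}
    (A : ContinuousMultilinearMap ℝ (fun _ : Fin k => E) F)
    (hA : ∀ (π : Equiv.Perm (Fin k)) v, A (fun i => v (π i)) = A v) (x : E) {r B : ℝ} (hr : 0 < r)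
    (hB : ∀ y ∈ Metric.closedBall x r, ‖A fun _ => y‖ ≤ B) :
    ‖A‖ ≤ (2 * Real.exp 1 / r) ^ k * B := by
  have hB0 : 0 ≤ B := (norm_nonneg _).trans (hB x (Metric.mem_closedBall_self hr.le))
  have hfac : (0 : ℝ) < k.factorial := by positivity
  have small : ∀ h : Fin k → E, (∀ i, ‖h i‖ ≤ r / k) → k.factorial * ‖A h‖ ≤ 2 ^ k * B := by
    intro h hh
    have := A.toMultilinearMap.factorial_smul_eq_sum_of_symmetric hA x h
    have h2 : k.factorial * ‖A h‖ = ‖(k.factorial : ℝ) • A h‖ := by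
      rw [norm_smul]; simp
    rw [h2]
    simp only [ContinuousMultilinearMap.coe_coe] at this
    rw [this]
    refine (norm_sum_le _ _).trans ?_
    have h3 : ∀ S ∈ (Finset.univ : Finset (Finset (Fin k))),
        ‖(-1 : ℝ) ^ (Sᶜ.card) • A (fun _ => x + ∑ i ∈ S, h i)‖ ≤ B := by
      intro S _
      rw [norm_smul]
      simp only [norm_pow, norm_neg, norm_one, one_pow, one_mul]
      apply hB
      rw [mem_closedBall_iff_norm, add_sub_cancel_left]
      refine (norm_sum_le _ _).trans ((Finset.sum_le_card_nsmul _ _ _ fun i _ => hh i).trans ?_)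
      rw [nsmul_eq_mul]
      have h4 : (S.card : ℝ) ≤ k := by
        exact_mod_cast (Finset.card_le_univ S).trans (by simp)
      rcases Nat.eq_zero_or_pos k with hk | hk
      · subst hk; simp [hr.le]
      · have : (0 : ℝ) < k := by exact_mod_cast hk
        calc (S.card : ℝ) * (r / k) ≤ k * (r / k) := by gcongr
          _ = r := by field_simp
    refine (Finset.sum_le_card_nsmul _ _ _ h3).trans ?_
    simp
  refine A.opNorm_le_bound (by positivity) fun h => ?_
  by_cases h0 : ∃ i, h i = 0
  · obtain ⟨i, hi⟩ := h0
    rw [A.map_coord_zero i hi, norm_zero]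
    positivity
  push Not at h0
  have h0' : ∀ i, 0 < ‖h i‖ := fun i => norm_pos_iff.2 (h0 i)
  have hs := small (fun i => ((r / k) / ‖h i‖) • h i) (by
    intro i
    rw [norm_smul, Real.norm_of_nonneg (by positivity)]
    have := h0' i
    apply le_of_eq; field_simp)
  rw [A.map_smul_univ, norm_smul, Finset.prod_div_distrib, Finset.prod_const, norm_div,
    Real.norm_of_nonneg (by positivity), Real.norm_of_nonneg (by positivity)] at hs
  simp only [Finset.card_univ, Fintype.card_fin] at hs
  have hP : 0 < ∏ i, ‖h i‖ := Finset.prod_pos fun i _ => h0' i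
  have hexp := Real.pow_div_factorial_le_exp (k : ℝ) (by positivity) k
  have hexp2 : Real.exp (k : ℝ) = Real.exp 1 ^ k := by rw [← Real.exp_nat_mul, mul_one]
  rw [hexp2, div_le_iff₀ hfac] at hexp
  rcases Nat.eq_zero_or_pos k with hk | hk
  · subst hk; simpa using hs
  have hk' : (0 : ℝ) < k := by exact_mod_cast hk
  rw [div_pow] at hs
  have hs2 : k.factorial * ‖A h‖ ≤ 2 ^ k * B * (k ^ k / r ^ k) * ∏ i, ‖h i‖ := by
    calc k.factorial * ‖A h‖ = (k.factorial * (r ^ k / k ^ k / (∏ i, ‖h i‖) * ‖A h‖)) *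
          (k ^ k / r ^ k) * ∏ i, ‖h i‖ := by field_simp
      _ ≤ _ := by gcongr
  have hs3 : 2 ^ k * B * (k ^ k / r ^ k) * ∏ i, ‖h i‖ ≤
      k.factorial * ((2 * Real.exp 1 / r) ^ k * B * ∏ i, ‖h i‖) := by
    calc 2 ^ k * B * (k ^ k / r ^ k) * ∏ i, ‖h i‖
        ≤ 2 ^ k * B * ((Real.exp 1 ^ k * k.factorial) / r ^ k) * ∏ i, ‖h i‖ := by gcongr
      _ = _ := by rw [div_pow, mul_pow]; ring
  exact le_of_mul_le_mul_left (hs2.trans hs3) hfac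

/-- A homogeneous polynomial bounded on some ball is the diagonal of a multilinear map whose norm
is controlled by that bound. -/
theorem ContinuousMultilinearMap.exists_diagonal_eq_norm_le {E F : Type*}
    [NormedAddCommGroup E] [NormedSpace ℝ E] [NormedAddCommGroup F] [NormedSpace ℝ F] {k : ℕ}
    (A : ContinuousMultilinearMap ℝ (fun _ : Fin k => E) F) (x : E) {r : ℝ} (hr : 0 < r) :
    ∃ A' : ContinuousMultilinearMap ℝ (fun _ : Fin k => E) F,
      (∀ y, A' (fun _ => y) = A fun _ => y) ∧
      ∀ B, (∀ y ∈ Metric.closedBall x r, ‖A fun _ => y‖ ≤ B) →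
        ‖A'‖ ≤ (2 * Real.exp 1 / r) ^ k * B := by
  set A' : ContinuousMultilinearMap ℝ (fun _ : Fin k => E) F :=
    (k.factorial : ℝ)⁻¹ • ∑ π : Equiv.Perm (Fin k), A.domDomCongr π with hA'
  have happ : ∀ v, A' v = (k.factorial : ℝ)⁻¹ • ∑ π : Equiv.Perm (Fin k), A fun i => v (π i) := by
    intro v
    simp [hA']
  have hdiag : ∀ y, A' (fun _ => y) = A fun _ => y := by
    intro y
    have hfac : (k.factorial : ℝ) ≠ 0 := by positivity
    rw [happ, Finset.sum_const, Finset.card_univ, Fintype.card_perm, Fintype.card_fin,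
      ← Nat.cast_smul_eq_nsmul ℝ, smul_smul, inv_mul_cancel₀ hfac, one_smul]
  refine ⟨A', hdiag, fun B hB => A'.norm_le_of_symmetric_of_diagonal_le ?_ x hr ?_⟩
  · intro σ v
    rw [happ, happ]
    congr 1
    exact Fintype.sum_equiv (Equiv.mulLeft σ) _ _ fun π => rfl
  · intro y hy
    rw [hdiag]
    exact hB y hy

open scoped Topology ContDiff in
theorem iteratedFDeriv_line_apply {E F : Type*} [NormedAddCommGroup E] [NormedSpace ℝ E]
    [NormedAddCommGroup F] [NormedSpace ℝ F] {u : E → F} {x₀ : E} {k : ℕ}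
    (hu : ContDiffAt ℝ k u x₀) (v : E) :
    iteratedFDeriv ℝ k (fun t : ℝ => u (x₀ + t • v)) 0 (fun _ => 1) =
      iteratedFDeriv ℝ k u x₀ fun _ => v := by
  have hw : ContDiffAt ℝ k (fun y => u (x₀ + y)) 0 := by
    have : ContDiffAt ℝ k u (x₀ + 0) := by simpa using hu
    exact this.comp (0 : E) (by fun_prop)
  have hf : iteratedFDeriv ℝ k u x₀ = iteratedFDeriv ℝ k (fun y => u (x₀ + y)) 0 := by
    rw [iteratedFDeriv_comp_add_left]; simp
  obtain ⟨s, hs0, hsc⟩ := hw.contDiffOn le_rfl (by simp)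
  obtain ⟨s', hs's, hs'o, h0s'⟩ := mem_nhds_iff.1 hs0
  let g : ℝ →L[ℝ] E := ContinuousLinearMap.toSpanSingleton ℝ v
  have hg0 : g 0 ∈ s' := by simpa using h0s'
  have hgo : IsOpen (g ⁻¹' s') := hs'o.preimage g.continuous
  have := g.iteratedFDerivWithin_comp_right (hsc.mono hs's) hs'o.uniqueDiffOn hgo.uniqueDiffOn
    hg0 (i := k) le_rfl
  rw [iteratedFDerivWithin_of_isOpen k hgo hg0, iteratedFDerivWithin_of_isOpen k hs'o hg0] at this
  have h2 := congrArg (fun A => A fun _ => (1 : ℝ)) this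
  simp only [ContinuousMultilinearMap.compContinuousLinearMap_apply] at h2
  rw [hf]
  simpa [g, Function.comp_def] using h2

open scoped Topology ContDiff NNReal ENNReal in
/-- A smooth function which is analytic along all lines through a point is analytic at that
point. -/
theorem ContDiffAt.analyticAt_of_analyticAt_lines {E F : Type*} [NormedAddCommGroup E]
    [NormedSpace ℝ E] [CompleteSpace E] [NormedAddCommGroup F] [NormedSpace ℝ F] [CompleteSpace F]
    {u : E → F} {x₀ : E} {R : ℝ} (hR : 0 < R) (hu : ContDiffAt ℝ ∞ u x₀)
    (hl : ∀ (v : E) (t : ℝ), ‖t • v‖ < R → AnalyticAt ℝ (fun s : ℝ => u (x₀ + s • v)) t) :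
    AnalyticAt ℝ u x₀ := by
  set P : ∀ k, ContinuousMultilinearMap ℝ (fun _ : Fin k => E) F :=
    fun k => (k.factorial : ℝ)⁻¹ • iteratedFDeriv ℝ k u x₀ with hP
  have hline : ∀ v : E, ∃ q : FormalMultilinearSeries ℝ ℝ F,
      HasFPowerSeriesAt (fun s : ℝ => u (x₀ + s • v)) q 0 ∧
        ∀ k, q k (fun _ => 1) = P k fun _ => v := by
    intro v
    obtain ⟨q, r, hq⟩ := hl v 0 (by simpa using hR)
    refine ⟨q, ⟨r, hq⟩, fun k => ?_⟩
    have h1 := hq.factorial_smul 1 k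
    rw [iteratedFDeriv_line_apply (hu.of_le (by exact_mod_cast le_top))] at h1
    have hfac : (k.factorial : ℝ) ≠ 0 := by positivity
    rw [hP, smul_apply, ← h1, ← Nat.cast_smul_eq_nsmul ℝ, smul_smul,
      inv_mul_cancel₀ hfac, one_smul]
  obtain ⟨N, hN⟩ : ∃ N : ℕ, (interior {v : E | ∀ k, ‖P k fun _ => v‖ ≤ (N : ℝ) ^ (k + 1)}).Nonempty := by
    refine nonempty_interior_of_iUnion_of_closed (fun N => ?_) ?_
    · simp only [Set.ofPred_forall]
      refine isClosed_iInter fun k => isClosed_le ?_ continuous_const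
      exact ((P k).cont.comp (continuous_pi fun _ => continuous_id)).norm
    · refine Set.eq_univ_of_forall fun v => Set.mem_iUnion.2 ?_
      obtain ⟨q, hq, hqP⟩ := hline v
      obtain ⟨C, r, hC, hr, hb⟩ := q.le_mul_pow_of_radius_pos hq.radius_pos
      obtain ⟨N, hN⟩ := exists_nat_ge (max C r)
      refine ⟨N, fun k => ?_⟩
      rw [← hqP]
      calc ‖q k fun _ => 1‖ ≤ ‖q k‖ * ∏ _i : Fin k, ‖(1 : ℝ)‖ := (q k).le_opNorm _
        _ = ‖q k‖ := by simp
        _ ≤ C * r ^ k := hb k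
        _ ≤ N * (N : ℝ) ^ k := by
          gcongr
          · exact (le_max_left _ _).trans hN
          · exact (le_max_right _ _).trans hN
        _ = (N : ℝ) ^ (k + 1) := by ring
  obtain ⟨v₀, hv₀⟩ := hN
  obtain ⟨r, hr, hball⟩ := Metric.nhds_basis_closedBall.mem_iff.1 (mem_interior_iff_mem_nhds.1 hv₀)
  choose p hpdiag hpnorm using fun k => (P k).exists_diagonal_eq_norm_le v₀ hr
  have hpn : ∀ k, ‖p k‖ ≤ (2 * Real.exp 1 / r) ^ k * (N : ℝ) ^ (k + 1) :=
    fun k => hpnorm k _ fun y hy => hball hy k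
  let pp : FormalMultilinearSeries ℝ E F := p
  have hrad : 0 < pp.radius := by
    set M : ℝ := 2 * Real.exp 1 / r * N + 1 with hM
    have hMpos : 0 < M := by positivity
    have : ((M⁻¹).toNNReal : ℝ≥0∞) ≤ pp.radius := by
      refine pp.le_radius_of_bound (N : ℝ) fun k => ?_
      rw [Real.coe_toNNReal _ (inv_nonneg.2 hMpos.le)]
      calc ‖p k‖ * M⁻¹ ^ k ≤ ((2 * Real.exp 1 / r) ^ k * (N : ℝ) ^ (k + 1)) * M⁻¹ ^ k := by
            gcongr; exact hpn k
        _ = N * ((2 * Real.exp 1 / r * N) * M⁻¹) ^ k := by rw [mul_pow, mul_pow]; ring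
        _ ≤ N * 1 ^ k := by
            gcongr
            rw [← div_eq_mul_inv, div_le_one hMpos, hM]
            linarith
        _ = N := by simp
    refine lt_of_lt_of_le ?_ this
    rw [ENNReal.coe_pos, Real.toNNReal_pos]
    positivity
  have hps := pp.hasFPowerSeriesOnBall hrad
  obtain ⟨ε, hε, hεr⟩ := ENNReal.lt_iff_exists_nnreal_btwn.1 hrad
  have hε0 : (0 : ℝ) < ε := by exact_mod_cast hε
  set δ : ℝ := min R ε with hδ
  have hδ0 : 0 < δ := lt_min hR hε0
  have han : ∀ y : E, ‖y‖ < δ → AnalyticAt ℝ pp.sum y := by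
    intro y hy
    refine hps.analyticAt_of_mem ?_
    rw [Metric.mem_eball, edist_zero_right]
    refine lt_trans ?_ hεr
    have : ‖y‖ < ε := hy.trans_le (min_le_right _ _)
    rw [enorm_eq_nnnorm]
    exact_mod_cast this
  have heq : ∀ y : E, ‖y‖ < δ → u (x₀ + y) = pp.sum y := by
    intro y hy
    set T : Set ℝ := {t | ‖t • y‖ < δ} with hT
    have hTpre : T = (ContinuousLinearMap.toSpanSingleton ℝ y) ⁻¹' Metric.ball 0 δ := by
      ext t; simp [hT]
    have hTconv : Convex ℝ T := by
      rw [hTpre]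
      exact (convex_ball (0 : E) δ).linear_preimage
        (ContinuousLinearMap.toSpanSingleton ℝ y).toLinearMap
    have h1 : AnalyticOnNhd ℝ (fun t : ℝ => u (x₀ + t • y)) T :=
      fun t ht => hl y t (ht.trans_le (min_le_left _ _))
    have h2 : AnalyticOnNhd ℝ (fun t : ℝ => pp.sum (t • y)) T := fun t ht =>
      (han (t • y) ht).comp_of_eq (f := fun t : ℝ => t • y)
        (analyticAt_id.smul analyticAt_const) rfl
    have h0 : (0 : ℝ) ∈ T := by simpa [hT] using hδ0
    have hev : (fun t : ℝ => u (x₀ + t • y)) =ᶠ[𝓝 0] fun t : ℝ => pp.sum (t • y) := by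
      obtain ⟨q, hq, hqP⟩ := hline y
      have hsmul : Tendsto (fun t : ℝ => t • y) (𝓝 0) (𝓝 0) := by
        have : Continuous fun t : ℝ => t • y := by fun_prop
        simpa using this.tendsto 0
      have hps' := hsmul.eventually hps.hasFPowerSeriesAt.eventually_hasSum
      filter_upwards [hq.eventually_hasSum, hps'] with t ht ht'
      simp only [zero_add] at ht ht'
      convert! ht.unique ?_
      convert! ht' using 1
      funext k
      rw [show pp k = p k from rfl, hpdiag, (P k).map_smul_univ (fun _ => t) (fun _ => y),
        q.apply_eq_pow_smul_coeff, FormalMultilinearSeries.coeff]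
      simp only [Finset.prod_const, Finset.card_univ, Fintype.card_fin]
      congr 1
      exact hqP k
    have := h1.eqOn_of_preconnected_of_eventuallyEq h2 hTconv.isPreconnected h0 hev
      (show (1 : ℝ) ∈ T by simpa [hT] using hy)
    simpa using this
  have hfin : u =ᶠ[𝓝 x₀] fun x => pp.sum (x - x₀) := by
    filter_upwards [Metric.ball_mem_nhds x₀ hδ0] with x hx
    rw [← heq (x - x₀) (by rwa [mem_ball_iff_norm] at hx)]
    simp
  refine AnalyticAt.congr ?_ hfin.symm
  exact (han 0 (by simpa using hδ0)).comp_of_eq (f := fun x => x - x₀)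
    (analyticAt_id.sub analyticAt_const) (by simp)

section FlatFunctions

open Polynomial Asymptotics
open scoped Topology ContDiff

/-- A function of a real variable is flat at the origin if it vanishes there to infinite order. -/
def FlatAtZero (g : ℝ → ℂ) : Prop := ∀ k : ℕ, g =o[𝓝[≠] 0] fun t : ℝ => t ^ k

/-- A polynomial whose coefficients are functions that are analytic at the origin. -/
def HasAnalyticCoeffs (P : (ℝ → ℂ)[X]) : Prop := ∀ i, AnalyticAt ℝ (P.coeff i) 0

theorem isBigO_pow_pow_of_le_nhds {n k : ℕ} (h : n ≤ k) :
    (fun t : ℝ => t ^ k) =O[𝓝 0] fun t : ℝ => t ^ n := by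
  rcases h.lt_or_eq with h | rfl
  · exact (isLittleO_pow_pow h).isBigO
  · exact isBigO_refl _ _

theorem isBigO_pow_pow_of_le {n k : ℕ} (h : n ≤ k) :
    (fun t : ℝ => t ^ k) =O[𝓝[≠] 0] fun t : ℝ => t ^ n :=
  (isBigO_pow_pow_of_le_nhds h).mono nhdsWithin_le_nhds

theorem isBigO_ofReal_pow (n : ℕ) :
    (fun t : ℝ => (t : ℂ) ^ n) =O[𝓝[≠] 0] fun t : ℝ => t ^ n :=
  IsBigO.of_bound 1 (.of_forall fun t => by simp)

theorem lt_of_pow_mul_isLittleO {g : ℝ → ℂ} (hg : ContinuousAt g 0) (h0 : g 0 ≠ 0) {n k : ℕ}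
    (h : (fun t : ℝ => (t : ℂ) ^ n * g t) =o[𝓝[≠] 0] fun t : ℝ => t ^ k) : k < n := by
  by_contra! hle
  have h1 := h.trans_isBigO (isBigO_pow_pow_of_le hle)
  have h2 : g =o[𝓝[≠] 0] fun _ : ℝ => (1 : ℝ) := by
    rw [isLittleO_iff] at h1 ⊢
    intro c hc
    filter_upwards [h1 hc, self_mem_nhdsWithin] with t ht ht0
    have ht0' : 0 < |t| ^ n := pow_pos (abs_pos.2 ht0) n
    simp only [norm_mul, norm_pow, Complex.norm_real, Real.norm_eq_abs, norm_one, mul_one] at ht ⊢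
    exact le_of_mul_le_mul_left (by linarith) ht0'
  rw [isLittleO_one_iff] at h2
  exact h0 (tendsto_nhds_unique (hg.tendsto.mono_left nhdsWithin_le_nhds) h2)

theorem AnalyticAt.eventually_eq_zero_or_pow_mul {f : ℝ → ℂ} (hf : AnalyticAt ℝ f 0) :
    (∀ᶠ t in 𝓝 0, f t = 0) ∨ ∃ (n : ℕ) (g : ℝ → ℂ), AnalyticAt ℝ g 0 ∧ g 0 ≠ 0 ∧
      ∀ᶠ t : ℝ in 𝓝 0, f t = (t : ℂ) ^ n * g t := by
  by_cases h : ∀ᶠ t in 𝓝 0, f t = 0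
  · exact Or.inl h
  · obtain ⟨n, g, hg, hg0, hfg⟩ := hf.exists_eventuallyEq_pow_smul_nonzero_iff.2 h
    refine Or.inr ⟨n, g, hg, hg0, ?_⟩
    filter_upwards [hfg] with t ht
    rw [ht, sub_zero, Complex.real_smul, Complex.ofReal_pow]

theorem AnalyticAt.eventually_eq_pow_mul_of_isLittleO {f : ℝ → ℂ} (hf : AnalyticAt ℝ f 0) {k : ℕ}
    (hk : f =o[𝓝[≠] 0] fun t : ℝ => t ^ k) :
    ∃ c : ℝ → ℂ, AnalyticAt ℝ c 0 ∧ c 0 = 0 ∧ ∀ᶠ t : ℝ in 𝓝 0, f t = (t : ℂ) ^ k * c t := by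
  rcases hf.eventually_eq_zero_or_pow_mul with h | ⟨n, g, hg, hg0, hfg⟩
  · exact ⟨0, analyticAt_const, rfl, by simpa using h⟩
  · have hlt : k < n := lt_of_pow_mul_isLittleO hg.continuousAt hg0
      (hk.congr' (hfg.filter_mono nhdsWithin_le_nhds) EventuallyEq.rfl)
    have hof : AnalyticAt ℝ (fun t : ℝ => (t : ℂ)) 0 := Complex.ofRealCLM.analyticAt 0
    refine ⟨fun t => (t : ℂ) ^ (n - k) * g t, (hof.pow _).mul hg, ?_, ?_⟩
    · simp [Nat.sub_ne_zero_of_lt hlt]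
    · filter_upwards [hfg] with t ht
      rw [ht, ← mul_assoc, ← pow_add, Nat.add_sub_cancel' hlt.le]

theorem ContDiffAt.exists_polynomial_isLittleO {u : ℝ → ℂ} (hu : ContDiffAt ℝ ∞ u 0) (n : ℕ) :
    ∃ T : ℝ → ℂ, AnalyticAt ℝ T 0 ∧ (u - T) =o[𝓝[≠] 0] fun t : ℝ => t ^ n := by
  obtain ⟨s, hs, hus⟩ := (hu.of_le (by exact_mod_cast le_top : (n : ℕ∞ω) ≤ ∞)).contDiffOn le_rfl (by simp)
  obtain ⟨ε, hε, hball⟩ := Metric.mem_nhds_iff.1 hs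
  have h0 : (0 : ℝ) ∈ Metric.ball (0 : ℝ) ε := Metric.mem_ball_self hε
  have h := taylor_isLittleO (convex_ball (0 : ℝ) ε) h0 (hus.mono hball)
  rw [Metric.isOpen_ball.nhdsWithin_eq h0] at h
  refine ⟨taylorWithinEval u n (Metric.ball 0 ε) 0, ?_, ?_⟩
  · have : taylorWithinEval u n (Metric.ball 0 ε) 0 = fun x => ∑ k ∈ Finset.range (n + 1),
        ((k.factorial : ℝ)⁻¹ * (x - 0) ^ k) • iteratedDerivWithin k u (Metric.ball 0 ε) 0 := by
      funext x
      exact taylor_within_apply _ _ _ _ _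
    rw [this]
    refine Finset.analyticAt_fun_sum _ fun k _ => ?_
    fun_prop
  · simp only [sub_zero] at h
    exact h.mono nhdsWithin_le_nhds

theorem ContDiffAt.flatAtZero_or_isLittleO {g : ℝ → ℂ} (hg : ContDiffAt ℝ ∞ g 0) :
    FlatAtZero g ∨ ∃ (e : ℕ) (C : ℂ), C ≠ 0 ∧
      (fun t : ℝ => g t - (t : ℂ) ^ e * C) =o[𝓝[≠] 0] fun t : ℝ => t ^ e := by
  refine or_iff_not_imp_left.2 fun hflat => ?_
  simp only [FlatAtZero, not_forall] at hflat
  obtain ⟨k, hk⟩ := hflat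
  obtain ⟨T, hT, hgT⟩ := hg.exists_polynomial_isLittleO k
  rcases hT.eventually_eq_zero_or_pow_mul with h | ⟨n, c, hc, hc0, hTc⟩
  · refine absurd (hgT.congr' ?_ EventuallyEq.rfl) hk
    filter_upwards [h.filter_mono nhdsWithin_le_nhds] with t ht
    simp [ht]
  have hcl : (fun t : ℝ => (t : ℂ) ^ n * (c t - c 0)) =o[𝓝[≠] 0] fun t : ℝ => t ^ n := by
    have h1 : (fun t => c t - c 0) =o[𝓝[≠] 0] fun _ => (1 : ℝ) := by
      rw [isLittleO_one_iff]
      have := (hc.continuousAt.tendsto.mono_left (nhdsWithin_le_nhds (s := {(0 : ℝ)}ᶜ))).sub_const (c 0)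
      simpa using this
    have h2 : (fun t : ℝ => (t : ℂ) ^ n) =O[𝓝[≠] 0] fun t : ℝ => t ^ n :=
      isBigO_ofReal_pow n
    simpa using h2.mul_isLittleO h1
  have hnk : n ≤ k := by
    by_contra! hlt
    refine hk ?_
    have h1 : T =o[𝓝[≠] 0] fun t : ℝ => t ^ k := by
      have h2 : T =O[𝓝[≠] 0] fun t : ℝ => t ^ n := by
        have h3 : (fun t : ℝ => (t : ℂ) ^ n * c t) =O[𝓝[≠] 0] fun t : ℝ => t ^ n * (1 : ℝ) := by
          refine IsBigO.mul (isBigO_ofReal_pow n) ?_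
          exact (hc.continuousAt.norm.isBoundedUnder_le.isBigO_one ℝ).mono nhdsWithin_le_nhds
        simp only [mul_one] at h3
        exact h3.congr' (hTc.filter_mono nhdsWithin_le_nhds |>.mono fun t ht => ht.symm)
          EventuallyEq.rfl
      exact h2.trans_isLittleO ((isLittleO_pow_pow hlt).mono nhdsWithin_le_nhds)
    simpa using hgT.add h1
  refine ⟨n, c 0, hc0, ?_⟩
  refine ((hgT.trans_isBigO (isBigO_pow_pow_of_le hnk)).add hcl).congr' ?_ EventuallyEq.rfl
  filter_upwards [hTc.filter_mono nhdsWithin_le_nhds] with t ht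
  simp only [Pi.sub_apply, ht]
  ring

namespace HasAnalyticCoeffs

variable {P : (ℝ → ℂ)[X]}

theorem eval_apply_eq_sum (P : (ℝ → ℂ)[X]) (u : ℝ → ℂ) (t : ℝ) :
    P.eval u t = ∑ i ∈ Finset.range (P.natDegree + 1), P.coeff i t * u t ^ i := by
  rw [eval_eq_sum_range, Finset.sum_apply]
  rfl

theorem analyticAt_eval (hP : HasAnalyticCoeffs P) {h : ℝ → ℂ} (hh : AnalyticAt ℝ h 0) :
    AnalyticAt ℝ (P.eval h) 0 := by
  rw [show P.eval h = fun t => _ from funext (eval_apply_eq_sum P h)]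
  exact Finset.analyticAt_fun_sum _ fun i _ => (hP i).mul (hh.pow i)

theorem contDiffAt_eval (hP : HasAnalyticCoeffs P) {h : ℝ → ℂ} (hh : ContDiffAt ℝ ∞ h 0) :
    ContDiffAt ℝ ∞ (P.eval h) 0 := by
  rw [show P.eval h = fun t => _ from funext (eval_apply_eq_sum P h)]
  exact ContDiffAt.sum fun i _ => (hP i).contDiffAt.mul (hh.pow i)

theorem eval_isBigO_one (hP : HasAnalyticCoeffs P) {w : ℝ → ℂ}
    (hw : Tendsto w (𝓝[≠] 0) (𝓝 0)) : P.eval w =O[𝓝[≠] 0] fun _ => (1 : ℝ) := by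
  rw [show P.eval w = fun t => _ from funext (eval_apply_eq_sum P w)]
  refine IsBigO.fun_sum fun i _ => ?_
  have h1 : Tendsto (fun t => P.coeff i t * w t ^ i) (𝓝[≠] 0) (𝓝 (P.coeff i 0 * 0 ^ i)) :=
    ((hP i).continuousAt.tendsto.mono_left nhdsWithin_le_nhds).mul (hw.pow i)
  exact h1.isBigO_one ℝ

theorem derivative (hP : HasAnalyticCoeffs P) : HasAnalyticCoeffs (derivative P) := by
  intro i
  rw [coeff_derivative]
  exact (hP (i + 1)).mul (analyticAt_const (v := (i : ℂ) + 1))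

theorem divX (hP : HasAnalyticCoeffs P) : HasAnalyticCoeffs P.divX := by
  intro i
  rw [coeff_divX]
  exact hP _

theorem taylor (hP : HasAnalyticCoeffs P) {T : ℝ → ℂ} (hT : AnalyticAt ℝ T 0) :
    HasAnalyticCoeffs (taylor T P) := by
  intro i
  rw [taylor_coeff]
  refine analyticAt_eval (fun j => ?_) hT
  rw [hasseDeriv_coeff]
  exact (analyticAt_const (v := ((j + i).choose i : ℂ))).mul (hP _)

end HasAnalyticCoeffs

theorem Polynomial.eval_eq_coeff_zero_add {R : Type*} [CommRing R] (Q : R[X]) (w : R) :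
    Q.eval w = Q.coeff 0 + w * Q.divX.eval w := by
  conv_lhs => rw [← divX_mul_X_add Q]
  simp
  ring

theorem Polynomial.eval_eq_eval_taylor_sub {R : Type*} [CommRing R] (P : R[X]) (u T : R) :
    P.eval u = (taylor T P).eval (u - T) := by
  simp [taylor_eval]

theorem FlatAtZero.tendsto {w : ℝ → ℂ} (hw : FlatAtZero w) : Tendsto w (𝓝[≠] 0) (𝓝 0) := by
  have := hw 0
  simpa [isLittleO_one_iff] using this

theorem FlatAtZero.eventually_eq_zero_of_coeff_zero {w : ℝ → ℂ} (hw : FlatAtZero w)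
    {Q : (ℝ → ℂ)[X]} (hQ : HasAnalyticCoeffs Q) (h0 : ¬ ∀ᶠ t in 𝓝 0, Q.coeff 0 t = 0)
    (hroot : ∀ᶠ t in 𝓝[≠] 0, w t ≠ 0 → Q.eval w t = 0) : ∀ᶠ t in 𝓝[≠] 0, w t = 0 := by
  obtain ⟨n, g, hg, hg0, hQg⟩ := (hQ 0).eventually_eq_zero_or_pow_mul.resolve_left h0
  obtain ⟨K, hK, hR⟩ := (hQ.divX.eval_isBigO_one hw.tendsto).exists_pos
  have hg0' : 0 < ‖g 0‖ := norm_pos_iff.2 hg0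
  have hgl : ∀ᶠ t in 𝓝 0, ‖g 0‖ / 2 < ‖g t‖ :=
    hg.continuousAt.norm.eventually (lt_mem_nhds (half_lt_self hg0'))
  have hwn := (isLittleO_iff.1 (hw n)) (show 0 < ‖g 0‖ / 2 / K by positivity)
  filter_upwards [hroot, hQg.filter_mono nhdsWithin_le_nhds, hR.bound,
    hgl.filter_mono nhdsWithin_le_nhds, hwn, self_mem_nhdsWithin] with t h1 h2 h3 h4 h5 h6
  by_contra hne
  have h7 := h1 hne
  rw [Polynomial.eval_eq_coeff_zero_add, Pi.add_apply, Pi.mul_apply, h2] at h7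
  have ht : 0 < |t| ^ n := pow_pos (abs_pos.2 h6) n
  have h8 : |t| ^ n * ‖g t‖ = ‖w t‖ * ‖Q.divX.eval w t‖ := by
    have := congrArg norm (eq_neg_of_add_eq_zero_left h7)
    simpa using this
  simp only [norm_one, mul_one, norm_pow, Real.norm_eq_abs] at h3 h5
  have h9 : ‖w t‖ * ‖Q.divX.eval w t‖ ≤ (‖g 0‖ / 2 / K * |t| ^ n) * K := by gcongr
  have h10 : (‖g 0‖ / 2 / K * |t| ^ n) * K = |t| ^ n * (‖g 0‖ / 2) := by field_simp
  have h11 : |t| ^ n * (‖g 0‖ / 2) < |t| ^ n * ‖g t‖ := by gcongr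
  linarith

/-- A flat root of a polynomial with analytic coefficients that are not all zero vanishes. -/
theorem FlatAtZero.eventually_eq_zero {w : ℝ → ℂ} (hw : FlatAtZero w) (i : ℕ) :
    ∀ Q : (ℝ → ℂ)[X], HasAnalyticCoeffs Q → (¬ ∀ᶠ t in 𝓝 0, Q.coeff i t = 0) →
      (∀ᶠ t in 𝓝[≠] 0, w t ≠ 0 → Q.eval w t = 0) → ∀ᶠ t in 𝓝[≠] 0, w t = 0 := by
  induction i with
  | zero => exact fun Q hQ hi hroot => hw.eventually_eq_zero_of_coeff_zero hQ hi hroot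
  | succ i ih =>
    intro Q hQ hi hroot
    by_cases h0 : ∀ᶠ t in 𝓝 0, Q.coeff 0 t = 0
    · refine ih Q.divX hQ.divX (by rwa [coeff_divX]) ?_
      filter_upwards [hroot, h0.filter_mono nhdsWithin_le_nhds] with t h1 h2 hne
      have h3 := h1 hne
      rw [Polynomial.eval_eq_coeff_zero_add, Pi.add_apply, Pi.mul_apply, h2, zero_add] at h3
      exact (mul_eq_zero.1 h3).resolve_left hne
    · exact hw.eventually_eq_zero_of_coeff_zero hQ h0 hroot

/-- A one-dimensional analytic implicit function theorem with a quantitative uniqueness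
statement. -/
theorem exists_analytic_implicit {Φ : ℝ × ℂ → ℂ} (hΦ : AnalyticAt ℝ Φ 0) (h0 : Φ 0 = 0) {C : ℂ}
    (hC : C ≠ 0) (hΦC : ∀ z, Φ (0, z) = C * z) :
    ∃ V : ℝ → ℂ, AnalyticAt ℝ V 0 ∧ V 0 = 0 ∧ (∀ᶠ t in 𝓝 0, Φ (t, V t) = 0) ∧
      ∀ v : ℝ → ℂ, Tendsto v (𝓝[≠] 0) (𝓝 0) →
        (fun t => v t - V t) =O[𝓝[≠] 0] fun t => Φ (t, v t) := by
  have hcd : ContDiffAt ℝ ω Φ 0 := hΦ.contDiffAt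
  have hstrict := hcd.hasStrictFDerivAt (by simp)
  set L := fderiv ℝ Φ 0 with hL
  have hLC : L ∘L .inr ℝ ℝ ℂ = ContinuousLinearMap.mul ℝ ℂ C := by
    have h1 : HasFDerivAt (fun z : ℂ => Φ (0, z)) (L ∘L .inr ℝ ℝ ℂ) 0 := by
      have h2 : HasFDerivAt Φ L ((ContinuousLinearMap.inr ℝ ℝ ℂ) 0) := by
        simpa using! hstrict.hasFDerivAt
      exact h2.comp (0 : ℂ) (ContinuousLinearMap.inr ℝ ℝ ℂ).hasFDerivAt
    have h2 : HasFDerivAt (fun z : ℂ => Φ (0, z)) (ContinuousLinearMap.mul ℝ ℂ C) 0 := by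
      have h3 : (fun z : ℂ => Φ (0, z)) = ContinuousLinearMap.mul ℝ ℂ C := by
        funext z; simp [hΦC]
      rw [h3]
      exact ContinuousLinearMap.hasFDerivAt _
    exact h1.unique h2
  have hinv : (L ∘L .inr ℝ ℝ ℂ).IsInvertible := by
    rw [hLC]
    refine ContinuousLinearMap.IsInvertible.of_inverse (g := ContinuousLinearMap.mul ℝ ℂ C⁻¹) ?_ ?_
    · ext; simp [hC]
    · ext; simp [hC]
  set V := hcd.implicitFunction (by simp) hinv with hV
  have hVan : AnalyticAt ℝ V 0 := (hcd.contDiffAt_implicitFunction (by simp) hinv).analyticAt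
  have hV0 : V 0 = 0 := hcd.implicitFunction_apply_self (by simp) hinv
  have hVev : ∀ᶠ t in 𝓝 0, Φ (t, V t) = 0 := by
    have := hcd.eventually_apply_implicitFunction (by simp) hinv
    simpa [h0] using! this
  refine ⟨V, hVan, hV0, hVev, fun v hv => ?_⟩
  have hid : Tendsto (fun t : ℝ => t) (𝓝[≠] 0) (𝓝 0) := tendsto_id.mono_left nhdsWithin_le_nhds
  have hVt : Tendsto V (𝓝[≠] 0) (𝓝 0) := by
    simpa [hV0] using hVan.continuousAt.tendsto.mono_left nhdsWithin_le_nhds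
  have ht : Tendsto (fun t => ((t, v t), (t, V t))) (𝓝[≠] 0)
      (𝓝 ((0 : ℝ × ℂ), (0 : ℝ × ℂ))) :=
    (hid.prodMk_nhds hv).prodMk_nhds (hid.prodMk_nhds hVt)
  have hlo := hstrict.isLittleO.comp_tendsto ht
  have hdiff : ∀ z : ℂ, L (0, z) = C * z := by
    intro z
    have := congrArg (fun A => A z) hLC
    simpa using this
  have hlo2 : (fun t => Φ (t, v t) - Φ (t, V t) - C * (v t - V t)) =o[𝓝[≠] 0]
      fun t => v t - V t := by
    refine (hlo.congr_left fun t => ?_).trans_isBigO (IsBigO.of_bound 1 (.of_forall fun t => ?_))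
    · change Φ (t, v t) - Φ (t, V t) - L ((t, v t) - (t, V t)) = _
      rw [Prod.mk_sub_mk, sub_self, hdiff]
    · simp [Prod.norm_def]
  have hb := (isLittleO_iff.1 hlo2) (show 0 < ‖C‖ / 2 by positivity)
  refine IsBigO.of_bound (2 / ‖C‖) ?_
  filter_upwards [hb, hVev.filter_mono nhdsWithin_le_nhds] with t h1 h2
  rw [h2, sub_zero] at h1
  have hC' : 0 < ‖C‖ := norm_pos_iff.2 hC
  have h3 : ‖C‖ * ‖v t - V t‖ ≤ ‖Φ (t, v t)‖ + ‖C‖ / 2 * ‖v t - V t‖ := by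
    rw [← norm_mul]
    calc ‖C * (v t - V t)‖ = ‖Φ (t, v t) - (Φ (t, v t) - C * (v t - V t))‖ := by congr 1; ring
      _ ≤ _ := (norm_sub_le _ _).trans (by gcongr)
  rw [div_mul_eq_mul_div, le_div_iff₀ hC']
  linarith

/-- Newton's lemma: an approximate smooth root at which the derivative is not flat is approximated
to infinite order by an analytic function. -/
theorem HasAnalyticCoeffs.exists_analytic_of_derivative_not_flat {P : (ℝ → ℂ)[X]}
    (hP : HasAnalyticCoeffs P) {u : ℝ → ℂ} (hu : ContDiffAt ℝ ∞ u 0) (hflat : FlatAtZero (P.eval u))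
    {e : ℕ} {C : ℂ} (hC : C ≠ 0)
    (hD : (fun t : ℝ => P.derivative.eval u t - (t : ℂ) ^ e * C) =o[𝓝[≠] 0] fun t : ℝ => t ^ e) :
    ∃ h : ℝ → ℂ, AnalyticAt ℝ h 0 ∧ FlatAtZero (u - h) := by
  obtain ⟨T, hT, huT⟩ := hu.exists_polynomial_isLittleO (e + 1)
  have hof : AnalyticAt ℝ (fun t : ℝ => (t : ℂ)) 0 := Complex.ofRealCLM.analyticAt 0
  set Q := Polynomial.taylor T P with hQdef
  have hQ : HasAnalyticCoeffs Q := hP.taylor hT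
  set R := Q.divX.divX with hRdef
  have hR : HasAnalyticCoeffs R := hQ.divX.divX
  have hexp : ∀ x t, P.eval x t = Q.coeff 0 t + (x t - T t) * (Q.coeff 1 t +
      (x t - T t) * R.eval (x - T) t) := by
    intro x t
    rw [P.eval_eq_eval_taylor_sub x T, Q.eval_eq_coeff_zero_add, Q.divX.eval_eq_coeff_zero_add,
      coeff_divX]
    rfl
  have hQ1 : Q.coeff 1 = P.derivative.eval T := taylor_coeff_one T P
  have hw0 : Tendsto (u - T) (𝓝[≠] 0) (𝓝 0) := by
    have := huT.trans_isBigO (isBigO_pow_pow_of_le (Nat.zero_le _))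
    simpa [isLittleO_one_iff] using this
  -- the linear coefficient
  obtain ⟨a, ha, ha0, hQa⟩ : ∃ a : ℝ → ℂ, AnalyticAt ℝ a 0 ∧ a 0 = 0 ∧
      ∀ᶠ t : ℝ in 𝓝 0, Q.coeff 1 t - (t : ℂ) ^ e * C = (t : ℂ) ^ e * a t := by
    refine AnalyticAt.eventually_eq_pow_mul_of_isLittleO
      (f := fun t => Q.coeff 1 t - (t : ℂ) ^ e * C)
      ((hQ 1).sub ((hof.pow e).mul analyticAt_const)) ?_
    have h1 : (fun t => (u - T) t * (Polynomial.taylor T P.derivative).divX.eval (u - T) t)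
        =o[𝓝[≠] 0] fun t : ℝ => t ^ e := by
      have := huT.mul_isBigO ((hP.derivative.taylor hT).divX.eval_isBigO_one hw0)
      simp only [mul_one] at this
      exact this.trans_isBigO (isBigO_pow_pow_of_le (Nat.le_succ e))
    refine (hD.sub h1).congr_left fun t => ?_
    rw [hQ1, P.derivative.eval_eq_eval_taylor_sub u T, Polynomial.eval_eq_coeff_zero_add,
      taylor_coeff_zero]
    simp only [Pi.add_apply, Pi.mul_apply]
    ring
  -- the constant coefficient
  obtain ⟨c, hc, hc0, hQc⟩ : ∃ c : ℝ → ℂ, AnalyticAt ℝ c 0 ∧ c 0 = 0 ∧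
      ∀ᶠ t : ℝ in 𝓝 0, Q.coeff 0 t = (t : ℂ) ^ (2 * e + 1) * c t := by
    refine (hQ 0).eventually_eq_pow_mul_of_isLittleO ?_
    have h1 : (Q.coeff 1) =O[𝓝[≠] 0] fun t : ℝ => t ^ e := by
      have h2 : (fun t : ℝ => (t : ℂ) ^ e * (C + a t)) =O[𝓝[≠] 0] fun t : ℝ => t ^ e * (1 : ℝ) := by
        refine (isBigO_ofReal_pow e).mul ?_
        exact ((continuousAt_const.add ha.continuousAt).tendsto.mono_left
          nhdsWithin_le_nhds).isBigO_one ℝ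
      simp only [mul_one] at h2
      refine h2.congr' ?_ EventuallyEq.rfl
      filter_upwards [hQa.filter_mono nhdsWithin_le_nhds] with t ht
      linear_combination -ht
    have h2 : (fun t => (u - T) t * Q.coeff 1 t) =o[𝓝[≠] 0] fun t : ℝ => t ^ (2 * e + 1) := by
      refine (huT.mul_isBigO h1).congr_right fun t => ?_
      ring
    have h3 : (fun t => (u - T) t * ((u - T) t * R.eval (u - T) t)) =o[𝓝[≠] 0]
        fun t : ℝ => t ^ (2 * e + 1) := by
      have := huT.mul_isBigO (huT.isBigO.mul (hR.eval_isBigO_one hw0))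
      refine this.trans_isBigO ?_
      refine (isBigO_pow_pow_of_le (n := 2 * e + 1) (k := 2 * e + 2) (by omega)).congr_left
        fun t => ?_
      ring
    refine (((hflat (2 * e + 1)).sub h2).sub h3).congr_left fun t => ?_
    rw [hexp u t]
    simp only [Pi.sub_apply]
    ring
  set Φ : ℝ × ℂ → ℂ := fun p => c p.1 + (C + a p.1) * p.2 + p.1 * p.2 ^ 2 *
    ∑ i ∈ Finset.range (R.natDegree + 1), R.coeff i p.1 * ((p.1 : ℂ) ^ (e + 1) * p.2) ^ i with hΦdef
  have hfst : AnalyticAt ℝ (fun p : ℝ × ℂ => p.1) 0 := analyticAt_fst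
  have hsnd : AnalyticAt ℝ (fun p : ℝ × ℂ => p.2) 0 := analyticAt_snd
  have hfstc : AnalyticAt ℝ (fun p : ℝ × ℂ => (p.1 : ℂ)) 0 := hof.comp_of_eq hfst rfl
  have hΦan : AnalyticAt ℝ Φ 0 := by
    refine ((hc.comp_of_eq hfst rfl).add
      ((analyticAt_const.add (ha.comp_of_eq hfst rfl)).mul hsnd)).add
      ((hfstc.mul (hsnd.pow 2)).mul ?_)
    refine Finset.analyticAt_fun_sum _ fun i _ => ?_
    exact ((hR i).comp_of_eq hfst rfl).mul (((hfstc.pow _).mul hsnd).pow i)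
  have hΦeval : ∀ v : ℝ → ℂ, ∀ᶠ t : ℝ in 𝓝 0,
      P.eval (fun s : ℝ => T s + (s : ℂ) ^ (e + 1) * v s) t = (t : ℂ) ^ (2 * e + 1) * Φ (t, v t) := by
    intro v
    filter_upwards [hQa, hQc] with t h1 h2
    rw [hexp, h2, show Q.coeff 1 t = (t : ℂ) ^ e * (C + a t) by linear_combination h1,
      HasAnalyticCoeffs.eval_apply_eq_sum]
    simp only [hΦdef, Pi.sub_apply, add_sub_cancel_left]
    ring
  obtain ⟨V, hV, hV0, hVroot, hVuniq⟩ := exists_analytic_implicit hΦan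
    (by simp [hΦdef, hc0]) hC (fun z => by simp [hΦdef, hc0, ha0])
  refine ⟨fun t => T t + (t : ℂ) ^ (e + 1) * V t, hT.add ((hof.pow _).mul hV), ?_⟩
  set v : ℝ → ℂ := fun t => (u t - T t) / (t : ℂ) ^ (e + 1) with hvdef
  have hv : Tendsto v (𝓝[≠] 0) (𝓝 0) := by
    rw [← isLittleO_one_iff ℝ, isLittleO_iff]
    intro ε hε
    filter_upwards [isLittleO_iff.1 huT hε, self_mem_nhdsWithin] with t h1 h2
    have ht : 0 < |t| ^ (e + 1) := pow_pos (abs_pos.2 h2) _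
    simp only [Pi.sub_apply, norm_pow, Real.norm_eq_abs] at h1
    simp only [hvdef, norm_div, norm_pow, Complex.norm_real, Real.norm_eq_abs, norm_one, mul_one]
    rwa [div_le_iff₀ ht]
  have huv : ∀ t : ℝ, t ≠ 0 → u t = T t + (t : ℂ) ^ (e + 1) * v t := by
    intro t ht
    have : (t : ℂ) ≠ 0 := by exact_mod_cast ht
    simp only [hvdef]
    field_simp
    ring
  have hPu : ∀ᶠ t : ℝ in 𝓝[≠] 0, P.eval u t = (t : ℂ) ^ (2 * e + 1) * Φ (t, v t) := by
    filter_upwards [(hΦeval v).filter_mono nhdsWithin_le_nhds, self_mem_nhdsWithin] with t h1 h2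
    rw [← h1, HasAnalyticCoeffs.eval_apply_eq_sum, HasAnalyticCoeffs.eval_apply_eq_sum, huv t h2]
  intro k
  obtain ⟨K, hK, hbound⟩ := (hVuniq v hv).exists_pos
  rw [isLittleO_iff]
  intro ε hε
  filter_upwards [hPu, hbound.bound, isLittleO_iff.1 (hflat (k + e)) (show 0 < ε / K by positivity),
    self_mem_nhdsWithin] with t h1 h2 h3 h4
  have ht : 0 < |t| := abs_pos.2 h4
  have h5 : (u - fun t : ℝ => T t + (t : ℂ) ^ (e + 1) * V t) t =
      (t : ℂ) ^ (e + 1) * (v t - V t) := by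
    rw [Pi.sub_apply, huv t h4]; ring
  rw [h1] at h3
  rw [h5]
  simp only [norm_mul, norm_pow, Complex.norm_real, Real.norm_eq_abs] at h3 ⊢
  refine le_of_mul_le_mul_left ?_ (pow_pos ht e)
  calc |t| ^ e * (|t| ^ (e + 1) * ‖v t - V t‖) ≤ |t| ^ e * (|t| ^ (e + 1) * (K * ‖Φ (t, v t)‖)) := by
        gcongr
    _ = K * (|t| ^ (2 * e + 1) * ‖Φ (t, v t)‖) := by ring
    _ ≤ K * (ε / K * |t| ^ (k + e)) := by gcongr
    _ = |t| ^ e * (ε * |t| ^ k) := by field_simp; ring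

theorem HasAnalyticCoeffs.exists_analytic_of_flat {u : ℝ → ℂ} (hu : ContDiffAt ℝ ∞ u 0) (n : ℕ) :
    ∀ P : (ℝ → ℂ)[X], HasAnalyticCoeffs P → P.natDegree ≤ n →
      (∃ c : ℂ, c ≠ 0 ∧ P.coeff n = fun _ => c) → FlatAtZero (P.eval u) →
      ∃ h : ℝ → ℂ, AnalyticAt ℝ h 0 ∧ FlatAtZero (u - h) := by
  induction n with
  | zero =>
    rintro P hP hdeg ⟨c, hc, hPc⟩ hflat
    rw [eq_C_of_natDegree_le_zero hdeg, eval_C, hPc] at hflat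
    exact absurd (tendsto_nhds_unique hflat.tendsto tendsto_const_nhds).symm hc
  | succ n ih =>
    rintro P hP hdeg ⟨c, hc, hPc⟩ hflat
    rcases (hP.derivative.contDiffAt_eval hu).flatAtZero_or_isLittleO with hD | ⟨e, C, hC, hD⟩
    · refine ih P.derivative hP.derivative ((natDegree_derivative_le P).trans (by omega))
        ⟨c * (n + 1), mul_ne_zero hc (by exact_mod_cast Nat.succ_ne_zero n), ?_⟩ hD
      rw [coeff_derivative, hPc]
      funext t
      simp
    · exact hP.exists_analytic_of_derivative_not_flat hu hflat hC hD

/-- A smooth root of a monic polynomial with analytic coefficients is analytic. -/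
theorem HasAnalyticCoeffs.analyticAt_of_root {P : (ℝ → ℂ)[X]} (hP : HasAnalyticCoeffs P)
    (hmonic : P.Monic) {u : ℝ → ℂ} (hu : ContDiffAt ℝ ∞ u 0) (hroot : P.eval u = 0) :
    AnalyticAt ℝ u 0 := by
  obtain ⟨h, hh, hflat⟩ := HasAnalyticCoeffs.exists_analytic_of_flat hu P.natDegree P hP le_rfl
    ⟨1, one_ne_zero, hmonic⟩ (by rw [hroot]; exact fun k => isLittleO_zero _ _)
  have hev := hflat.eventually_eq_zero P.natDegree _ (hP.taylor hh)
    (by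
      have : (Polynomial.taylor h P).coeff P.natDegree = 1 := by
        rw [coeff_taylor_natDegree]; exact hmonic
      rw [this]
      intro hc
      exact one_ne_zero hc.self_of_nhds)
    (.of_forall fun t _ => by rw [← P.eval_eq_eval_taylor_sub, hroot]; rfl)
  have hpun : h =ᶠ[𝓝[≠] 0] u := by
    filter_upwards [hev] with t ht
    exact (sub_eq_zero.1 ht).symm
  refine hh.congr ?_
  exact (ContinuousAt.eventuallyEq_nhds_iff_eventuallyEq_nhdsNE hh.continuousAt
    hu.continuousAt).1 hpun

end FlatFunctions

section FiniteGroup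

open MvPolynomial
open scoped Topology ContDiff

/-- The orbit polynomial `∏ g, (X - (g • x) i)` of the `i`-th coordinate function under a linear
action of a finite group. -/
noncomputable def coordinateOrbitPoly {m : ℕ} {G : Type} [Group G] [Fintype G]
    (ρ : G →* ((Fin m → ℂ) ≃ₗ[ℂ] (Fin m → ℂ))) (i : Fin m) :
    Polynomial (MvPolynomial (Fin m) ℂ) :=
  ∏ g, (Polynomial.X - Polynomial.C (∑ j, C (ρ g (Pi.single j 1) i) * X j))

variable {m : ℕ} {G : Type} [Group G] [Fintype G] (ρ : G →* ((Fin m → ℂ) ≃ₗ[ℂ] (Fin m → ℂ)))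

theorem coordinateOrbitPoly_monic (i : Fin m) : (coordinateOrbitPoly ρ i).Monic :=
  Polynomial.monic_prod_of_monic _ _ fun _ _ => Polynomial.monic_X_sub_C _

theorem coordinateOrbitPoly_eval_X (i : Fin m) : (coordinateOrbitPoly ρ i).eval (X i) = 0 := by
  rw [coordinateOrbitPoly, Polynomial.eval_prod]
  refine Finset.prod_eq_zero (Finset.mem_univ 1) ?_
  simp [Pi.single_apply]

theorem map_eval_coordinateOrbitPoly (i : Fin m) (x : Fin m → ℂ) :
    (coordinateOrbitPoly ρ i).map (eval x) =
      ∏ g, (Polynomial.X - Polynomial.C (ρ g x i)) := by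
  rw [coordinateOrbitPoly, Polynomial.map_prod]
  refine Finset.prod_congr rfl fun g _ => ?_
  have : ρ g x i = ∑ j, ρ g (Pi.single j 1) i * x j := by
    conv_lhs => rw [pi_eq_sum_univ' x]
    simp [Finset.sum_apply, mul_comm]
  simp [this, Polynomial.map_sum]

theorem eval_coeff_coordinateOrbitPoly_map (i : Fin m) (k : ℕ) (h : G) (x : Fin m → ℂ) :
    eval (ρ h x) ((coordinateOrbitPoly ρ i).coeff k) =
      eval x ((coordinateOrbitPoly ρ i).coeff k) := by
  rw [← Polynomial.coeff_map, ← Polynomial.coeff_map, map_eval_coordinateOrbitPoly,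
    map_eval_coordinateOrbitPoly]
  congr 1
  refine Fintype.prod_equiv (Equiv.mulRight h) _ _ fun g => ?_
  simp [map_mul]

/-- A coordinate of a smooth map is analytic if it is a root of a monic polynomial whose coefficients
become analytic along the map. -/
theorem analyticAt_coordinate_of_coeff {q : ℕ} {U : Set (Fin q → ℝ)} (hU : IsOpen U)
    {fb : (Fin q → ℝ) → Fin m → ℂ} {Q : Polynomial (MvPolynomial (Fin m) ℂ)} (hQ : Q.Monic)
    {i : Fin m} (hroot : Q.eval (X i) = 0) (hfb : ContDiffOn ℝ ∞ fb U)
    (hcoeff : ∀ k, AnalyticOnNhd ℝ (fun y => eval (fb y) (Q.coeff k)) U)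
    {x₀ : Fin q → ℝ} (hx₀ : x₀ ∈ U) : AnalyticAt ℝ (fun y => fb y i) x₀ := by
  have hsm : ∀ y ∈ U, ContDiffAt ℝ ∞ (fun y => fb y i) y := fun y hy =>
    contDiffAt_pi.1 (hfb.contDiffAt (hU.mem_nhds hy)) i
  obtain ⟨R, hR, hRU⟩ := Metric.isOpen_iff.1 hU x₀ hx₀
  refine ContDiffAt.analyticAt_of_analyticAt_lines hR (hsm x₀ hx₀) fun v t ht => ?_
  have hγ0 : x₀ + (t + 0) • v ∈ U := hRU (by simpa using ht)
  have hγa : AnalyticAt ℝ (fun s : ℝ => x₀ + (t + s) • v) 0 := by fun_prop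
  set φ : MvPolynomial (Fin m) ℂ →+* (ℝ → ℂ) :=
    RingHom.pi fun s : ℝ => eval (fb (x₀ + (t + s) • v)) with hφ
  have hP : HasAnalyticCoeffs (Q.map φ) := by
    intro k
    rw [Polynomial.coeff_map]
    exact (hcoeff k _ hγ0).comp_of_eq hγa rfl
  have hu : ContDiffAt ℝ ∞ (φ (X i)) 0 := by
    have h1 : φ (X i) = fun s : ℝ => fb (x₀ + (t + s) • v) i := by
      funext s
      exact eval_X i
    rw [h1]
    exact (hsm _ hγ0).comp (0 : ℝ) hγa.contDiffAt
  have hline := hP.analyticAt_of_root (hQ.map φ) hu (by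
    rw [Polynomial.eval_map_apply, hroot, map_zero])
  have hshift : AnalyticAt ℝ (fun s : ℝ => s - t) t := by fun_prop
  refine (hline.comp_of_eq hshift (sub_self t)).congr (.of_forall fun s => ?_)
  change eval (fb (x₀ + (t + (s - t)) • v)) (X i) = _
  rw [eval_X, add_sub_cancel]

end FiniteGroup

/-- Smooth multivariable lifts of real-analytic maps into `σ(ℂ^m)` (finite group)
are real-analytic. -/
theorem stmt11
    {m n : ℕ} {G : Type} [Group G] [Fintype G]
    (ρ : G →* ((Fin m → ℂ) ≃ₗ[ℂ] (Fin m → ℂ)))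
    (σ : Fin n → MvPolynomial (Fin m) ℂ) (deg : Fin n → ℕ)
    (hdeg : ∀ k, 1 ≤ deg k)
    (hhom : ∀ k, (σ k).IsHomogeneous (deg k))
    (hinv : ∀ k g x, MvPolynomial.eval (ρ g x) (σ k) = MvPolynomial.eval x (σ k))
    (hgen : ∀ f : MvPolynomial (Fin m) ℂ,
      (∀ g x, MvPolynomial.eval (ρ g x) f = MvPolynomial.eval x f) →
      ∃ p : MvPolynomial (Fin n) ℂ, MvPolynomial.aeval σ p = f)
    (σm : (Fin m → ℂ) → (Fin n → ℂ))
    (hσm : ∀ x k, σm x k = MvPolynomial.eval x (σ k))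
    {q : ℕ} (U : Set (Fin q → ℝ)) (hU : IsOpen U)
    (f : (Fin q → ℝ) → Fin n → ℂ) (hf : AnalyticOnNhd ℝ f U)
    (hfσ : ∀ x ∈ U, ∃ v : Fin m → ℂ, σm v = f x)
    (fb : (Fin q → ℝ) → Fin m → ℂ) (hfb : ContDiffOn ℝ (⊤:ℕ∞) fb U)
    (hl : ∀ x ∈ U, σm (fb x) = f x) :
    AnalyticOnNhd ℝ fb U := by
  intro x₀ hx₀
  refine analyticAt_pi_iff.2 fun i => ?_
  refine analyticAt_coordinate_of_coeff hU (coordinateOrbitPoly_monic ρ i)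
    (coordinateOrbitPoly_eval_X ρ i) hfb (fun k => ?_) hx₀
  obtain ⟨p, hp⟩ := hgen ((coordinateOrbitPoly ρ i).coeff k)
    fun g x => eval_coeff_coordinateOrbitPoly_map ρ i k g x
  have hpf : AnalyticOnNhd ℝ (fun y => MvPolynomial.aeval (f y) p) U := fun y hy =>
    AnalyticAt.aeval_mvPolynomial (fun j => analyticAt_pi_iff.1 (hf y hy) j) p
  refine hpf.congr hU fun y hy => ?_
  have hfy : f y = fun j => MvPolynomial.eval (fb y) (σ j) := by
    rw [← hl y hy]
    exact funext (hσm (fb y))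
  rw [← hp, ← MvPolynomial.coe_aeval_eq_eval, RingHom.coe_coe, MvPolynomial.comp_aeval_apply, hfy]
  simp only [MvPolynomial.aeval_eq_eval]
end

section
/- If (v_k) is a sequence in ℂ^m such that σ(v_k) → 0 in ℂ^n, then v_k → 0 in ℂ^m. In particular, σ^{-1}(0) = {0}. (This properness of σ at the origin is the key claim used in the paper to prove continuity of lifts at zeros of the curve: for finite G, every neighborhood of 0 in ℂ^m contains a G-invariant neighborhood, and σ(c̄(t_k)) → 0 implies c̄(t_k) → 0.) -/
open MeasureTheory Set Filter

/-- The coordinate orbit polynomial `x ↦ ∏ g, (t - (ρ g x) i)`. -/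
noncomputable def orbitPoly {m : ℕ} {G : Type} [Group G] [Fintype G]
    (ρ : G →* ((Fin m → ℂ) ≃ₗ[ℂ] (Fin m → ℂ))) (i : Fin m) (t : ℂ) :
    MvPolynomial (Fin m) ℂ :=
  ∏ g : G, (MvPolynomial.C t -
    ∑ j, MvPolynomial.X j * MvPolynomial.C (ρ g (Pi.single j 1) i))

theorem eval_orbitPoly {m : ℕ} {G : Type} [Group G] [Fintype G]
    (ρ : G →* ((Fin m → ℂ) ≃ₗ[ℂ] (Fin m → ℂ))) (i : Fin m) (t : ℂ) (x : Fin m → ℂ) :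
    MvPolynomial.eval x (orbitPoly ρ i t) = ∏ g : G, (t - ρ g x i) := by
  simp only [orbitPoly, map_prod, map_sub, map_sum, map_mul, MvPolynomial.eval_C,
    MvPolynomial.eval_X]
  refine Finset.prod_congr rfl fun g _ => ?_
  congr 1
  conv_rhs => rw [pi_eq_sum_univ' x]
  simp [Finset.sum_apply]

theorem eval_orbitPoly_invariant {m : ℕ} {G : Type} [Group G] [Fintype G]
    (ρ : G →* ((Fin m → ℂ) ≃ₗ[ℂ] (Fin m → ℂ))) (i : Fin m) (t : ℂ) (h : G)
    (x : Fin m → ℂ) :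
    MvPolynomial.eval (ρ h x) (orbitPoly ρ i t) =
      MvPolynomial.eval x (orbitPoly ρ i t) := by
  rw [eval_orbitPoly, eval_orbitPoly]
  exact Fintype.prod_equiv (Equiv.mulRight h) _ _ (by simp)

/-- Invariant polynomials separate a nonzero vector from the origin. -/
theorem eq_zero_of_eval_invariant_eq {m : ℕ} {G : Type} [Group G] [Fintype G]
    (ρ : G →* ((Fin m → ℂ) ≃ₗ[ℂ] (Fin m → ℂ))) (x : Fin m → ℂ)
    (hx : ∀ f : MvPolynomial (Fin m) ℂ,
      (∀ g y, MvPolynomial.eval (ρ g y) f = MvPolynomial.eval y f) →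
      MvPolynomial.eval x f = MvPolynomial.eval 0 f) : x = 0 := by
  funext i
  have h := hx (orbitPoly ρ i (x i)) (eval_orbitPoly_invariant ρ i (x i))
  rw [eval_orbitPoly, eval_orbitPoly,
    Finset.prod_eq_zero (Finset.mem_univ (1 : G)) (by simp)] at h
  simpa using h.symm

theorem MvPolynomial.IsHomogeneous.eval_smul_vec {ι R : Type*} [CommSemiring R]
    {f : MvPolynomial ι R} {d : ℕ} (hf : f.IsHomogeneous d) (c : R) (x : ι → R) :
    MvPolynomial.eval (c • x) f = c ^ d * MvPolynomial.eval x f := by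
  rw [MvPolynomial.eval_eq, MvPolynomial.eval_eq, Finset.mul_sum]
  refine Finset.sum_congr rfl fun e he => ?_
  have hd : ∑ k ∈ e.support, e k = d := by
    rw [← hf (MvPolynomial.mem_support_iff.mp he), Finsupp.weight_apply]
    simp [Finsupp.sum]
  simp only [Pi.smul_apply, smul_eq_mul, mul_pow, Finset.prod_mul_distrib,
    Finset.prod_pow_eq_pow_sum, hd]
  ring

/-- Properness of `σ` at the origin (finite group): `σ(vₖ) → 0` implies `vₖ → 0`;
in particular `σ⁻¹(0) = {0}`. -/
theorem stmt15
    {m n : ℕ} {G : Type} [Group G] [Fintype G]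
    (ρ : G →* ((Fin m → ℂ) ≃ₗ[ℂ] (Fin m → ℂ)))
    (σ : Fin n → MvPolynomial (Fin m) ℂ) (deg : Fin n → ℕ)
    (hdeg : ∀ k, 1 ≤ deg k)
    (hhom : ∀ k, (σ k).IsHomogeneous (deg k))
    (hinv : ∀ k g x, MvPolynomial.eval (ρ g x) (σ k) = MvPolynomial.eval x (σ k))
    (hgen : ∀ f : MvPolynomial (Fin m) ℂ,
      (∀ g x, MvPolynomial.eval (ρ g x) f = MvPolynomial.eval x f) →
      ∃ p : MvPolynomial (Fin n) ℂ, MvPolynomial.aeval σ p = f)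
    (σm : (Fin m → ℂ) → (Fin n → ℂ))
    (hσm : ∀ x k, σm x k = MvPolynomial.eval x (σ k))
    :
    (∀ v : ℕ → Fin m → ℂ,
      Tendsto (fun k => σm (v k)) atTop (nhds 0) → Tendsto v atTop (nhds 0)) ∧
    {x : Fin m → ℂ | σm x = 0} = {0} := by
  have hσ0 : σm 0 = 0 := by
    funext k
    have h := (hhom k).eval_smul_vec 0 0
    rw [zero_pow (Nat.one_le_iff_ne_zero.mp (hdeg k)), zero_mul, smul_zero] at h
    rw [hσm, h, Pi.zero_apply]
  have heval : ∀ (p : MvPolynomial (Fin n) ℂ) x,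
      MvPolynomial.eval x (MvPolynomial.aeval σ p) = MvPolynomial.eval (σm x) p := by
    intro p x
    rw [funext (hσm x)]
    induction p using MvPolynomial.induction_on with
    | C a => simp
    | add p q hp hq => simp only [map_add, hp, hq]
    | mul_X p j hp => rw [map_mul, map_mul, map_mul, hp]; simp
  have hzero : ∀ x, σm x = 0 → x = 0 := by
    intro x hx
    refine eq_zero_of_eval_invariant_eq ρ x fun f hf => ?_
    obtain ⟨p, rfl⟩ := hgen f hf
    rw [heval, heval, hx, hσ0]
  have hcont : Continuous σm := by
    refine continuous_pi fun k => ?_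
    simp only [hσm]
    exact MvPolynomial.continuous_eval (σ k)
  refine ⟨fun v hv => ?_, Set.ext fun x => ⟨hzero x, fun h => ?_⟩⟩
  · rw [Metric.tendsto_atTop] at hv ⊢
    intro ε hε
    obtain ⟨c, hc, hcle⟩ : ∃ c > 0, ∀ w ∈ Metric.sphere (0 : Fin m → ℂ) ε, c ≤ ‖σm w‖ := by
      refine (isCompact_sphere (0 : Fin m → ℂ) ε).exists_forall_le' hcont.norm.continuousOn
        fun w hw => norm_pos_iff.mpr fun h => ?_
      rw [hzero w h, mem_sphere_zero_iff_norm, norm_zero] at hw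
      exact hε.ne hw
    obtain ⟨N, hN⟩ := hv c hc
    refine ⟨N, fun k hk => ?_⟩
    by_contra! hlt
    have hk' := hN k hk
    rw [dist_zero_right] at hlt hk'
    have hpos : 0 < ‖v k‖ := hε.trans_le hlt
    have hs0 : 0 ≤ ε / ‖v k‖ := by positivity
    have hs1 : ε / ‖v k‖ ≤ 1 := (div_le_one hpos).mpr hlt
    have hw : ((ε / ‖v k‖ : ℝ) : ℂ) • v k ∈ Metric.sphere (0 : Fin m → ℂ) ε := by
      rw [mem_sphere_zero_iff_norm, norm_smul, Complex.norm_of_nonneg hs0,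
        div_mul_cancel₀ _ hpos.ne']
    refine (hk'.trans_le (hcle _ hw)).not_ge ?_
    refine (pi_norm_le_iff_of_nonneg (norm_nonneg _)).mpr fun j => ?_
    rw [hσm, (hhom j).eval_smul_vec, norm_mul, norm_pow, Complex.norm_of_nonneg hs0, ← hσm]
    exact (mul_le_of_le_one_left (norm_nonneg _) (pow_le_one₀ hs0 hs1)).trans
      (norm_le_pi_norm _ j)
  · rw [Set.mem_singleton_iff.mp h]
    exact hσ0
end
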